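/- Let x > 0. Then, as k → ∞, j_{xk,k}/k − ι(x) = −(π/(4k))·f(x)/√(f(x)²−1) + ζ_x/k² + o(1/k²), where ζ_x is the explicit constant ζ_x = (π/4)·(f(x)/√(f(x)²−1))·(1/(2π²) − ∫₀ˣ Θ₀(t) dt). -/

import Mathlib

open Real Set Filter MeasureTheory

/-- The Bessel function of the first kind,
`J_ν(x) = Σ_{n=0}^∞ ((−1)ⁿ/(n!·Γ(n+ν+1)))·(x/2)^{2n+ν}`. -/
noncomputable def besselJ (ν x : ℝ) : ℝ :=
  ∑' n : ℕ, ((-1 : ℝ)^n / ((n.factorial : ℝ) * Real.Gamma ((n : ℝ) + ν + 1)))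
    * (x/2) ^ (2*(n:ℝ) + ν)

/-- The function `y ↦ π/(√(y²−1) − arccos(1/y))`, a strictly decreasing bijection
from `(1,∞)` onto `(0,∞)`. -/
noncomputable def sigmaF (y : ℝ) : ℝ :=
  Real.pi / (Real.sqrt (y^2 - 1) - Real.arccos (1/y))

/-- `g(t) = arccos(1/t) / √(1 − 1/t²)`. -/
noncomputable def gFun (t : ℝ) : ℝ := Real.arccos (1/t) / Real.sqrt (1 - 1/t^2)

/-- The modified Bessel function of the second kind,
`K_ν(x) = ∫₀^∞ exp(−x cosh t) cosh(ν t) dt`. -/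
noncomputable def besselK (ν x : ℝ) : ℝ :=
  ∫ t in Set.Ioi (0:ℝ), Real.exp (-x * Real.cosh t) * Real.cosh (ν * t)

/-- `Θ₀(t) = −(π/(8t²))·g''(f(t))·f(t)/√(f(t)²−1)
       + (√(f(t)²−1)/(6π t² f(t)³))·∫₀^∞ s³ K₁(s) e^{−s/f(t)} ds`,
where `f` is the inverse of `sigmaF`. -/
noncomputable def theta0 (f : ℝ → ℝ) (t : ℝ) : ℝ :=
  -(Real.pi/(8*t^2)) * deriv (deriv gFun) (f t) * f t / Real.sqrt ((f t)^2 - 1)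
    + (Real.sqrt ((f t)^2 - 1) / (6*Real.pi*t^2*(f t)^3))
      * ∫ s in Set.Ioi (0:ℝ), s^3 * besselK 1 s * Real.exp (-s / f t)

/-- `ζ_x = (π/4)·(f(x)/√(f(x)²−1))·(1/(2π²) − ∫₀ˣ Θ₀(t) dt)`. -/
noncomputable def zetaC (f : ℝ → ℝ) (x : ℝ) : ℝ :=
  (Real.pi/4) * (f x / Real.sqrt ((f x)^2 - 1))
    * (1/(2*Real.pi^2) - ∫ t in (0:ℝ)..x, theta0 f t)

section Part1
open Real Set Filter MeasureTheory
open scoped Nat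

/-! ### Part 1: the Bessel series -/

noncomputable def aB (ν : ℝ) (n : ℕ) : ℝ :=
  (-1 : ℝ)^n / ((n.factorial : ℝ) * Real.Gamma ((n : ℝ) + ν + 1))

noncomputable def hB (ν w : ℝ) : ℝ := ∑' n : ℕ, aB ν n * w ^ n

lemma gamma_lower (ν : ℝ) (hν : 0 ≤ ν) (n : ℕ) :
    Real.Gamma (ν + 1) ≤ Real.Gamma ((n : ℝ) + ν + 1) := by
  induction n with
  | zero => simp
  | succ n ih =>
    have h : ((n + 1 : ℕ) : ℝ) + ν + 1 = ((n : ℝ) + ν + 1) + 1 := by push_cast; ring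
    have hn : (0 : ℝ) ≤ n := Nat.cast_nonneg n
    rw [h, Real.Gamma_add_one (s := (n : ℝ) + ν + 1) (by positivity)]
    have hp : 0 < Real.Gamma ((n : ℝ) + ν + 1) := Real.Gamma_pos_of_pos (by positivity)
    nlinarith

lemma aB_abs_le (ν : ℝ) (hν : 0 ≤ ν) (n : ℕ) :
    |aB ν n| ≤ (Real.Gamma (ν + 1))⁻¹ * (1 / (n.factorial : ℝ)) := by
  have hg : 0 < Real.Gamma (ν + 1) := Real.Gamma_pos_of_pos (by positivity)
  have hg2 : 0 < Real.Gamma ((n : ℝ) + ν + 1) := Real.Gamma_pos_of_pos (by positivity)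
  have hf : (0 : ℝ) < n.factorial := by exact_mod_cast n.factorial_pos
  unfold aB
  rw [abs_div, abs_pow, abs_neg, abs_one, one_pow, abs_of_pos (by positivity),
    ← one_div, div_mul_div_comm, one_mul]
  apply one_div_le_one_div_of_le (by positivity)
  rw [mul_comm]
  exact mul_le_mul_of_nonneg_left (gamma_lower ν hν n) hf.le

lemma aB_term_le (ν : ℝ) (hν : 0 ≤ ν) (w R : ℝ) (hw : |w| ≤ R) (n : ℕ) :
    ‖aB ν n * w ^ n‖ ≤ (Real.Gamma (ν + 1))⁻¹ * (R ^ n / (n.factorial : ℝ)) := by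
  rw [Real.norm_eq_abs, abs_mul, abs_pow]
  have h := aB_abs_le ν hν n
  have hg : 0 < Real.Gamma (ν + 1) := Real.Gamma_pos_of_pos (by positivity)
  calc |aB ν n| * |w| ^ n ≤ ((Real.Gamma (ν + 1))⁻¹ * (1 / (n.factorial : ℝ))) * R ^ n := by
        gcongr
    _ = _ := by ring

lemma aB_summable (ν : ℝ) (hν : 0 ≤ ν) (w : ℝ) : Summable (fun n => aB ν n * w ^ n) :=
  Summable.of_norm_bounded ((Real.summable_pow_div_factorial |w|).mul_left _)
    (fun n => aB_term_le ν hν w |w| le_rfl n)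

lemma aB_succ (ν : ℝ) (n : ℕ) : ((n : ℝ) + 1) * aB ν (n + 1) = - aB (ν + 1) n := by
  unfold aB
  have h : ((n + 1 : ℕ) : ℝ) + ν + 1 = (n : ℝ) + (ν + 1) + 1 := by push_cast; ring
  have hf : (0 : ℝ) < n.factorial := by exact_mod_cast n.factorial_pos
  have hn : ((n : ℝ) + 1) ≠ 0 := by positivity
  rw [h, Nat.factorial_succ, pow_succ]
  push_cast
  by_cases hG : Real.Gamma ((n : ℝ) + (ν + 1) + 1) = 0
  · simp [hG]
  · field_simp

lemma hB_hasDerivAt (ν : ℝ) (hν : 0 ≤ ν) (w : ℝ) : HasDerivAt (hB ν) (-hB (ν + 1) w) w := by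
  have hsum : Summable (fun n : ℕ => (Real.Gamma (ν + 1 + 1))⁻¹ * ((|w| + 1) ^ n / (n.factorial : ℝ))) :=
    (Real.summable_pow_div_factorial _).mul_left _
  have key : HasDerivAt (fun z => ∑' n : ℕ, aB ν (n + 1) * z ^ (n + 1))
      (∑' n : ℕ, -(aB (ν + 1) n * w ^ n)) w := by
    refine hasDerivAt_tsum_of_isPreconnected (t := Metric.ball 0 (|w| + 1))
      (g := fun n z => aB ν (n + 1) * z ^ (n + 1)) (g' := fun n z => -(aB (ν + 1) n * z ^ n))
      hsum Metric.isOpen_ball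
      (convex_ball _ _).isPreconnected ?_ ?_ (y₀ := 0) ?_ ?_ ?_
    · intro n y _
      have := (hasDerivAt_pow (n + 1) y).const_mul (aB ν (n + 1))
      refine this.congr_deriv ?_
      have h := aB_succ ν n
      push_cast
      linear_combination (y ^ n) * h
    · intro n y hy
      rw [norm_neg]
      apply aB_term_le (ν + 1) (by linarith)
      simpa using (mem_ball_zero_iff.mp hy).le
    · simp; positivity
    · simp
    · simp
  rw [tsum_neg] at key
  have h2 : hB ν = fun z => aB ν 0 + ∑' n : ℕ, aB ν (n + 1) * z ^ (n + 1) := by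
    funext z
    unfold hB
    rw [(aB_summable ν hν z).tsum_eq_zero_add]
    simp
  rw [h2]
  exact key.const_add _

lemma aB_rec (ν : ℝ) (hν : 0 ≤ ν) (n : ℕ) : aB ν n = ((n : ℝ) + ν + 1) * aB (ν + 1) n := by
  unfold aB
  have h : (n : ℝ) + (ν + 1) + 1 = ((n : ℝ) + ν + 1) + 1 := by ring
  have hn : (0 : ℝ) ≤ n := Nat.cast_nonneg n
  have hf : (0 : ℝ) < n.factorial := by exact_mod_cast n.factorial_pos
  have hp : 0 < Real.Gamma ((n : ℝ) + ν + 1) := Real.Gamma_pos_of_pos (by positivity)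
  have h3 : 0 < (n : ℝ) + ν + 1 := by positivity
  rw [h, Real.Gamma_add_one (s := (n : ℝ) + ν + 1) (by positivity)]
  field_simp

lemma hB_rec (ν : ℝ) (hν : 0 ≤ ν) (w : ℝ) :
    hB ν w = (ν + 1) * hB (ν + 1) w - w * hB (ν + 2) w := by
  have s1 := aB_summable (ν + 1) (by linarith) w
  have s2 := aB_summable (ν + 2) (by linarith) w
  have e : ∀ n, aB ν (n+1) * w ^ (n+1)
      = (ν + 1) * (aB (ν + 1) (n+1) * w ^ (n+1)) - w * (aB (ν + 2) n * w ^ n) := by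
    intro n
    have h1 := aB_rec ν hν (n+1)
    have h2 := aB_succ (ν + 1) n
    have h3 : ν + 1 + 1 = ν + 2 := by ring
    rw [h3] at h2
    push_cast at h1
    rw [h1]
    linear_combination (w ^ (n+1)) * h2
  unfold hB
  rw [(aB_summable ν hν w).tsum_eq_zero_add, s1.tsum_eq_zero_add, mul_add, ← tsum_mul_left,
    ← tsum_mul_left, add_sub_assoc, ← Summable.tsum_sub]
  · congr 1
    · have h1 := aB_rec ν hν 0
      push_cast at h1
      rw [h1]; ring
    · exact tsum_congr e
  · exact ((summable_nat_add_iff 1).mpr s1).mul_left _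
  · exact s2.mul_left _

lemma besselJ_eq (ν z : ℝ) (hz : 0 < z) : besselJ ν z = (z / 2) ^ ν * hB ν (z ^ 2 / 4) := by
  unfold besselJ hB
  rw [← tsum_mul_left]
  refine tsum_congr fun n => ?_
  have h2 : (z / 2) ^ (2 * (n : ℝ)) = (z ^ 2 / 4) ^ n := by
    rw [Real.rpow_mul (by positivity), Real.rpow_natCast]
    congr 1
    rw [Real.rpow_two]; ring
  rw [Real.rpow_add (by positivity), h2]
  unfold aB
  ring

noncomputable def dJ (ν z : ℝ) : ℝ := ν / z * besselJ ν z - besselJ (ν + 1) z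

lemma besselJ_hasDerivAt (ν : ℝ) (hν : 0 ≤ ν) (z : ℝ) (hz : 0 < z) :
    HasDerivAt (besselJ ν) (dJ ν z) z := by
  have h1 : HasDerivAt (fun z : ℝ => (z / 2) ^ ν) ((1/2) * ν * (z / 2) ^ (ν - 1)) z :=
    ((hasDerivAt_id z).div_const 2).rpow_const (Or.inl (by simp; positivity))
  have h2 : HasDerivAt (fun z : ℝ => z ^ 2 / 4) (z / 2) z := by
    refine ((hasDerivAt_pow 2 z).div_const 4).congr_deriv ?_
    norm_num; ring
  have h3 := h1.mul (HasDerivAt.comp z (hB_hasDerivAt ν hν (z^2/4)) h2)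
  have h4 := h3.congr_of_eventuallyEq (f₁ := besselJ ν) (by
    filter_upwards [lt_mem_nhds hz] with y hy
    simpa using besselJ_eq ν y hy)
  refine h4.congr_deriv ?_
  unfold dJ
  rw [besselJ_eq ν z hz, besselJ_eq (ν + 1) z hz, Real.rpow_add (by positivity),
    Real.rpow_sub (by positivity), Real.rpow_one]
  simp only [Function.comp]
  field_simp
  ring

lemma besselJ_rec (ν : ℝ) (hν : 0 ≤ ν) (z : ℝ) (hz : 0 < z) :
    besselJ ν z = 2 * (ν + 1) / z * besselJ (ν + 1) z - besselJ (ν + 2) z := by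
  rw [besselJ_eq ν z hz, besselJ_eq (ν + 1) z hz, besselJ_eq (ν + 2) z hz, hB_rec ν hν,
    Real.rpow_add (by positivity), Real.rpow_add (by positivity), Real.rpow_one, Real.rpow_two]
  field_simp
  ring

lemma dJ_hasDerivAt (ν : ℝ) (hν : 0 ≤ ν) (z : ℝ) (hz : 0 < z) :
    HasDerivAt (dJ ν) (-(dJ ν z) / z - (1 - ν^2 / z^2) * besselJ ν z) z := by
  have h1 := ((((hasDerivAt_inv hz.ne').const_mul ν)).mul (besselJ_hasDerivAt ν hν z hz)).sub
    (besselJ_hasDerivAt (ν + 1) (by linarith) z hz)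
  refine h1.congr_deriv ?_
  have h2 : besselJ (ν + 1 + 1) z = 2 * (ν + 1) / z * besselJ (ν + 1) z - besselJ ν z := by
    rw [besselJ_rec ν hν z hz, show ν + 1 + 1 = ν + 2 by ring]; ring
  unfold dJ
  rw [h2]
  field_simp
  ring

lemma hB_ne (ν : ℝ) (hν : 0 ≤ ν) (w : ℝ) (hw : 0 ≤ w) : ∃ n : ℕ, hB (ν + n) w ≠ 0 := by
  obtain ⟨n, hn⟩ := exists_nat_gt (Real.exp w)
  refine ⟨n, fun h0 => ?_⟩
  set μ : ℝ := ν + n with hμ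
  have hn0 : (0 : ℝ) ≤ n := Nat.cast_nonneg n
  have hμ0 : 0 ≤ μ := by positivity
  have hg : 0 < Real.Gamma (μ + 1) := Real.Gamma_pos_of_pos (by positivity)
  have hs := aB_summable μ hμ0 w
  unfold hB at h0
  rw [hs.tsum_eq_zero_add] at h0
  have hexp := Real.summable_pow_div_factorial w
  have hE : Real.exp w = ∑' n : ℕ, w ^ n / (n.factorial : ℝ) := by
    rw [Real.exp_eq_exp_ℝ, NormedSpace.exp_eq_tsum_div]
  have hb : ‖∑' j : ℕ, aB μ (j + 1) * w ^ (j + 1)‖ ≤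
      ((μ + 1) * Real.Gamma (μ + 1))⁻¹ * (Real.exp w - 1) := by
    have he : Real.exp w - 1 = ∑' j : ℕ, w ^ (j + 1) / ((j + 1).factorial : ℝ) := by
      rw [hE, hexp.tsum_eq_zero_add]; simp
    rw [he, ← tsum_mul_left]
    refine tsum_of_norm_bounded (Summable.hasSum (((summable_nat_add_iff 1).mpr hexp).mul_left _)) ?_
    intro j
    have h1 : Real.Gamma (((j + 1 : ℕ) : ℝ) + μ + 1) ≥ (μ + 1) * Real.Gamma (μ + 1) := by
      rw [← Real.Gamma_add_one (by positivity)]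
      have := gamma_lower (μ + 1) (by positivity) j
      calc _ ≤ _ := this
        _ = _ := by push_cast; ring_nf
    have hf : (0 : ℝ) < (j+1).factorial := by exact_mod_cast (j+1).factorial_pos
    have hg2 : 0 < (μ + 1) * Real.Gamma (μ + 1) := by positivity
    rw [norm_mul, Real.norm_eq_abs, Real.norm_eq_abs, abs_pow, abs_of_nonneg hw]
    unfold aB
    rw [abs_div, abs_pow, abs_neg, abs_one, one_pow, abs_of_pos (mul_pos hf (by linarith))]
    calc 1 / (((j+1).factorial : ℝ) * Real.Gamma (((j + 1 : ℕ) : ℝ) + μ + 1)) * w ^ (j + 1)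
        ≤ 1 / (((j+1).factorial : ℝ) * ((μ + 1) * Real.Gamma (μ + 1))) * w ^ (j + 1) := by
          gcongr
      _ = _ := by field_simp
  have h1 : aB μ 0 = (Real.Gamma (μ + 1))⁻¹ := by simp [aB]
  have h2 : ∑' j : ℕ, aB μ (j + 1) * w ^ (j + 1) = -(Real.Gamma (μ + 1))⁻¹ := by
    rw [h1] at h0; linarith
  rw [h2, norm_neg, Real.norm_eq_abs, abs_of_pos (by positivity)] at hb
  have h3 : μ + 1 ≤ Real.exp w - 1 := by
    rw [mul_inv, mul_assoc, mul_comm (Real.Gamma (μ + 1))⁻¹, ← mul_assoc] at hb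
    have := le_of_mul_le_mul_right ((one_mul _).trans_le hb) (inv_pos.mpr hg)
    rw [inv_mul_eq_div, le_div_iff₀ (by positivity)] at this
    linarith
  linarith

lemma besselJ_simple (ν : ℝ) (hν : 0 ≤ ν) (z : ℝ) (hz : 0 < z) (h : besselJ ν z = 0) :
    dJ ν z ≠ 0 := by
  intro h'
  unfold dJ at h'
  rw [h] at h'
  have h1 : besselJ (ν + 1) z = 0 := by linarith
  have key : ∀ n : ℕ, besselJ (ν + n) z = 0 ∧ besselJ (ν + n + 1) z = 0 := by
    intro n
    induction n with
    | zero => simpa using ⟨h, h1⟩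
    | succ n ih =>
      have hr := besselJ_rec (ν + n) (by positivity) z hz
      push_cast
      rw [ih.1, ih.2] at hr
      refine ⟨by rw [← ih.2]; ring_nf, ?_⟩
      rw [show ν + ((n:ℝ) + 1) + 1 = ν + n + 2 by ring]
      linarith
  obtain ⟨n, hn⟩ := hB_ne ν hν (z^2/4) (by positivity)
  apply hn
  have := (key n).1
  rw [besselJ_eq _ z hz] at this
  exact (mul_eq_zero.mp this).resolve_left (by positivity)

lemma besselJ_tendsto_zero (ν : ℝ) (hν : 0 < ν) :
    Tendsto (besselJ ν) (nhdsWithin 0 (Ioi 0)) (nhds 0) := by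
  have h1 : ContinuousAt (fun z : ℝ => (z/2) ^ ν * hB ν (z^2/4)) 0 := by
    refine ContinuousAt.mul ?_ ?_
    · exact ContinuousAt.rpow_const (by fun_prop) (Or.inr hν.le)
    · exact ContinuousAt.comp (f := fun z : ℝ => z^2/4) (g := hB ν)
        ((hB_hasDerivAt ν hν.le _).continuousAt) (by fun_prop)
  have h2 : Tendsto (fun z : ℝ => (z/2) ^ ν * hB ν (z^2/4)) (nhdsWithin 0 (Ioi 0)) (nhds 0) := by
    have := h1.tendsto
    simp only [zero_div, Real.zero_rpow hν.ne', zero_mul] at this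
    exact this.mono_left nhdsWithin_le_nhds
  refine h2.congr' ?_
  filter_upwards [self_mem_nhdsWithin] with z hz
  exact (besselJ_eq ν z hz).symm

lemma zdJ_tendsto_zero (ν : ℝ) (hν : 0 < ν) :
    Tendsto (fun z => z * dJ ν z) (nhdsWithin 0 (Ioi 0)) (nhds 0) := by
  have hid : Tendsto (fun z : ℝ => z) (nhdsWithin 0 (Ioi 0)) (nhds 0) :=
    tendsto_id.mono_left nhdsWithin_le_nhds
  have h := ((besselJ_tendsto_zero ν hν).const_mul ν).sub
    (hid.mul (besselJ_tendsto_zero (ν + 1) (by linarith)))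
  simp only [mul_zero, sub_zero] at h
  refine h.congr' ?_
  filter_upwards [self_mem_nhdsWithin] with z hz
  have hz' : (0:ℝ) < z := hz
  unfold dJ
  field_simp

lemma besselJ_half (z : ℝ) (hz : 0 < z) :
    besselJ (1/2) z = √(2 / (π * z)) * Real.sin z := by
  have h := (Real.hasSum_sin z).mul_left (√(2 / (π * z)))
  rw [← h.tsum_eq]
  unfold besselJ
  refine tsum_congr fun n => ?_
  have hG : Real.Gamma ((n : ℝ) + 1/2 + 1) = (2 * n + 1 : ℕ)‼ * √π / 2 ^ (n + 1) := by
    rw [← Real.Gamma_nat_add_one_add_half]; ring_nf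
  have hfac : ((2 * n + 1).factorial : ℝ) = (2 * n + 1 : ℕ)‼ * (2 ^ n * n.factorial) := by
    have := Nat.factorial_eq_mul_doubleFactorial (2 * n)
    rw [Nat.doubleFactorial_two_mul] at this
    exact_mod_cast this
  have hpw : (z / 2) ^ (2 * (n : ℝ) + 1/2) = (z/2) ^ (2 * n) * √(z / 2) := by
    rw [Real.rpow_add (by positivity), Real.sqrt_eq_rpow, ← Real.rpow_natCast]
    push_cast; rfl
  rw [hG, hfac, hpw]
  have hd : (0 : ℝ) < (2 * n + 1 : ℕ)‼ := by exact_mod_cast Nat.doubleFactorial_pos _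
  have hf : (0 : ℝ) < n.factorial := by exact_mod_cast n.factorial_pos
  have hsq : √(2 / (π * z)) = √(z/2) * 2 / (√π * z) := by
    rw [Real.sqrt_eq_iff_mul_self_eq_of_pos (by positivity)]
    rw [show (√(z/2) * 2 / (√π * z)) * (√(z/2) * 2 / (√π * z)) =
      (√(z/2)) ^ 2 * 4 / ((√π) ^ 2 * z ^ 2) by ring, Real.sq_sqrt (by positivity),
      Real.sq_sqrt (by positivity)]
    field_simp; norm_num
  rw [hsq]
  have hpi : 0 < √π := by positivity
  rw [div_pow]
  field_simp
  ring_nf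
end Part1

section Part2
open Real Set Filter MeasureTheory
open scoped Nat

/-! ### Part 2: Liouville-Green phase analysis -/

noncomputable def cF (y : ℝ) : ℝ := 1 / √(y^2 - 1)
noncomputable def TF (y : ℝ) : ℝ := √(y^2 - 1) - Real.arccos (1/y)
noncomputable def PF (y : ℝ) : ℝ := (3 * cF y + 5 * (cF y)^3) / 24
noncomputable def kF (y : ℝ) : ℝ := ((cF y)^2 + 6 * (cF y)^4 + 5 * (cF y)^6) / 4
noncomputable def rF (y : ℝ) : ℝ := y * ((cF y)^3 + 5 * (cF y)^5) / 4

lemma sqm_pos {y : ℝ} (hy : 1 < y) : 0 < y^2 - 1 := by nlinarith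

lemma cF_pos {y : ℝ} (hy : 1 < y) : 0 < cF y := by
  have := sqm_pos hy
  unfold cF; positivity

lemma cF_rel {y : ℝ} (hy : 1 < y) : y^2 * (cF y)^2 = 1 + (cF y)^2 := by
  have h := sqm_pos hy
  unfold cF
  rw [div_pow, Real.sq_sqrt h.le]
  field_simp
  ring

lemma sqrtm_hasDerivAt {y : ℝ} (hy : 1 < y) :
    HasDerivAt (fun y : ℝ => √(y^2 - 1)) (y * cF y) y := by
  have h := sqm_pos hy
  have h1 : HasDerivAt (fun y : ℝ => y^2 - 1) (2 * y) y := by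
    simpa using (hasDerivAt_pow 2 y).sub_const 1
  refine (h1.sqrt h.ne').congr_deriv ?_
  unfold cF
  field_simp

lemma cF_hasDerivAt {y : ℝ} (hy : 1 < y) : HasDerivAt cF (-(y * (cF y)^3)) y := by
  have h := sqm_pos hy
  have hs : 0 < √(y^2 - 1) := by positivity
  have h1 := (sqrtm_hasDerivAt hy).inv hs.ne'
  have h2 : cF = (fun y : ℝ => √(y^2 - 1))⁻¹ := by
    funext y; simp [cF]
  rw [h2]
  refine h1.congr_deriv ?_
  simp only [Pi.inv_apply]
  unfold cF
  field_simp

lemma beta_hasDerivAt {y : ℝ} (hy : 1 < y) :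
    HasDerivAt (fun y : ℝ => Real.arccos (1/y)) (cF y / y) y := by
  have h := sqm_pos hy
  have hy0 : 0 < y := by linarith
  have hs : 0 < √(y^2 - 1) := by positivity
  have h1 : HasDerivAt (fun y : ℝ => 1/y) (-(y^2)⁻¹) y := by
    simpa using hasDerivAt_inv hy0.ne'
  have hlt : 1/y < 1 := by rw [div_lt_one hy0]; exact hy
  have hgt : 0 < 1/y := by positivity
  have h2 := (Real.hasDerivAt_arccos (x := 1/y) (by linarith) (by linarith)).comp y h1
  refine h2.congr_deriv ?_
  have h3 : √(1 - (1/y)^2) = √(y^2 - 1) / y := by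
    rw [show 1 - (1/y)^2 = (y^2 - 1)/y^2 by field_simp, Real.sqrt_div h.le, Real.sqrt_sq hy0.le]
  rw [h3]
  unfold cF
  field_simp

lemma TF_hasDerivAt {y : ℝ} (hy : 1 < y) : HasDerivAt TF (1 / (y * cF y)) y := by
  refine ((sqrtm_hasDerivAt hy).sub (beta_hasDerivAt hy)).congr_deriv ?_
  have hc := cF_pos hy
  have hr := cF_rel hy
  have hy0 : 0 < y := by linarith
  field_simp
  linarith

lemma PF_hasDerivAt {y : ℝ} (hy : 1 < y) : HasDerivAt PF (-(rF y / 2)) y := by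
  have h := cF_hasDerivAt hy
  have h1 := ((h.const_mul 3).add ((h.pow 3).const_mul 5)).div_const 24
  refine h1.congr_deriv ?_
  unfold rF
  norm_num
  ring

noncomputable def dk (y : ℝ) : ℝ := -(y * ((cF y)^4 + 12 * (cF y)^6 + 15 * (cF y)^8) / 2)

lemma kF_hasDerivAt {y : ℝ} (hy : 1 < y) : HasDerivAt kF (dk y) y := by
  have h := cF_hasDerivAt hy
  have h1 := (((h.pow 2).add ((h.pow 4).const_mul 6)).add ((h.pow 6).const_mul 5)).div_const 4
  refine h1.congr_deriv ?_
  unfold dk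
  norm_num
  ring

lemma kF_eq {y : ℝ} (hy : 1 < y) : kF y = rF y * (y * cF y) := by
  have hr := cF_rel hy
  unfold kF rF
  linear_combination (-(cF y)^2/4 - 5 * (cF y)^4 / 4) * hr

lemma cF_bound {y0 y : ℝ} (h0 : 1 < y0) (hy : y0 ≤ y) : cF y ≤ (1 + cF y0) / y := by
  have hy1 : 1 < y := by linarith
  have hy0 : 0 < y := by linarith
  have hc := cF_pos hy1
  have hc0 := cF_pos h0
  have hr := cF_rel hy1
  have hle : cF y ≤ cF y0 := by
    unfold cF
    have := sqm_pos h0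
    apply one_div_le_one_div_of_le (by positivity)
    apply Real.sqrt_le_sqrt
    nlinarith
  rw [le_div_iff₀ hy0]
  have h1 : (cF y * y)^2 ≤ (1 + cF y0)^2 := by nlinarith
  exact abs_le_of_sq_le_sq' h1 (by linarith) |>.2

/-- system for the Liouville-Green variables -/
noncomputable def wA (ν y : ℝ) : ℝ := √(√(y^2 - 1)) * besselJ ν (ν * y)
noncomputable def wB (ν y : ℝ) : ℝ :=
  -(y^2 / (2 * ν * (√(√(y^2 - 1)))^5) * besselJ ν (ν * y)) - y / √(√(y^2 - 1)) * dJ ν (ν * y)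

lemma qrt_facts {y : ℝ} (hy : 1 < y) : 0 < √(√(y^2 - 1)) ∧ (√(√(y^2 - 1)))^4 = y^2 - 1 ∧
    cF y = 1 / (√(√(y^2 - 1)))^2 ∧
    HasDerivAt (fun y : ℝ => √(√(y^2 - 1))) (y / (2 * (√(√(y^2 - 1)))^3)) y := by
  have h := sqm_pos hy
  have hs : 0 < √(y^2 - 1) := by positivity
  have h2 : (√(√(y^2 - 1)))^2 = √(y^2 - 1) := Real.sq_sqrt hs.le
  have hq : 0 < √(√(y^2 - 1)) := by positivity
  refine ⟨hq, ?_, ?_, ?_⟩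
  · rw [show 4 = 2 * 2 from rfl, pow_mul, h2, Real.sq_sqrt h.le]
  · rw [h2]; rfl
  · refine ((sqrtm_hasDerivAt hy).sqrt hs.ne').congr_deriv ?_
    unfold cF
    rw [show (√(√(y^2 - 1)))^3 = (√(√(y^2 - 1)))^2 * √(√(y^2 - 1)) by ring, h2]
    field_simp

lemma wA_hasDerivAt {ν y : ℝ} (hν : 0 < ν) (hy : 1 < y) :
    HasDerivAt (wA ν) (-(ν / (y * cF y) * wB ν y)) y := by
  obtain ⟨hq, hq4, hc, hd⟩ := qrt_facts hy
  have hy0 : 0 < y := by linarith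
  have hJ : HasDerivAt (fun y => besselJ ν (ν * y)) (dJ ν (ν * y) * ν) y :=
    (besselJ_hasDerivAt ν hν.le (ν * y) (by positivity)).comp y
      (by simpa using (hasDerivAt_id y).const_mul ν)
  refine (hd.mul hJ).congr_deriv ?_
  rw [hc]
  unfold wB
  set s := √(√(y^2 - 1))
  field_simp
  ring

lemma wB_hasDerivAt {ν y : ℝ} (hν : 0 < ν) (hy : 1 < y) :
    HasDerivAt (wB ν) ((ν / (y * cF y) + rF y / ν) * wA ν y) y := by
  obtain ⟨hq, hq4, hc, hd⟩ := qrt_facts hy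
  have hy0 : 0 < y := by linarith
  have hJ : HasDerivAt (fun y => besselJ ν (ν * y)) (dJ ν (ν * y) * ν) y :=
    (besselJ_hasDerivAt ν hν.le (ν * y) (by positivity)).comp y
      (by simpa using (hasDerivAt_id y).const_mul ν)
  have hJ2 : HasDerivAt (fun y => dJ ν (ν * y))
      ((-(dJ ν (ν * y)) / (ν * y) - (1 - ν^2 / (ν * y)^2) * besselJ ν (ν * y)) * ν) y :=
    (dJ_hasDerivAt ν hν.le (ν * y) (by positivity)).comp y
      (by simpa using (hasDerivAt_id y).const_mul ν)
  have h1 := (hasDerivAt_pow 2 y).div ((hd.pow 5).const_mul (2 * ν)) (mul_ne_zero (by positivity) (pow_ne_zero 5 hq.ne'))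
  have h2 := (hasDerivAt_id y).div hd hq.ne'
  have h3 := ((h1.mul hJ).neg).sub (h2.mul hJ2)
  refine h3.congr_deriv ?_
  unfold rF wA
  rw [hc]
  simp only [Pi.pow_apply, Pi.div_apply, id]
  set s := √(√(y^2 - 1)) with hs
  generalize besselJ ν (ν * y) = j
  generalize dJ ν (ν * y) = d
  have hy2 : y^2 = 1 + s^4 := by linarith
  norm_num
  field_simp
  have e4 : y^4 = (1+s^4)^2 := by rw [← hy2]; ring
  have e3 : y^3 = y * (1+s^4) := by rw [← hy2]; ring
  ring_nf
  simp only [e4, e3, hy2]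
  ring

lemma wAB_pos {ν y : ℝ} (hν : 0 < ν) (hy : 1 < y) : 0 < (wA ν y)^2 + (wB ν y)^2 := by
  obtain ⟨hq, hq4, hc, hd⟩ := qrt_facts hy
  have hy0 : 0 < y := by linarith
  rcases eq_or_ne (besselJ ν (ν * y)) 0 with h | h
  · have h2 := besselJ_simple ν hν.le (ν * y) (by positivity) h
    have : wB ν y ≠ 0 := by
      unfold wB
      rw [h]
      have := mul_ne_zero (div_pos hy0 hq).ne' h2
      simpa using this
    positivity
  · have : wA ν y ≠ 0 := mul_ne_zero hq.ne' h
    positivity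
end Part2

section Part3
open Real Set Filter MeasureTheory
open scoped Nat

lemma angle_lift (A B a b : ℝ → ℝ)
    (hA : ∀ y, 1 < y → HasDerivAt A (-(a y * B y)) y)
    (hB : ∀ y, 1 < y → HasDerivAt B (b y * A y) y)
    (ha : ContinuousOn a (Ioi 1)) (hb : ContinuousOn b (Ioi 1))
    (hr : ∀ y, 1 < y → 0 < (A y)^2 + (B y)^2) :
    ∃ θ : ℝ → ℝ, ∀ y, 1 < y →
      HasDerivAt θ (a y + (b y - a y) * (Real.cos (θ y))^2) y ∧
      (Real.cos (θ y))^2 * ((A y)^2 + (B y)^2) = (A y)^2 := by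
  have hAc : ContinuousOn A (Ioi 1) := fun y hy => (hA y hy).continuousAt.continuousWithinAt
  have hBc : ContinuousOn B (Ioi 1) := fun y hy => (hB y hy).continuousAt.continuousWithinAt
  set G : ℝ → ℝ := fun y => (a y * (B y)^2 + b y * (A y)^2) / ((A y)^2 + (B y)^2) with hG
  have hGc : ContinuousOn G (Ioi 1) := by
    apply ContinuousOn.div
    · exact (ha.mul (hBc.pow 2)).add (hb.mul (hAc.pow 2))
    · exact (hAc.pow 2).add (hBc.pow 2)
    · intro y hy; exact (hr y hy).ne'
  set θ0 : ℝ := Complex.arg ⟨A 2, B 2⟩ with hθ0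
  set θ : ℝ → ℝ := fun y => θ0 + ∫ t in (2:ℝ)..y, G t with hθ
  have hθd : ∀ y, 1 < y → HasDerivAt θ (G y) y := by
    intro y hy
    apply HasDerivAt.const_add
    have hsub : uIcc 2 y ⊆ Ioi (1:ℝ) := by
      intro t ht
      have := ht.1
      have h2 : (1:ℝ) < min 2 y := lt_min (by norm_num) hy
      exact lt_of_lt_of_le h2 this
    apply intervalIntegral.integral_hasDerivAt_right
    · exact (hGc.mono hsub).intervalIntegrable
    · exact hGc.stronglyMeasurableAtFilter isOpen_Ioi y hy
    · exact hGc.continuousAt (isOpen_Ioi.mem_nhds hy)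
  set V : ℝ → ℝ := fun y => (A y * Real.sin (θ y) - B y * Real.cos (θ y))^2 / ((A y)^2 + (B y)^2)
    with hV
  have hVd : ∀ y, 1 < y → HasDerivAt V 0 y := by
    intro y hy
    have h1 := (((hA y hy).mul (hθd y hy).sin).sub ((hB y hy).mul (hθd y hy).cos)).pow 2
    have h2 := ((hA y hy).pow 2).add ((hB y hy).pow 2)
    refine (h1.div h2 (hr y hy).ne').congr_deriv ?_
    simp only [hG, Pi.sub_apply, Pi.mul_apply, Pi.add_apply, Pi.pow_apply]
    have := (hr y hy).ne'
    norm_num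
    left
    field_simp
    ring
  have hV0 : V 2 = 0 := by
    have hz : θ 2 = θ0 := by simp [hθ]
    simp only [hV]
    rw [hz, hθ0]
    have hne : (⟨A 2, B 2⟩ : ℂ) ≠ 0 := by
      intro h
      have h1 := congrArg Complex.re h
      have h2 := congrArg Complex.im h
      simp at h1 h2
      have := hr 2 (by norm_num)
      rw [h1, h2] at this
      norm_num at this
    rw [Complex.sin_arg, Complex.cos_arg hne]
    simp only
    have : A 2 * (B 2 / ‖(⟨A 2, B 2⟩ : ℂ)‖) - B 2 * (A 2 / ‖(⟨A 2, B 2⟩ : ℂ)‖) = 0 := by ring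
    rw [this]; simp
  have hVz : ∀ y, 1 < y → V y = 0 := by
    intro y hy
    rw [← hV0]
    apply IsOpen.is_const_of_deriv_eq_zero (s := Ioi (1:ℝ)) isOpen_Ioi isPreconnected_Ioi
    · intro t ht; exact (hVd t ht).differentiableAt.differentiableWithinAt
    · intro t ht; exact (hVd t ht).deriv
    · exact hy
    · norm_num
  refine ⟨θ, fun y hy => ?_⟩
  have h0 := hVz y hy
  have hrr := (hr y hy)
  have h1 : A y * Real.sin (θ y) = B y * Real.cos (θ y) := by
    simp only [hV] at h0
    rcases div_eq_zero_iff.mp h0 with h | h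
    · have := pow_eq_zero_iff (two_ne_zero) |>.mp h
      linarith
    · exact absurd h hrr.ne'
  have h2 : (Real.cos (θ y))^2 * ((A y)^2 + (B y)^2) = (A y)^2 := by
    have h3 := Real.sin_sq_add_cos_sq (θ y)
    linear_combination (A y)^2 * h3 - (A y * Real.sin (θ y) + B y * Real.cos (θ y)) * h1
  refine ⟨(hθd y hy).congr_deriv ?_, h2⟩
  simp only [hG]
  rw [div_eq_iff hrr.ne']
  linear_combination (- (b y - a y)) * h2

lemma theta_exists (ν : ℝ) (hν : 0 < ν) : ∃ θ : ℝ → ℝ, ∀ y, 1 < y →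
    HasDerivAt θ (ν / (y * cF y) + rF y / ν * (Real.cos (θ y))^2) y ∧
    (besselJ ν (ν * y) = 0 ↔ Real.cos (θ y) = 0) := by
  have hc : ContinuousOn cF (Ioi 1) := fun y hy => (cF_hasDerivAt hy).continuousAt.continuousWithinAt
  have hac : ContinuousOn (fun y => ν / (y * cF y)) (Ioi 1) := by
    apply ContinuousOn.div continuousOn_const (continuousOn_id.mul hc)
    intro y hy
    have hy' : (1:ℝ) < y := hy
    exact mul_ne_zero (by simp only [id]; linarith) (cF_pos hy').ne'
  have hrc : ContinuousOn (fun y => rF y / ν) (Ioi 1) := by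
    unfold rF
    fun_prop
  obtain ⟨θ, hθ⟩ := angle_lift (wA ν) (wB ν) (fun y => ν / (y * cF y))
    (fun y => ν / (y * cF y) + rF y / ν) (fun y hy => wA_hasDerivAt hν hy)
    (fun y hy => wB_hasDerivAt hν hy) hac (hac.add hrc) (fun y hy => wAB_pos hν hy)
  refine ⟨θ, fun y hy => ⟨?_, ?_⟩⟩
  · refine (hθ y hy).1.congr_deriv ?_
    ring
  · have h2 := (hθ y hy).2
    have hp := wAB_pos hν hy
    have hq := (qrt_facts hy).1
    have hAe : wA ν y = 0 ↔ besselJ ν (ν * y) = 0 := by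
      unfold wA
      simp [hq.ne']
    rw [← hAe]
    constructor
    · intro h
      rw [h] at h2
      have : (Real.cos (θ y))^2 = 0 := by
        have h3 : (0:ℝ)^2 = 0 := by norm_num
        rcases mul_eq_zero.mp (h2.trans h3) with h4 | h4
        · exact h4
        · rw [h] at hp; linarith
      exact pow_eq_zero_iff two_ne_zero |>.mp this
    · intro h
      rw [h] at h2
      have : (wA ν y)^2 = 0 := by rw [← h2]; ring
      exact pow_eq_zero_iff two_ne_zero |>.mp this

noncomputable def Cb (y0 : ℝ) : ℝ := 6 * (1 + cF y0) ^ 11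

noncomputable def DF (ν : ℝ) (θ : ℝ → ℝ) (y : ℝ) : ℝ :=
  θ y - kF y / (4 * ν^2) * Real.sin (2 * θ y) - ν * TF y + PF y / ν

lemma DF_hasDerivAt {ν : ℝ} (hν : 0 < ν) (θ : ℝ → ℝ) {y : ℝ} (hy : 1 < y)
    (hθ : HasDerivAt θ (ν / (y * cF y) + rF y / ν * (Real.cos (θ y))^2) y) :
    HasDerivAt (DF ν θ) (-(dk y / (4 * ν^2) * Real.sin (2 * θ y))
      - kF y * rF y / (2 * ν^3) * Real.cos (2 * θ y) * (Real.cos (θ y))^2) y := by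
  have h1 := (hθ.sub (((kF_hasDerivAt hy).div_const (4 * ν^2)).mul (hθ.const_mul 2).sin)).sub
    ((TF_hasDerivAt hy).const_mul ν)
  have h2 := h1.add ((PF_hasDerivAt hy).div_const ν)
  refine h2.congr_deriv ?_
  have hk := kF_eq hy
  have hc := cF_pos hy
  have hy0 : 0 < y := by linarith
  have hcos := Real.cos_two_mul (θ y)
  have hk2 : kF y * (ν / (y * cF y)) = rF y * ν := by
    rw [hk]; field_simp
  have e1 : kF y / (4 * ν^2) * (Real.cos (2 * θ y) * (2 * (ν / (y * cF y) + rF y / ν * (Real.cos (θ y))^2)))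
      = rF y / (2 * ν) * Real.cos (2 * θ y) + kF y * rF y / (2 * ν^3) * Real.cos (2 * θ y) * (Real.cos (θ y))^2 := by
    have : kF y / (4 * ν^2) * (Real.cos (2 * θ y) * (2 * (ν / (y * cF y) + rF y / ν * (Real.cos (θ y))^2)))
      = (kF y * (ν / (y * cF y))) * Real.cos (2 * θ y) / (2 * ν^2) + kF y * rF y / (2 * ν^3) * Real.cos (2 * θ y) * (Real.cos (θ y))^2 := by
      field_simp
      ring
    rw [this, hk2]
    field_simp
  rw [e1, hcos]
  field_simp
  ring

lemma DF_deriv_bound {ν : ℝ} (hν : 0 < ν) (t y0 : ℝ) (h0 : 1 < y0) {y : ℝ} (hy : y0 ≤ y) :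
    |-(dk y / (4 * ν^2) * Real.sin (2 * t))
      - kF y * rF y / (2 * ν^3) * Real.cos (2 * t) * (Real.cos t)^2| ≤
      Cb y0 * (1 / ν^2 + 1/ν^3) * (1 / y^2) := by
  have hy1 : 1 < y := by linarith
  have hyp : 0 < y := by linarith
  have hc := cF_pos hy1
  have hb := cF_bound h0 hy
  have hK : 1 ≤ 1 + cF y0 := by linarith [cF_pos h0]
  have hKpow : ∀ n m : ℕ, n ≤ m → (1 + cF y0)^n ≤ (1 + cF y0)^m := fun n m h => pow_le_pow_right₀ hK h
  set K := 1 + cF y0 with hKdef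
  have hcn : ∀ n : ℕ, 4 ≤ n → n ≤ 11 → cF y ^ n ≤ K ^ 11 / y ^ 4 := by
    intro n h4 h11
    calc cF y ^ n ≤ (K / y)^n := pow_le_pow_left₀ hc.le hb n
      _ = K^n / y^n := div_pow _ _ _
      _ ≤ K ^ 11 / y ^ 4 := by
        apply div_le_div₀ (by positivity) (hKpow n 11 h11) (by positivity)
        exact pow_le_pow_right₀ hy1.le h4
  have hsin : |Real.sin (2 * t)| ≤ 1 := Real.abs_sin_le_one _
  have hcos : |Real.cos (2 * t) * (Real.cos t)^2| ≤ 1 := by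
    rw [abs_mul, abs_pow]
    have h1 := Real.abs_cos_le_one (2 * t)
    have h2 := Real.abs_cos_le_one t
    calc |Real.cos (2 * t)| * |Real.cos t| ^ 2 ≤ 1 * 1^2 := by gcongr
      _ = 1 := by norm_num
  have hdk : |dk y| ≤ 24 * K^11 * (1/y^2) := by
    unfold dk
    rw [abs_neg, abs_of_pos (by positivity)]
    have a1 := hcn 4 (by norm_num) (by norm_num)
    have a2 := hcn 6 (by norm_num) (by norm_num)
    have a3 := hcn 8 (by norm_num) (by norm_num)
    have : y * (cF y ^ 4 + 12 * cF y ^ 6 + 15 * cF y ^ 8) / 2 ≤ y * (28 * (K^11/y^4)) / 2 := by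
      gcongr; linarith
    refine this.trans ?_
    have e : y * (28 * (K^11/y^4)) / 2 = 14 * K^11 * (1/y^2) * (1/y) := by field_simp; norm_num
    rw [e]
    have h1y : 1 / y ≤ 1 := by rw [div_le_one hyp]; exact hy1.le
    have : 0 ≤ K^11 * (1/y^2) := by positivity
    nlinarith
  have hkr : |kF y * rF y| ≤ 12 * K^11 * (1/y^2) := by
    have hk0 : 0 ≤ kF y := by unfold kF; positivity
    have hr0 : 0 ≤ rF y := by unfold rF; positivity
    rw [abs_of_nonneg (by positivity), kF_eq hy1]
    have e : rF y * (y * cF y) * rF y = y^3 * (cF y^7 + 10 * cF y^9 + 25 * cF y^11) / 16 := by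
      unfold rF; ring
    rw [e]
    have a1 := hcn 7 (by norm_num) (by norm_num)
    have a2 := hcn 9 (by norm_num) (by norm_num)
    have b1 : cF y ^ 7 ≤ K ^ 11 / y ^ 5 := by
      calc cF y ^ 7 ≤ (K / y)^7 := pow_le_pow_left₀ hc.le hb 7
        _ = K^7 / y^7 := div_pow _ _ _
        _ ≤ K ^ 11 / y ^ 5 := by
          apply div_le_div₀ (by positivity) (hKpow 7 11 (by norm_num)) (by positivity)
          exact pow_le_pow_right₀ hy1.le (by norm_num)
    have b2 : cF y ^ 9 ≤ K ^ 11 / y ^ 5 := by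
      calc cF y ^ 9 ≤ (K / y)^9 := pow_le_pow_left₀ hc.le hb 9
        _ = K^9 / y^9 := div_pow _ _ _
        _ ≤ K ^ 11 / y ^ 5 := by
          apply div_le_div₀ (by positivity) (hKpow 9 11 (by norm_num)) (by positivity)
          exact pow_le_pow_right₀ hy1.le (by norm_num)
    have b3 : cF y ^ 11 ≤ K ^ 11 / y ^ 5 := by
      calc cF y ^ 11 ≤ (K / y)^11 := pow_le_pow_left₀ hc.le hb 11
        _ = K^11 / y^11 := div_pow _ _ _
        _ ≤ K ^ 11 / y ^ 5 := by
          apply div_le_div₀ (by positivity) le_rfl (by positivity)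
          exact pow_le_pow_right₀ hy1.le (by norm_num)
    calc _ ≤ y^3 * (36 * (K^11 / y^5)) / 16 := by gcongr; linarith
      _ = (36/16) * (K^11 * (1/y^2)) := by field_simp
      _ ≤ 12 * (K^11 * (1/y^2)) := by
        have : 0 ≤ K^11 * (1/y^2) := by positivity
        nlinarith
      _ = _ := by ring
  have f1 : |dk y / (4 * ν^2) * Real.sin (2 * t)| ≤ 6 * K^11 * (1/y^2) * (1/ν^2) := by
    rw [abs_mul, abs_div, abs_of_pos (show (0:ℝ) < 4 * ν^2 by positivity)]
    calc |dk y| / (4 * ν^2) * |Real.sin (2 * t)| ≤ (24 * K^11 * (1/y^2)) / (4 * ν^2) * 1 := by gcongr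
      _ = _ := by field_simp; norm_num
  have f2 : |kF y * rF y / (2 * ν^3) * Real.cos (2 * t) * (Real.cos t)^2| ≤ 6 * K^11 * (1/y^2) * (1/ν^3) := by
    rw [mul_assoc, abs_mul, abs_div, abs_of_pos (show (0:ℝ) < 2 * ν^3 by positivity)]
    calc |kF y * rF y| / (2 * ν^3) * |Real.cos (2 * t) * (Real.cos t)^2| ≤ (12 * K^11 * (1/y^2)) / (2 * ν^3) * 1 := by gcongr
      _ = _ := by field_simp; norm_num
  calc _ ≤ |-(dk y / (4 * ν^2) * Real.sin (2 * t))| + |kF y * rF y / (2 * ν^3) * Real.cos (2 * t) * (Real.cos t)^2| := abs_sub _ _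
    _ ≤ 6 * K^11 * (1/y^2) * (1/ν^2) + 6 * K^11 * (1/y^2) * (1/ν^3) := by rw [abs_neg]; exact add_le_add f1 f2
    _ = _ := by unfold Cb; ring
end Part3

section Part4
open Real Set Filter MeasureTheory
open scoped Nat

/-- `θ` is a phase function for `J_ν(ν y)` with limiting constant `L` -/
def IsPhase (ν : ℝ) (θ : ℝ → ℝ) (L : ℝ) : Prop :=
  (∀ y, 1 < y → HasDerivAt θ (ν / (y * cF y) + rF y / ν * (Real.cos (θ y))^2) y ∧
    (besselJ ν (ν * y) = 0 ↔ Real.cos (θ y) = 0)) ∧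
  (∀ y0 y, 1 < y0 → y0 ≤ y → |DF ν θ y - L| ≤ Cb y0 * (1/ν^2 + 1/ν^3) * (1/y))

lemma inv_tend (M : ℝ) : Tendsto (fun y : ℝ => M * (1/y)) atTop (nhds 0) := by
  have := (tendsto_inv_atTop_zero (𝕜 := ℝ)).const_mul M
  simpa using this

lemma phase_exists (ν : ℝ) (hν : 0 < ν) : ∃ θ L, IsPhase ν θ L := by
  obtain ⟨θ, hθ⟩ := theta_exists ν hν
  have hd : ∀ y, 1 < y → HasDerivAt (DF ν θ) _ y := fun y hy => DF_hasDerivAt hν θ hy (hθ y hy).1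
  have hinv : ∀ M y : ℝ, 1 < y → HasDerivAt (fun y : ℝ => M * (1/y)) (-(M * (1/y^2))) y := by
    intro M y hy
    have h := (hasDerivAt_inv (show y ≠ 0 by linarith)).const_mul M
    refine (h.congr_deriv ?_).congr_of_eventuallyEq ?_
    · simp
    · filter_upwards with t; simp
  have hanti : ∀ y0, 1 < y0 → AntitoneOn (fun y => DF ν θ y + Cb y0 * (1/ν^2 + 1/ν^3) * (1/y)) (Ici y0) := by
    intro y0 h0
    have hdd : ∀ y, 1 < y → HasDerivAt (fun y => DF ν θ y + Cb y0 * (1/ν^2 + 1/ν^3) * (1/y)) _ y :=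
      fun y hy => (hd y hy).add (hinv _ y hy)
    apply antitoneOn_of_deriv_nonpos (convex_Ici y0)
    · intro y hy
      exact (hdd y (lt_of_lt_of_le h0 hy)).continuousAt.continuousWithinAt
    · intro y hy
      rw [interior_Ici] at hy
      exact (hdd y (h0.trans hy)).differentiableAt.differentiableWithinAt
    · intro y hy
      rw [interior_Ici] at hy
      rw [(hdd y (h0.trans hy)).deriv]
      have := DF_deriv_bound hν (θ y) y0 h0 (le_of_lt hy)
      have := (abs_le.mp this).2
      linarith
  have hmono : ∀ y0, 1 < y0 → MonotoneOn (fun y => DF ν θ y - Cb y0 * (1/ν^2 + 1/ν^3) * (1/y)) (Ici y0) := by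
    intro y0 h0
    have hdd : ∀ y, 1 < y → HasDerivAt (fun y => DF ν θ y - Cb y0 * (1/ν^2 + 1/ν^3) * (1/y)) _ y :=
      fun y hy => (hd y hy).sub (hinv _ y hy)
    apply monotoneOn_of_deriv_nonneg (convex_Ici y0)
    · intro y hy
      exact (hdd y (lt_of_lt_of_le h0 hy)).continuousAt.continuousWithinAt
    · intro y hy
      rw [interior_Ici] at hy
      exact (hdd y (h0.trans hy)).differentiableAt.differentiableWithinAt
    · intro y hy
      rw [interior_Ici] at hy
      rw [(hdd y (h0.trans hy)).deriv]
      have := DF_deriv_bound hν (θ y) y0 h0 (le_of_lt hy)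
      have := (abs_le.mp this).1
      linarith
  have hCpos : ∀ y0, 1 < y0 → 0 ≤ Cb y0 * (1/ν^2 + 1/ν^3) := by
    intro y0 h0
    have := cF_pos h0
    unfold Cb; positivity
  have hinv0 := inv_tend
  obtain ⟨L, hL⟩ : ∃ L, Tendsto (DF ν θ) atTop (nhds L) := by
    set M := Cb 2 * (1/ν^2 + 1/ν^3) with hM
    set g : ℝ → ℝ := fun y => DF ν θ (max y 2) - M * (1/(max y 2)) with hg
    have hgm : Monotone g := by
      intro a b hab
      exact hmono 2 (by norm_num) (le_max_right a 2) (le_max_right b 2) (max_le_max_right 2 hab)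
    have hgb : BddAbove (range g) := by
      refine ⟨DF ν θ 2 + M * (1/2), ?_⟩
      rintro _ ⟨y, rfl⟩
      have h1 := hanti 2 (by norm_num) (le_refl (2:ℝ)) (le_max_right y 2) (le_max_right y 2)
      simp only at h1
      have h2 : 0 ≤ M * (1/(max y 2)) :=
        mul_nonneg (hCpos 2 (by norm_num)) (by positivity)
      simp only [hg]
      linarith
    have ht := tendsto_atTop_ciSup hgm hgb
    refine ⟨⨆ i, g i, ?_⟩
    have h3 := ht.add (hinv0 M)
    rw [add_zero] at h3
    refine h3.congr' ?_
    filter_upwards [eventually_ge_atTop 2] with y hy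
    simp only [hg]
    rw [max_eq_left hy]
    ring
  refine ⟨θ, L, hθ, ?_⟩
  intro y0 y h0 hy
  have t1 : Tendsto (fun t => DF ν θ t + Cb y0 * (1/ν^2 + 1/ν^3) * (1/t)) atTop (nhds L) := by
    have h3 := hL.add (hinv0 (Cb y0 * (1/ν^2 + 1/ν^3)))
    rwa [add_zero] at h3
  have t2 : Tendsto (fun t => DF ν θ t - Cb y0 * (1/ν^2 + 1/ν^3) * (1/t)) atTop (nhds L) := by
    have h3 := hL.sub (hinv0 (Cb y0 * (1/ν^2 + 1/ν^3)))
    rwa [sub_zero] at h3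
  have l1 : L ≤ DF ν θ y + Cb y0 * (1/ν^2 + 1/ν^3) * (1/y) := by
    apply le_of_tendsto t1
    filter_upwards [eventually_ge_atTop y] with t ht
    exact hanti y0 h0 hy (hy.trans ht) ht
  have l2 : DF ν θ y - Cb y0 * (1/ν^2 + 1/ν^3) * (1/y) ≤ L := by
    apply ge_of_tendsto t2
    filter_upwards [eventually_ge_atTop y] with t ht
    exact hmono y0 h0 hy (hy.trans ht) ht
  rw [abs_le]
  constructor <;> linarith

lemma cF_tendsto : Tendsto cF atTop (nhds 0) := by
  unfold cF
  have h1 : Tendsto (fun y : ℝ => y^2 - 1) atTop atTop :=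
    tendsto_atTop_add_const_right _ _ (tendsto_pow_atTop two_ne_zero)
  have h2 : Tendsto (fun y : ℝ => √(y^2 - 1)) atTop atTop := Real.tendsto_sqrt_atTop.comp h1
  have h3 := h2.inv_tendsto_atTop
  refine h3.congr fun y => ?_
  simp

lemma TF_tendsto : Tendsto (fun y => TF y - y) atTop (nhds (-(π/2))) := by
  have h1 : Tendsto (fun y : ℝ => y - √(y^2 - 1)) atTop (nhds 0) := by
    have hz : Tendsto (fun y : ℝ => 1/y) atTop (nhds 0) := by
      simpa using tendsto_inv_atTop_zero (𝕜 := ℝ)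
    refine tendsto_of_tendsto_of_tendsto_of_le_of_le' tendsto_const_nhds hz ?_ ?_
    · filter_upwards [eventually_gt_atTop 1] with y hy
      have : √(y^2 - 1) ≤ y := by
        rw [Real.sqrt_le_left (by linarith)]; linarith
      linarith
    · filter_upwards [eventually_gt_atTop 1] with y hy
      have hy0 : 0 < y := by linarith
      have : y - 1/y ≤ √(y^2 - 1) := by
        apply Real.le_sqrt_of_sq_le
        have : (y - 1/y)^2 = y^2 - 2 + 1/y^2 := by field_simp; ring
        rw [this]
        have h3 : 1 / y^2 ≤ 1 := by
          rw [div_le_one (by positivity)]; nlinarith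
        linarith
      linarith
  have h2 : Tendsto (fun y : ℝ => Real.arccos (1/y)) atTop (nhds (π/2)) := by
    have hz : Tendsto (fun y : ℝ => 1/y) atTop (nhds 0) := by
      simpa using tendsto_inv_atTop_zero (𝕜 := ℝ)
    have := (Real.continuous_arccos.tendsto 0).comp hz
    rwa [Real.arccos_zero] at this
  have h3 := (h1.neg).sub h2
  simp only [neg_zero, zero_sub] at h3
  refine h3.congr fun y => ?_
  unfold TF; ring

lemma phase_tendsto {ν : ℝ} {θ : ℝ → ℝ} {L : ℝ} (h : IsPhase ν θ L) :
    Tendsto (fun y => θ y - ν * y) atTop (nhds (L - ν * (π/2))) := by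
  have hD : Tendsto (DF ν θ) atTop (nhds L) := by
    rw [tendsto_iff_norm_sub_tendsto_zero]
    have hz : Tendsto (fun y : ℝ => Cb 2 * (1/ν^2 + 1/ν^3) * (1/y)) atTop (nhds 0) := inv_tend _
    refine squeeze_zero' (Eventually.of_forall fun y => norm_nonneg _) ?_ hz
    filter_upwards [eventually_ge_atTop 2] with y hy
    exact h.2 2 y (by norm_num) hy
  have hc := cF_tendsto
  have hk : Tendsto (fun y => kF y / (4 * ν^2)) atTop (nhds 0) := by
    have := (((hc.pow 2).add ((hc.pow 4).const_mul 6)).add ((hc.pow 6).const_mul 5)).div_const 4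
    have := this.div_const (4 * ν^2)
    simpa [kF] using this
  have hP : Tendsto (fun y => PF y / ν) atTop (nhds 0) := by
    have := ((hc.const_mul 3).add ((hc.pow 3).const_mul 5)).div_const 24
    have := this.div_const ν
    simpa [PF] using this
  have hks : Tendsto (fun y => kF y / (4 * ν^2) * Real.sin (2 * θ y)) atTop (nhds 0) := by
    refine squeeze_zero_norm (a := fun y => |kF y / (4 * ν^2)|) (fun y => ?_) (by simpa using hk.abs)
    rw [Real.norm_eq_abs, abs_mul]
    exact mul_le_of_le_one_right (abs_nonneg _) (Real.abs_sin_le_one _)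
  have := ((hD.add hks).add (TF_tendsto.const_mul ν)).sub hP
  have e : L + 0 + ν * (-(π/2)) - 0 = L - ν * (π/2) := by ring
  rw [e] at this
  refine this.congr fun y => ?_
  unfold DF; ring

lemma phase_deriv_pos {ν : ℝ} (hν : 0 < ν) {y : ℝ} (hy : 1 < y) (t : ℝ) :
    0 < ν / (y * cF y) + rF y / ν * (Real.cos t)^2 := by
  have hc := cF_pos hy
  have hr : 0 < rF y := by unfold rF; positivity
  positivity

lemma phase_strictMono {ν : ℝ} (hν : 0 < ν) {θ : ℝ → ℝ} {L : ℝ} (h : IsPhase ν θ L) :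
    StrictMonoOn θ (Ioi 1) := by
  apply strictMonoOn_of_deriv_pos (convex_Ioi 1)
  · intro y hy; exact (h.1 y hy).1.continuousAt.continuousWithinAt
  · intro y hy
    rw [interior_Ioi] at hy
    rw [(h.1 y hy).1.deriv]
    exact phase_deriv_pos hν hy _

lemma phase_atTop {ν : ℝ} (hν : 0 < ν) {θ : ℝ → ℝ} {L : ℝ} (h : IsPhase ν θ L) :
    Tendsto θ atTop atTop := by
  have h1 := phase_tendsto h
  have h2 : Tendsto (fun y : ℝ => ν * y) atTop atTop := tendsto_id.const_mul_atTop hν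
  have := h1.add_atTop h2
  refine this.congr fun y => by ring

lemma phase_cont {ν : ℝ} {θ : ℝ → ℝ} {L : ℝ} (h : IsPhase ν θ L) : ContinuousOn θ (Ioi 1) :=
  fun y hy => (h.1 y hy).1.continuousAt.continuousWithinAt

lemma phase_shift {ν : ℝ} {θ : ℝ → ℝ} {L : ℝ} (h : IsPhase ν θ L) (n : ℤ) :
    IsPhase ν (fun y => θ y + n * π) (L + n * π) := by
  have hc : ∀ t : ℝ, (Real.cos (t + n * π))^2 = (Real.cos t)^2 := by
    intro t
    have h1 := Real.cos_sq (t + n * π)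
    have h2 := Real.cos_sq t
    rw [h1, h2, show 2 * (t + n * π) = 2 * t + n * (2 * π) by ring, Real.cos_add_int_mul_two_pi]
  have hs : ∀ t : ℝ, Real.sin (2 * (t + n * π)) = Real.sin (2 * t) := by
    intro t
    rw [show 2 * (t + n * π) = 2 * t + n * (2 * π) by ring, Real.sin_add_int_mul_two_pi]
  refine ⟨fun y hy => ⟨?_, ?_⟩, ?_⟩
  · simp only [hc]
    exact (h.1 y hy).1.add_const _
  · rw [(h.1 y hy).2]
    rw [← pow_eq_zero_iff (two_ne_zero) (a := Real.cos (θ y)), ← hc, pow_eq_zero_iff two_ne_zero]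
  · intro y0 y h0 hy
    have := h.2 y0 y h0 hy
    have e : DF ν (fun y => θ y + n * π) y - (L + n * π) = DF ν θ y - L := by
      unfold DF
      simp only [hs]
      ring
    rw [e]; exact this
end Part4

section Part5
open Real Set Filter MeasureTheory
open scoped Nat

/-! ### Schlaefli integral -/

noncomputable def EB (ν : ℝ) (j : ℕ) (z t : ℝ) : ℝ :=
  (Real.sinh t)^j * Real.exp (-(z * Real.sinh t) - ν * t)

lemma EB_cont (ν : ℝ) (j : ℕ) (z : ℝ) : Continuous (EB ν j z) := by
  unfold EB; fun_prop

lemma EB_nonneg (ν : ℝ) (j : ℕ) (z : ℝ) {t : ℝ} (ht : 0 < t) : 0 ≤ EB ν j z t := by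
  have : 0 ≤ Real.sinh t := (Real.sinh_pos_iff.2 ht).le
  unfold EB; positivity

lemma EB_bound (ν : ℝ) (j : ℕ) {z t : ℝ} (hz : 0 < z) (ht : 0 < t) :
    EB ν j z t ≤ (j.factorial : ℝ) / z^j * Real.exp (-ν * t) := by
  have hs : 0 ≤ Real.sinh t := (Real.sinh_pos_iff.2 ht).le
  have h1 := Real.pow_div_factorial_le_exp (z * Real.sinh t) (by positivity) j
  have h2 : Real.exp (-(z * Real.sinh t)) * Real.exp (z * Real.sinh t) = 1 := by
    rw [← Real.exp_add]; simp
  unfold EB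
  rw [sub_eq_add_neg, Real.exp_add, ← mul_assoc, show -(ν * t) = -ν * t by ring]
  refine mul_le_mul_of_nonneg_right ?_ (Real.exp_pos _).le
  rw [le_div_iff₀ (by positivity)]
  rw [div_le_iff₀ (by positivity), mul_pow] at h1
  have h3 := mul_le_mul_of_nonneg_left h1 (Real.exp_pos (-(z * Real.sinh t))).le
  rw [← mul_assoc (rexp _) (rexp _), h2, one_mul] at h3
  nlinarith [h3]

lemma EB_integrable (ν : ℝ) (hν : 0 < ν) (j : ℕ) {z : ℝ} (hz : 0 < z) :
    IntegrableOn (EB ν j z) (Ioi 0) := by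
  refine Integrable.mono' ((exp_neg_integrableOn_Ioi 0 hν).const_mul ((j.factorial : ℝ) / z^j))
    (EB_cont ν j z).aestronglyMeasurable ?_
  filter_upwards [ae_restrict_mem measurableSet_Ioi] with t ht
  rw [Real.norm_of_nonneg (EB_nonneg ν j z ht)]
  exact EB_bound ν j hz ht

noncomputable def IB (ν : ℝ) (j : ℕ) (z : ℝ) : ℝ := ∫ t in Ioi (0:ℝ), EB ν j z t

lemma IB_hasDerivAt (ν : ℝ) (hν : 0 < ν) (j : ℕ) {z : ℝ} (hz : 0 < z) :
    HasDerivAt (IB ν j) (-(IB ν (j+1) z)) z := by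
  have h := hasDerivAt_integral_of_dominated_loc_of_deriv_le (μ := volume.restrict (Ioi (0:ℝ)))
    (F := EB ν j) (F' := fun z t => -(EB ν (j+1) z t)) (x₀ := z) (s := Ioi (z/2))
    (bound := fun t => ((j+1).factorial : ℝ) / (z/2)^(j+1) * Real.exp (-ν * t))
    (Ioi_mem_nhds (by linarith))
    (Eventually.of_forall fun x => (EB_cont ν j x).aestronglyMeasurable)
    (EB_integrable ν hν j hz) (EB_cont ν (j+1) z).neg.aestronglyMeasurable ?_
    ((exp_neg_integrableOn_Ioi 0 hν).const_mul _) ?_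
  · have h2 := h.2
    rw [integral_neg] at h2
    exact h2
  · filter_upwards [ae_restrict_mem measurableSet_Ioi] with t ht x hx
    have hx' : z/2 < x := hx
    have hx0 : 0 < x := by linarith
    rw [norm_neg, Real.norm_of_nonneg (EB_nonneg ν _ x ht)]
    refine (EB_bound ν (j+1) hx0 ht).trans ?_
    gcongr
  · filter_upwards with t x hx
    have h1 : HasDerivAt (fun x => -(x * Real.sinh t) - ν * t) (-(1 * Real.sinh t)) x :=
      (((hasDerivAt_id x).mul_const _).neg).sub_const _
    have h2 := (h1.exp).const_mul ((Real.sinh t)^j)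
    refine h2.congr_deriv ?_
    unfold EB
    ring

lemma IB_nonneg (ν : ℝ) (j : ℕ) (z : ℝ) : 0 ≤ IB ν j z :=
  setIntegral_nonneg measurableSet_Ioi fun _ ht => EB_nonneg ν j z ht

lemma IB_bound (ν : ℝ) (hν : 0 < ν) (j : ℕ) {z : ℝ} (hz : 0 < z) :
    IB ν j z ≤ (j.factorial : ℝ) / z^j * ∫ t in Ioi (0:ℝ), Real.exp (-ν * t) := by
  rw [← integral_const_mul]
  exact setIntegral_mono_on (EB_integrable ν hν j hz)
    ((exp_neg_integrableOn_Ioi 0 hν).const_mul _) measurableSet_Ioi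
    fun t ht => EB_bound ν j hz ht

/-- integrated identity for the second part -/
lemma IB_ode (ν : ℝ) (hν : 0 < ν) {z : ℝ} (hz : 0 < z) :
    z^2 * IB ν 2 z - z * IB ν 1 z + (z^2 - ν^2) * IB ν 0 z = z - ν := by
  have hIntg : IntegrableOn (fun t => z^2 * EB ν 2 z t - z * EB ν 1 z t + (z^2 - ν^2) * EB ν 0 z t)
      (Ioi 0) :=
    (((EB_integrable ν hν 2 hz).const_mul _).sub ((EB_integrable ν hν 1 hz).const_mul _)).add
      ((EB_integrable ν hν 0 hz).const_mul _)
  have hlim : Tendsto (fun t => -((z * Real.cosh t - ν) * Real.exp (-(z * Real.sinh t) - ν * t)))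
      atTop (nhds 0) := by
    have he : Tendsto (fun t : ℝ => (z + 1 + z + ν) * Real.exp (-(ν * t))) atTop
        (nhds ((z + 1 + z + ν) * 0)) := by
      refine Tendsto.const_mul _ ?_
      refine Real.tendsto_exp_neg_atTop_nhds_zero.comp ?_
      exact tendsto_id.const_mul_atTop hν
    rw [mul_zero] at he
    refine squeeze_zero_norm' ?_ he
    filter_upwards [eventually_gt_atTop 0] with t ht
    have hs : 0 < Real.sinh t := Real.sinh_pos_iff.2 ht
    have hc := Real.cosh_sq t
    have hc1 : Real.cosh t ≤ 1 + Real.sinh t := by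
      have := Real.cosh_pos t
      nlinarith
    have e0 : Real.exp (-(z * Real.sinh t) - ν * t) =
      Real.exp (-(z * Real.sinh t)) * Real.exp (-(ν * t)) := by rw [← Real.exp_add]; ring_nf
    have e1 : z * Real.sinh t + 1 ≤ Real.exp (z * Real.sinh t) := Real.add_one_le_exp _
    have e2 : Real.exp (-(z * Real.sinh t)) * Real.exp (z * Real.sinh t) = 1 := by
      rw [← Real.exp_add]; simp
    have e3 : Real.exp (-(z * Real.sinh t)) ≤ 1 := Real.exp_le_one_iff.2 (by nlinarith)
    have e4 := Real.exp_pos (-(z * Real.sinh t))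
    have e5 := mul_le_mul_of_nonneg_left e1 e4.le
    rw [e2] at e5
    rw [norm_neg, e0, Real.norm_eq_abs, ← mul_assoc, abs_mul, abs_of_pos (Real.exp_pos (-(ν * t)))]
    refine mul_le_mul_of_nonneg_right ?_ (Real.exp_pos _).le
    rw [abs_mul, abs_of_pos e4]
    have e6 : |z * Real.cosh t - ν| ≤ z * (1 + Real.sinh t) + ν := by
      have := Real.cosh_pos t
      rw [abs_le]; constructor <;> nlinarith
    have e7 := mul_le_mul_of_nonneg_right e6 e4.le
    nlinarith
  have h := integral_Ioi_of_hasDerivAt_of_tendsto' (a := 0)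
    (f := fun t => -((z * Real.cosh t - ν) * Real.exp (-(z * Real.sinh t) - ν * t)))
    (f' := fun t => z^2 * EB ν 2 z t - z * EB ν 1 z t + (z^2 - ν^2) * EB ν 0 z t) ?_ hIntg hlim
  · rw [integral_add, integral_sub, integral_const_mul, integral_const_mul, integral_const_mul] at h
    · simp at h
      unfold IB
      linarith
    · exact (EB_integrable ν hν 2 hz).const_mul _
    · exact (EB_integrable ν hν 1 hz).const_mul _
    · exact ((EB_integrable ν hν 2 hz).const_mul _).sub ((EB_integrable ν hν 1 hz).const_mul _)
    · exact (EB_integrable ν hν 0 hz).const_mul _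
  · intro t _
    have h1 : HasDerivAt (fun t => -(z * Real.sinh t) - ν * t) (-(z * Real.cosh t) - ν * 1) t :=
      (((Real.hasDerivAt_sinh t).const_mul z).neg).sub ((hasDerivAt_id t).const_mul ν)
    have h2 := (((((Real.hasDerivAt_cosh t).const_mul z).sub_const ν)).mul h1.exp).neg
    refine h2.congr_deriv ?_
    unfold EB
    have hc := Real.cosh_sq t
    linear_combination (z^2 * Real.exp (-(z * Real.sinh t) - ν * t)) * hc

noncomputable def CB (ν : ℝ) (j : ℕ) (z : ℝ) : ℝ :=
  ∫ t in (0:ℝ)..π, (Real.sin t)^j * Real.cos (ν * t - z * Real.sin t)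
noncomputable def SB (ν : ℝ) (j : ℕ) (z : ℝ) : ℝ :=
  ∫ t in (0:ℝ)..π, (Real.sin t)^j * Real.sin (ν * t - z * Real.sin t)

lemma CB_hasDerivAt (ν : ℝ) (j : ℕ) (z : ℝ) : HasDerivAt (CB ν j) (SB ν (j+1) z) z := by
  refine (intervalIntegral.hasDerivAt_integral_of_dominated_loc_of_deriv_le
    (F' := fun z t => (Real.sin t)^(j+1) * Real.sin (ν * t - z * Real.sin t))
    (bound := fun _ => 1) (s := univ) univ_mem
    (Eventually.of_forall fun x => Continuous.aestronglyMeasurable (by fun_prop))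
    (Continuous.intervalIntegrable (by fun_prop) _ _)
    (Continuous.aestronglyMeasurable (by fun_prop)) ?_ (by simp) ?_).2
  · filter_upwards with t _ x _
    rw [norm_mul, norm_pow]
    exact mul_le_one₀ (pow_le_one₀ (norm_nonneg _) (Real.abs_sin_le_one _)) (norm_nonneg _)
      (Real.abs_sin_le_one _)
  · filter_upwards with t _ x _
    have h1 : HasDerivAt (fun x => ν * t - x * Real.sin t) (-(1 * Real.sin t)) x :=
      ((hasDerivAt_id x).mul_const _).const_sub _
    refine (h1.cos.const_mul _).congr_deriv ?_
    ring

lemma SB_hasDerivAt (ν : ℝ) (j : ℕ) (z : ℝ) : HasDerivAt (SB ν j) (-(CB ν (j+1) z)) z := by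
  have h := (intervalIntegral.hasDerivAt_integral_of_dominated_loc_of_deriv_le
    (F := fun z t => (Real.sin t)^j * Real.sin (ν * t - z * Real.sin t))
    (μ := volume) (a := 0) (b := π) (x₀ := z)
    (F' := fun z t => -((Real.sin t)^(j+1) * Real.cos (ν * t - z * Real.sin t)))
    (bound := fun _ => 1) (s := univ) univ_mem
    (Eventually.of_forall fun x => Continuous.aestronglyMeasurable (by fun_prop))
    (Continuous.intervalIntegrable (by fun_prop) _ _)
    (Continuous.aestronglyMeasurable (by fun_prop)) ?_ (by simp) ?_).2
  · rw [intervalIntegral.integral_neg] at h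
    exact h
  · filter_upwards with t _ x _
    rw [norm_neg, norm_mul, norm_pow]
    exact mul_le_one₀ (pow_le_one₀ (norm_nonneg _) (Real.abs_sin_le_one _)) (norm_nonneg _)
      (Real.abs_cos_le_one _)
  · filter_upwards with t _ x _
    have h1 : HasDerivAt (fun x => ν * t - x * Real.sin t) (-(1 * Real.sin t)) x :=
      ((hasDerivAt_id x).mul_const _).const_sub _
    refine (h1.sin.const_mul _).congr_deriv ?_
    ring

lemma CB_bound (ν : ℝ) (j : ℕ) (z : ℝ) : |CB ν j z| ≤ π := by
  have h := intervalIntegral.norm_integral_le_of_norm_le_const (a := 0) (b := π) (C := 1)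
    (f := fun t => (Real.sin t)^j * Real.cos (ν * t - z * Real.sin t)) ?_
  · rw [sub_zero, abs_of_pos Real.pi_pos, one_mul] at h
    exact h
  · intro t _
    rw [norm_mul, norm_pow]
    exact mul_le_one₀ (pow_le_one₀ (norm_nonneg _) (Real.abs_sin_le_one _)) (norm_nonneg _)
      (Real.abs_cos_le_one _)

lemma SB_bound (ν : ℝ) (j : ℕ) (z : ℝ) : |SB ν j z| ≤ π := by
  have h := intervalIntegral.norm_integral_le_of_norm_le_const (a := 0) (b := π) (C := 1)
    (f := fun t => (Real.sin t)^j * Real.sin (ν * t - z * Real.sin t)) ?_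
  · rw [sub_zero, abs_of_pos Real.pi_pos, one_mul] at h
    exact h
  · intro t _
    rw [norm_mul, norm_pow]
    exact mul_le_one₀ (pow_le_one₀ (norm_nonneg _) (Real.abs_sin_le_one _)) (norm_nonneg _)
      (Real.abs_sin_le_one _)

lemma CB_ode (ν z : ℝ) :
    -(z^2 * CB ν 2 z) + z * SB ν 1 z + (z^2 - ν^2) * CB ν 0 z = (z - ν) * Real.sin (ν * π) := by
  have h := intervalIntegral.integral_eq_sub_of_hasDerivAt (a := 0) (b := π)
    (f := fun t => -((z * Real.cos t + ν) * Real.sin (ν * t - z * Real.sin t)))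
    (f' := fun t => -(z^2 * ((Real.sin t)^2 * Real.cos (ν * t - z * Real.sin t))) +
      z * ((Real.sin t)^1 * Real.sin (ν * t - z * Real.sin t)) +
      (z^2 - ν^2) * ((Real.sin t)^0 * Real.cos (ν * t - z * Real.sin t))) ?_
      (Continuous.intervalIntegrable (by fun_prop) _ _)
  · rw [intervalIntegral.integral_add, intervalIntegral.integral_add, intervalIntegral.integral_neg,
      intervalIntegral.integral_const_mul, intervalIntegral.integral_const_mul,
      intervalIntegral.integral_const_mul] at h
    · unfold CB SB
      rw [h]
      simp
      ring
    all_goals exact Continuous.intervalIntegrable (by fun_prop) _ _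
  · intro t _
    have h1 : HasDerivAt (fun t => ν * t - z * Real.sin t) (ν * 1 - z * Real.cos t) t :=
      ((hasDerivAt_id t).const_mul ν).sub ((Real.hasDerivAt_sin t).const_mul z)
    have h2 := ((((Real.hasDerivAt_cos t).const_mul z).add_const ν).mul h1.sin).neg
    refine h2.congr_deriv ?_
    have hc := Real.sin_sq_add_cos_sq t
    linear_combination (z^2 * Real.cos (ν * t - z * Real.sin t)) * hc

noncomputable def FB (ν z : ℝ) : ℝ := CB ν 0 z - Real.sin (ν * π) * IB ν 0 z
noncomputable def FBd (ν z : ℝ) : ℝ := SB ν 1 z + Real.sin (ν * π) * IB ν 1 z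

lemma FB_hasDerivAt (ν : ℝ) (hν : 0 < ν) {z : ℝ} (hz : 0 < z) :
    HasDerivAt (FB ν) (FBd ν z) z := by
  refine ((CB_hasDerivAt ν 0 z).sub ((IB_hasDerivAt ν hν 0 hz).const_mul _)).congr_deriv ?_
  unfold FBd; ring

lemma FBd_hasDerivAt (ν : ℝ) (hν : 0 < ν) {z : ℝ} (hz : 0 < z) :
    HasDerivAt (FBd ν) (-(FBd ν z) / z - (1 - ν^2/z^2) * FB ν z) z := by
  refine ((SB_hasDerivAt ν 1 z).add ((IB_hasDerivAt ν hν 1 hz).const_mul _)).congr_deriv ?_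
  have h1 := CB_ode ν z
  have h2 := IB_ode ν hν hz
  unfold FBd FB
  field_simp
  linear_combination h1 - Real.sin (ν * π) * h2

lemma FB_zero (ν : ℝ) (hν : 0 < ν) {z : ℝ} (hz : 0 < z) (h0 : besselJ ν z = 0) : FB ν z = 0 := by
  set W : ℝ → ℝ := fun z => z * (FB ν z * dJ ν z - FBd ν z * besselJ ν z) with hW
  have hWd : ∀ y ∈ Ioi (0:ℝ), HasDerivAt W 0 y := by
    intro y hy
    have hy' : (0:ℝ) < y := hy
    have h := (hasDerivAt_id y).mul (((FB_hasDerivAt ν hν hy').mul (dJ_hasDerivAt ν hν.le y hy')).sub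
      ((FBd_hasDerivAt ν hν hy').mul (besselJ_hasDerivAt ν hν.le y hy')))
    refine h.congr_deriv ?_
    simp only [id, Pi.sub_apply, Pi.mul_apply]
    field_simp
    ring
  have hconst : ∀ y ∈ Ioi (0:ℝ), W y = W z := by
    intro y hy
    refine (convex_Ioi (0:ℝ)).is_const_of_fderivWithin_eq_zero (𝕜 := ℝ) (f := W)
      (fun w hw => (hWd w hw).differentiableAt.differentiableWithinAt) ?_ hy hz
    intro w hw
    have := (hWd w hw).hasFDerivAt.hasFDerivWithinAt.fderivWithin (s := Ioi (0:ℝ))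
      (isOpen_Ioi.uniqueDiffWithinAt hw)
    rw [this]; ext; simp
  have hlim : Tendsto W (nhdsWithin 0 (Ioi 0)) (nhds 0) := by
    set A := ∫ t in Ioi (0:ℝ), Real.exp (-ν * t) with hA
    have hA0 : 0 ≤ A := setIntegral_nonneg measurableSet_Ioi fun _ _ => (Real.exp_pos _).le
    have b1 : ∀ y, 0 < y → |FB ν y| ≤ π + A := by
      intro y hy
      have h1 := CB_bound ν 0 y
      have h2 := IB_bound ν hν 0 hy
      have h3 := IB_nonneg ν 0 y
      simp at h2
      unfold FB
      refine (abs_sub _ _).trans ?_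
      rw [abs_mul, abs_of_nonneg h3]
      have := Real.abs_sin_le_one (ν * π)
      have := abs_nonneg (Real.sin (ν * π))
      have : A = ∫ t in Ioi (0:ℝ), Real.exp (-(ν * t)) := by rw [hA]; simp
      nlinarith
    have b2 : ∀ y, 0 < y → y < 1 → |y * FBd ν y| ≤ π + A := by
      intro y hy hy1
      have h1 := SB_bound ν 1 y
      have h2 := IB_bound ν hν 1 hy
      have h3 := IB_nonneg ν 1 y
      rw [← hA] at h2
      simp only [Nat.factorial_one, Nat.cast_one, pow_one] at h2
      have h4 : y * IB ν 1 y ≤ A := by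
        have := mul_le_mul_of_nonneg_left h2 hy.le
        field_simp at this
        linarith
      unfold FBd
      have e : y * (SB ν 1 y + Real.sin (ν * π) * IB ν 1 y) =
        y * SB ν 1 y + Real.sin (ν * π) * (y * IB ν 1 y) := by ring
      rw [e]
      refine (abs_add_le _ _).trans ?_
      rw [abs_mul, abs_mul, abs_of_pos hy, abs_of_nonneg (by positivity : 0 ≤ y * IB ν 1 y)]
      have := Real.abs_sin_le_one (ν * π)
      have := abs_nonneg (Real.sin (ν * π))
      have := abs_nonneg (SB ν 1 y)
      have : 0 ≤ y * IB ν 1 y := by positivity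
      nlinarith
    have hz1 := (zdJ_tendsto_zero ν hν).abs.const_mul (π + A)
    have hz2 := (besselJ_tendsto_zero ν hν).abs.const_mul (π + A)
    have hz3 := hz1.add hz2
    simp only [abs_zero, mul_zero, add_zero] at hz3
    refine squeeze_zero_norm' ?_ hz3
    filter_upwards [self_mem_nhdsWithin, mem_nhdsWithin_of_mem_nhds (Iio_mem_nhds one_pos)]
      with y hy hy1
    have hy' : (0:ℝ) < y := hy
    have e : W y = FB ν y * (y * dJ ν y) - (y * FBd ν y) * besselJ ν y := by rw [hW]; ring
    rw [e]
    refine (norm_sub_le _ _).trans ?_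
    rw [norm_mul (FB ν y), norm_mul (y * FBd ν y)]
    simp only [Real.norm_eq_abs]
    exact add_le_add (mul_le_mul_of_nonneg_right (b1 y hy') (abs_nonneg _))
      (mul_le_mul_of_nonneg_right (b2 y hy' hy1) (abs_nonneg _))
  have hWz : W z = 0 := by
    refine tendsto_nhds_unique (f := W) (l := nhdsWithin 0 (Ioi 0)) ?_ hlim
    refine tendsto_const_nhds.congr' ?_
    filter_upwards [self_mem_nhdsWithin] with y hy
    exact (hconst y hy).symm
  rw [hW] at hWz
  simp only [h0, mul_zero, sub_zero, mul_eq_zero] at hWz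
  rcases hWz with h | h | h
  · exact absurd h hz.ne'
  · exact h
  · exact absurd h (besselJ_simple ν hν.le z hz h0)
end Part5

section Part6
open Real Set Filter MeasureTheory
open scoped Nat

/-! ### Fresnel integrals -/

noncomputable def fC (X : ℝ) : ℝ := ∫ w in (0:ℝ)..X, Real.cos (w^2)
noncomputable def fS (X : ℝ) : ℝ := ∫ w in (0:ℝ)..X, Real.sin (w^2)
noncomputable def fA (X : ℝ) : ℝ := ∫ s in (0:ℝ)..1, Real.sin (X^2 * (1+s^2)) / (1+s^2)
noncomputable def fB (X : ℝ) : ℝ := ∫ s in (0:ℝ)..1, Real.cos (X^2 * (1+s^2)) / (1+s^2)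

lemma hasDerivAt_prim {q : ℝ → ℝ} (hq : Continuous q) (X : ℝ) :
    HasDerivAt (fun X => ∫ w in (0:ℝ)..X, q w) (q X) X :=
  intervalIntegral.integral_hasDerivAt_right (hq.intervalIntegrable _ _)
    hq.aestronglyMeasurable.stronglyMeasurableAtFilter hq.continuousAt

lemma fC_hasDerivAt (X : ℝ) : HasDerivAt fC (Real.cos (X^2)) X :=
  hasDerivAt_prim (q := fun w => Real.cos (w^2)) (by fun_prop) X
lemma fS_hasDerivAt (X : ℝ) : HasDerivAt fS (Real.sin (X^2)) X :=
  hasDerivAt_prim (q := fun w => Real.sin (w^2)) (by fun_prop) X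

lemma cont_div1 {q : ℝ → ℝ} (hq : Continuous q) : Continuous (fun s => q s / (1+s^2)) :=
  hq.div (by fun_prop) (fun s => by positivity)

lemma fA_hasDerivAt (X : ℝ) :
    HasDerivAt fA (∫ s in (0:ℝ)..1, 2 * X * Real.cos (X^2 * (1+s^2))) X := by
  refine (intervalIntegral.hasDerivAt_integral_of_dominated_loc_of_deriv_le
    (F' := fun X s => 2 * X * Real.cos (X^2 * (1+s^2)))
    (bound := fun _ => 2 * (|X| + 1)) (Metric.ball_mem_nhds X one_pos)
    (Eventually.of_forall fun x =>
      (cont_div1 (q := fun s => Real.sin (x^2 * (1+s^2))) (by fun_prop)).aestronglyMeasurable)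
    ((cont_div1 (q := fun s => Real.sin (X^2 * (1+s^2))) (by fun_prop)).intervalIntegrable _ _)
    (Continuous.aestronglyMeasurable (by fun_prop)) ?_ (by simp) ?_).2
  · filter_upwards with t _ x hx
    rw [norm_mul, norm_mul]
    have h1 : |x| ≤ |X| + 1 := by
      have h := mem_ball_iff_norm.1 hx
      rw [Real.norm_eq_abs] at h
      have := abs_sub_abs_le_abs_sub x X
      linarith
    have h2 := Real.abs_cos_le_one (x^2 * (1+t^2))
    simp only [Real.norm_eq_abs, abs_two]
    have := abs_nonneg x
    have := abs_nonneg (Real.cos (x^2 * (1+t^2)))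
    nlinarith
  · filter_upwards with t _ x _
    have h1 : HasDerivAt (fun x => x^2 * (1+t^2)) (2 * x * (1 + t^2)) x := by
      simpa using (hasDerivAt_pow 2 x).mul_const (1+t^2)
    refine (h1.sin.div_const _).congr_deriv ?_
    have : 1 + t^2 ≠ 0 := by positivity
    field_simp

lemma fB_hasDerivAt (X : ℝ) :
    HasDerivAt fB (∫ s in (0:ℝ)..1, -(2 * X * Real.sin (X^2 * (1+s^2)))) X := by
  refine (intervalIntegral.hasDerivAt_integral_of_dominated_loc_of_deriv_le
    (F' := fun X s => -(2 * X * Real.sin (X^2 * (1+s^2))))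
    (bound := fun _ => 2 * (|X| + 1)) (Metric.ball_mem_nhds X one_pos)
    (Eventually.of_forall fun x =>
      (cont_div1 (q := fun s => Real.cos (x^2 * (1+s^2))) (by fun_prop)).aestronglyMeasurable)
    ((cont_div1 (q := fun s => Real.cos (X^2 * (1+s^2))) (by fun_prop)).intervalIntegrable _ _)
    (Continuous.aestronglyMeasurable (by fun_prop)) ?_ (by simp) ?_).2
  · filter_upwards with t _ x hx
    rw [norm_neg, norm_mul, norm_mul]
    have h1 : |x| ≤ |X| + 1 := by
      have h := mem_ball_iff_norm.1 hx
      rw [Real.norm_eq_abs] at h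
      have := abs_sub_abs_le_abs_sub x X
      linarith
    have h2 := Real.abs_sin_le_one (x^2 * (1+t^2))
    simp only [Real.norm_eq_abs, abs_two]
    have := abs_nonneg x
    have := abs_nonneg (Real.sin (x^2 * (1+t^2)))
    nlinarith
  · filter_upwards with t _ x _
    have h1 : HasDerivAt (fun x => x^2 * (1+t^2)) (2 * x * (1 + t^2)) x := by
      simpa using (hasDerivAt_pow 2 x).mul_const (1+t^2)
    refine (h1.cos.div_const _).congr_deriv ?_
    have : 1 + t^2 ≠ 0 := by positivity
    field_simp

lemma fC_scale (X : ℝ) : X * ∫ s in (0:ℝ)..1, Real.cos ((X*s)^2) = fC X := by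
  have := intervalIntegral.mul_integral_comp_mul_left (a := 0) (b := 1)
    (f := fun w => Real.cos (w^2)) (c := X)
  simpa [fC] using this

lemma fS_scale (X : ℝ) : X * ∫ s in (0:ℝ)..1, Real.sin ((X*s)^2) = fS X := by
  have := intervalIntegral.mul_integral_comp_mul_left (a := 0) (b := 1)
    (f := fun w => Real.sin (w^2)) (c := X)
  simpa [fS] using this

lemma comb_int (a b X : ℝ) : ∫ s in (0:ℝ)..1, 2 * (a * Real.cos ((X*s)^2) + b * Real.sin ((X*s)^2))
    = 2 * (a * (∫ s in (0:ℝ)..1, Real.cos ((X*s)^2)) + b * ∫ s in (0:ℝ)..1, Real.sin ((X*s)^2)) := by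
  rw [intervalIntegral.integral_const_mul, intervalIntegral.integral_add,
    intervalIntegral.integral_const_mul, intervalIntegral.integral_const_mul]
  all_goals exact Continuous.intervalIntegrable (by fun_prop) _ _

lemma const_of_deriv_zero {W : ℝ → ℝ} (h : ∀ y, HasDerivAt W 0 y) (x y : ℝ) : W x = W y :=
  is_const_of_deriv_eq_zero (fun y => (h y).differentiableAt) (fun y => (h y).deriv) x y

lemma fresnel1 (X : ℝ) : (fC X)^2 - (fS X)^2 = fA X := by
  have h := const_of_deriv_zero (W := fun X => (fC X)^2 - (fS X)^2 - fA X) ?_ X 0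
  · have h0 : fC 0 = 0 := by simp [fC]
    have h1 : fS 0 = 0 := by simp [fS]
    have h2 : fA 0 = 0 := by simp [fA]
    simp only [h0, h1, h2] at h
    linarith
  · intro y
    refine ((((fC_hasDerivAt y).pow 2).sub ((fS_hasDerivAt y).pow 2)).sub
      (fA_hasDerivAt y)).congr_deriv ?_
    have e : (∫ s in (0:ℝ)..1, 2 * y * Real.cos (y^2 * (1+s^2))) =
        ∫ s in (0:ℝ)..1, 2 * ((y * Real.cos (y^2)) * Real.cos ((y*s)^2) +
          (-(y * Real.sin (y^2))) * Real.sin ((y*s)^2)) := by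
      refine intervalIntegral.integral_congr fun s _ => ?_
      rw [show y^2 * (1+s^2) = y^2 + (y*s)^2 by ring, Real.cos_add]
      ring
    rw [e, comb_int]
    have h1 := fC_scale y
    have h2 := fS_scale y
    rw [← h1, ← h2]
    push_cast
    ring

lemma fresnel2 (X : ℝ) : 2 * fC X * fS X = π/4 - fB X := by
  have h := const_of_deriv_zero (W := fun X => 2 * fC X * fS X + fB X) ?_ X 0
  · have h0 : fC 0 = 0 := by simp [fC]
    have h2 : fB 0 = π/4 := by simp [fB]
    simp only [h0, h2] at h
    linarith
  · intro y
    refine ((((fC_hasDerivAt y).const_mul 2).mul (fS_hasDerivAt y)).add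
      (fB_hasDerivAt y)).congr_deriv ?_
    have e : (∫ s in (0:ℝ)..1, -(2 * y * Real.sin (y^2 * (1+s^2)))) =
        ∫ s in (0:ℝ)..1, 2 * ((-(y * Real.sin (y^2))) * Real.cos ((y*s)^2) +
          (-(y * Real.cos (y^2))) * Real.sin ((y*s)^2)) := by
      refine intervalIntegral.integral_congr fun s _ => ?_
      rw [show y^2 * (1+s^2) = y^2 + (y*s)^2 by ring, Real.sin_add]
      ring
    rw [e, comb_int]
    have h1 := fC_scale y
    have h2 := fS_scale y
    rw [← h1, ← h2]
    ring

lemma unit_bound {q : ℝ → ℝ} (hq : ∀ s, |q s| ≤ 1) : |∫ s in (0:ℝ)..1, q s / (1+s^2)| ≤ 1 := by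
  have h := intervalIntegral.norm_integral_le_of_norm_le_const (a := 0) (b := 1) (C := 1)
    (f := fun s => q s / (1+s^2)) ?_
  · simpa using h
  · intro s _
    rw [norm_div, Real.norm_eq_abs, Real.norm_eq_abs, abs_of_pos (by positivity : 0 < 1 + s^2),
      div_le_one (by positivity)]
    nlinarith [hq s]

lemma fresnel_bd (X : ℝ) : |fC X| ≤ 2 ∧ |fS X| ≤ 2 := by
  have h1 := fresnel1 X
  have h3 : |fA X| ≤ 1 := unit_bound (q := fun s => Real.sin (X^2 * (1+s^2)))
    (fun s => Real.abs_sin_le_one _)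
  have h2 := fresnel2 X
  have h4 : |fB X| ≤ 1 := unit_bound (q := fun s => Real.cos (X^2 * (1+s^2)))
    (fun s => Real.abs_cos_le_one _)
  rw [abs_le] at h3 h4
  have hp := Real.pi_le_four
  have hp0 := Real.pi_pos
  have key : ((fC X)^2 + (fS X)^2)^2 ≤ 3^2 := by
    have : ((fC X)^2 + (fS X)^2)^2 = (fA X)^2 + (π/4 - fB X)^2 := by
      rw [← h1, ← h2]; ring
    rw [this]
    nlinarith
  have k2 := abs_le_of_sq_le_sq key (by norm_num)
  rw [abs_le] at k2
  constructor
  · exact abs_le_of_sq_le_sq (by nlinarith [sq_nonneg (fS X)]) (by norm_num)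
  · exact abs_le_of_sq_le_sq (by nlinarith [sq_nonneg (fC X)]) (by norm_num)

lemma ibp_small {q : ℝ → ℝ} (hq : Continuous q) (hQ : ∀ X, |∫ w in (0:ℝ)..X, q w| ≤ 2)
    {X : ℝ} (hX : 0 < X) : |∫ s in (0:ℝ)..1, q (X*s) / (1+s^2)| ≤ 6 / X := by
  set Q : ℝ → ℝ := fun X => ∫ w in (0:ℝ)..X, q w with hQd
  have hQc : Continuous Q := by
    have : ∀ X, HasDerivAt Q (q X) X := hasDerivAt_prim hq
    exact continuous_iff_continuousAt.2 fun x => (this x).continuousAt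
  have h := intervalIntegral.integral_mul_deriv_eq_deriv_mul (a := 0) (b := 1)
    (u := fun s : ℝ => (1+s^2)⁻¹) (v := fun s => Q (X*s) / X)
    (u' := fun s : ℝ => -(2*s) / (1+s^2)^2) (v' := fun s => q (X*s)) ?_ ?_ ?_ ?_
  · have e : (∫ s in (0:ℝ)..1, q (X*s) / (1+s^2)) = ∫ s in (0:ℝ)..1, (1+s^2)⁻¹ * q (X*s) :=
      intervalIntegral.integral_congr fun s _ => by rw [div_eq_inv_mul]
    rw [e, h]
    have b1 : |(1+(1:ℝ)^2)⁻¹ * (Q (X*1) / X)| ≤ 2 / X := by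
      rw [abs_mul, abs_div, abs_of_pos hX]
      have := hQ (X*1)
      rw [abs_of_pos (by norm_num)]
      have h3 : |Q (X*1)| / X ≤ 2 / X := by gcongr
      have : 0 ≤ |Q (X*1)| / X := by positivity
      nlinarith
    have b2 : (1+(0:ℝ)^2)⁻¹ * (Q (X*0) / X) = 0 := by simp [hQd]
    have b3 : |∫ s in (0:ℝ)..1, -(2*s) / (1+s^2)^2 * (Q (X*s) / X)| ≤ 4 / X := by
      have h4 := intervalIntegral.norm_integral_le_of_norm_le_const (a := 0) (b := 1) (C := 4/X)
        (f := fun s => -(2*s) / (1+s^2)^2 * (Q (X*s) / X)) ?_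
      · simpa using h4
      · intro s hs
        rw [uIoc_of_le zero_le_one] at hs
        rw [norm_mul]
        have k1 : ‖-(2*s) / (1+s^2)^2‖ ≤ 2 := by
          rw [norm_div, norm_neg, Real.norm_of_nonneg (by linarith [hs.1]),
            Real.norm_of_nonneg (by positivity), div_le_iff₀ (by positivity)]
          nlinarith [hs.1, hs.2, sq_nonneg s]
        have k2 : ‖Q (X*s) / X‖ ≤ 2 / X := by
          rw [norm_div, Real.norm_of_nonneg hX.le]
          have := hQ (X*s)
          gcongr
          exact this
        calc _ ≤ 2 * (2 / X) := mul_le_mul k1 k2 (norm_nonneg _) (by norm_num)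
          _ = 4 / X := by ring
    rw [b2, sub_zero]
    refine (abs_sub _ _).trans ?_
    calc _ ≤ 2 / X + 4 / X := add_le_add b1 b3
      _ = 6 / X := by ring
  · intro s _
    have h1 : HasDerivAt (fun s : ℝ => 1 + s^2) (2*s) s := by
      simpa using (hasDerivAt_pow 2 s).const_add 1
    exact h1.inv (by positivity)
  · intro s _
    have h1 : HasDerivAt (fun s : ℝ => X * s) (X * 1) s := (hasDerivAt_id s).const_mul X
    have h2 := ((hasDerivAt_prim hq (X*s)).comp s h1).div_const X
    refine h2.congr_deriv ?_
    field_simp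
  · refine Continuous.intervalIntegrable ?_ _ _
    exact Continuous.div (by fun_prop) (by fun_prop) (fun s => by positivity)
  · exact Continuous.intervalIntegrable (by fun_prop) _ _

lemma fA_small {X : ℝ} (hX : 0 < X) : |fA X| ≤ 12 / X ∧ |fB X| ≤ 12 / X := by
  have h1 := ibp_small (q := fun w => Real.cos (w^2)) (by fun_prop) (fun X => (fresnel_bd X).1) hX
  have h2 := ibp_small (q := fun w => Real.sin (w^2)) (by fun_prop) (fun X => (fresnel_bd X).2) hX
  set U := ∫ s in (0:ℝ)..1, Real.cos ((X*s)^2) / (1+s^2) with hU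
  set V := ∫ s in (0:ℝ)..1, Real.sin ((X*s)^2) / (1+s^2) with hV
  have iU : IntervalIntegrable (fun s => Real.cos ((X*s)^2) / (1+s^2)) volume 0 1 :=
    (cont_div1 (q := fun s => Real.cos ((X*s)^2)) (by fun_prop)).intervalIntegrable _ _
  have iV : IntervalIntegrable (fun s => Real.sin ((X*s)^2) / (1+s^2)) volume 0 1 :=
    (cont_div1 (q := fun s => Real.sin ((X*s)^2)) (by fun_prop)).intervalIntegrable _ _
  have eA : fA X = Real.sin (X^2) * U + Real.cos (X^2) * V := by
    rw [hU, hV, ← intervalIntegral.integral_const_mul, ← intervalIntegral.integral_const_mul,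
      ← intervalIntegral.integral_add (iU.const_mul _) (iV.const_mul _)]
    refine intervalIntegral.integral_congr fun s _ => ?_
    rw [show X^2 * (1+s^2) = X^2 + (X*s)^2 by ring, Real.sin_add]
    ring
  have eB : fB X = Real.cos (X^2) * U - Real.sin (X^2) * V := by
    rw [hU, hV, ← intervalIntegral.integral_const_mul, ← intervalIntegral.integral_const_mul,
      ← intervalIntegral.integral_sub (iU.const_mul _) (iV.const_mul _)]
    refine intervalIntegral.integral_congr fun s _ => ?_
    rw [show X^2 * (1+s^2) = X^2 + (X*s)^2 by ring, Real.cos_add]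
    ring
  have hc := Real.abs_cos_le_one (X^2)
  have hs := Real.abs_sin_le_one (X^2)
  have hU0 := abs_nonneg U
  have hV0 := abs_nonneg V
  have e12 : 12 / X = 6 / X + 6 / X := by ring
  rw [e12]
  constructor
  · rw [eA]; refine (abs_add_le _ _).trans ?_
    rw [abs_mul, abs_mul]
    nlinarith
  · rw [eB]; refine (abs_sub _ _).trans ?_
    rw [abs_mul, abs_mul]
    nlinarith
end Part6

section Part7
open Real Set Filter MeasureTheory


/-! ### Asymptotic phase of the zeros -/

noncomputable def hS (ν p : ℝ) : ℝ := (Real.cos (ν*p) - Real.cos (p/2)) / Real.sin p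
noncomputable def hS' (ν p : ℝ) : ℝ :=
  ((-(ν * Real.sin (ν*p)) + Real.sin (p/2) / 2) * Real.sin p
    - (Real.cos (ν*p) - Real.cos (p/2)) * Real.cos p) / (Real.sin p)^2

lemma cos_diff_bd (ν p : ℝ) : |Real.cos (ν*p) - Real.cos (p/2)| ≤ (ν^2+1) * p^2 / 2 := by
  have h1 := Real.one_sub_sq_div_two_le_cos (x := ν*p)
  have h2 := Real.one_sub_sq_div_two_le_cos (x := p/2)
  have h3 := Real.cos_le_one (ν*p)
  have h4 := Real.cos_le_one (p/2)
  rw [abs_le]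
  constructor <;> nlinarith [sq_nonneg p, sq_nonneg (ν*p)]

lemma sin_lb {p : ℝ} (h0 : 0 ≤ p) (h1 : p ≤ π/2) : 2/π * p ≤ Real.sin p := Real.mul_le_sin h0 h1

lemma hS_bd (ν : ℝ) {p : ℝ} (h0 : 0 ≤ p) (h1 : p ≤ π/2) : |hS ν p| ≤ (ν^2+1) * π * p := by
  rcases h0.eq_or_lt with h | h
  · rw [← h]; simp [hS]
  have hs := sin_lb h0 h1
  have hp := Real.pi_pos
  have hs0 : 0 < Real.sin p := lt_of_lt_of_le (by positivity) hs
  unfold hS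
  rw [abs_div, abs_of_pos hs0, div_le_iff₀ hs0]
  refine (cos_diff_bd ν p).trans ?_
  have : (ν^2+1) * π * p * (2/π*p) ≤ (ν^2+1) * π * p * Real.sin p := by gcongr
  refine le_trans ?_ this
  rw [show (ν^2+1) * π * p * (2/π*p) = (ν^2+1) * p^2 * 2 by field_simp]
  nlinarith [show 0 ≤ (ν^2+1) * p^2 by positivity]

lemma hS'_bd (ν : ℝ) {p : ℝ} (h0 : 0 < p) (h1 : p ≤ π/2) : |hS' ν p| ≤ (ν^2+1) * π^2 := by
  have hs := sin_lb h0.le h1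
  have hp := Real.pi_pos
  have hs0 : 0 < Real.sin p := lt_of_lt_of_le (by positivity) hs
  unfold hS'
  rw [abs_div, abs_of_pos (by positivity : 0 < (Real.sin p)^2), div_le_iff₀ (by positivity)]
  have k1 : (2/π*p)^2 ≤ (Real.sin p)^2 := by gcongr
  have k2 : (ν^2+1) * π^2 * (2/π*p)^2 ≤ (ν^2+1) * π^2 * (Real.sin p)^2 := by gcongr
  refine le_trans ?_ k2
  rw [show (ν^2+1) * π^2 * (2/π*p)^2 = 4 * ((ν^2+1) * p^2) by field_simp; ring]
  have b1 := cos_diff_bd ν p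
  have b2 : |-(ν * Real.sin (ν*p)) + Real.sin (p/2) / 2| ≤ (ν^2+1) * p := by
    refine (abs_add_le _ _).trans ?_
    rw [abs_neg, abs_mul, abs_div, abs_two]
    have e1 := Real.abs_sin_le_abs (x := ν*p)
    have e2 := Real.abs_sin_le_abs (x := p/2)
    rw [abs_mul, abs_of_pos h0] at e1
    rw [abs_of_pos (by positivity : 0 < p/2)] at e2
    have := mul_le_mul_of_nonneg_left e1 (abs_nonneg ν)
    have h2 : |ν| * (|ν| * p) = ν^2 * p := by rw [← mul_assoc, abs_mul_abs_self]; ring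
    nlinarith
  have b3 : |Real.sin p| ≤ p := by
    have := Real.abs_sin_le_abs (x := p); rwa [abs_of_pos h0] at this
  have b4 := Real.abs_cos_le_one p
  refine (abs_sub _ _).trans ?_
  rw [abs_mul, abs_mul]
  have c1 : |-(ν * Real.sin (ν*p)) + Real.sin (p/2) / 2| * |Real.sin p| ≤ ((ν^2+1) * p) * p :=
    mul_le_mul b2 b3 (abs_nonneg _) (by positivity)
  have c2 : |Real.cos (ν*p) - Real.cos (p/2)| * |Real.cos p| ≤ (ν^2+1) * p^2 / 2 * 1 :=
    mul_le_mul b1 b4 (abs_nonneg _) (by positivity)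
  nlinarith [show 0 ≤ (ν^2+1) * p^2 by positivity]

lemma hS_deriv (ν : ℝ) {p : ℝ} (h : Real.sin p ≠ 0) : HasDerivAt (hS ν) (hS' ν p) p := by
  have h1 : HasDerivAt (fun p => Real.cos (ν*p)) (-Real.sin (ν*p) * (ν*1)) p :=
    ((hasDerivAt_id p).const_mul ν).cos
  have h2 : HasDerivAt (fun p => Real.cos (p/2)) (-Real.sin (p/2) * (1/2)) p :=
    ((hasDerivAt_id p).div_const 2).cos
  refine ((h1.sub h2).div (Real.hasDerivAt_sin p) h).congr_deriv ?_
  unfold hS'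
  congr 1
  simp only [Pi.sub_apply]
  ring

lemma repl_bound (ν : ℝ) : ∃ M : ℝ, 0 ≤ M ∧ ∀ z a : ℝ, 0 < z →
    |∫ p in (0:ℝ)..(π/2), Real.cos (z * Real.cos p - a) * (Real.cos (ν*p) - Real.cos (p/2))|
      ≤ M / z := by
  have hp := Real.pi_pos
  set K := (ν^2+1) * π^2 with hK
  have hK0 : 0 ≤ K := by positivity
  refine ⟨K + K * (π/2), by positivity, fun z a hz => ?_⟩
  have hle : (0:ℝ) ≤ π/2 := by positivity
  have hv : ∀ p, HasDerivAt (fun p => -Real.sin (z * Real.cos p - a) / z)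
      (Real.sin p * Real.cos (z * Real.cos p - a)) p := by
    intro p
    have h1 : HasDerivAt (fun p => z * Real.cos p - a) (z * -Real.sin p) p :=
      ((Real.hasDerivAt_cos p).const_mul z).sub_const a
    refine (h1.sin.neg.div_const z).congr_deriv ?_
    field_simp
  have hvb : ∀ p, |-Real.sin (z * Real.cos p - a) / z| ≤ 1 / z := by
    intro p
    rw [abs_div, abs_neg, abs_of_pos hz]
    gcongr
    exact Real.abs_sin_le_one _
  have hcont : ContinuousOn (hS ν) (uIcc 0 (π/2)) := by
    rw [uIcc_of_le hle]
    intro p hp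
    rcases hp.1.eq_or_lt with h | h
    · rw [← h]
      have h0 : hS ν 0 = 0 := by simp [hS]
      unfold ContinuousWithinAt
      rw [h0]
      have hl : Tendsto (fun p : ℝ => (ν^2+1) * π * p) (nhdsWithin 0 (Icc 0 (π/2))) (nhds 0) := by
        have : Tendsto (fun p : ℝ => (ν^2+1) * π * p) (nhds 0) (nhds ((ν^2+1)*π*0)) :=
          (continuous_const.mul continuous_id).tendsto 0
        rw [mul_zero] at this
        exact this.mono_left nhdsWithin_le_nhds
      refine squeeze_zero_norm' ?_ hl
      filter_upwards [self_mem_nhdsWithin] with y hy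
      exact hS_bd ν hy.1 hy.2
    · have : Real.sin p ≠ 0 := (Real.sin_pos_of_pos_of_lt_pi h (by linarith [hp.2])).ne'
      exact (hS_deriv ν this).continuousAt.continuousWithinAt
  have hIntg : IntervalIntegrable (hS' ν) volume 0 (π/2) := by
    rw [intervalIntegrable_iff_integrableOn_Ioc_of_le hle]
    refine Measure.integrableOn_of_bounded (M := K) (by simp) ?_ ?_
    · refine Measurable.aestronglyMeasurable ?_
      unfold hS'
      fun_prop
    · filter_upwards [ae_restrict_mem measurableSet_Ioc] with p hp
      exact hS'_bd ν hp.1 hp.2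
  have h := intervalIntegral.integral_mul_deriv_eq_deriv_mul_of_hasDeriv_right (a := 0) (b := π/2)
    (u := hS ν) (u' := hS' ν) (v := fun p => -Real.sin (z * Real.cos p - a) / z)
    (v' := fun p => Real.sin p * Real.cos (z * Real.cos p - a)) hcont
    (Continuous.continuousOn (by fun_prop)) ?_ (fun p _ => (hv p).hasDerivWithinAt) hIntg
    (Continuous.intervalIntegrable (by fun_prop) _ _)
  · have e : (∫ p in (0:ℝ)..(π/2), Real.cos (z * Real.cos p - a) *
        (Real.cos (ν*p) - Real.cos (p/2))) =
        ∫ p in (0:ℝ)..(π/2), hS ν p * (Real.sin p * Real.cos (z * Real.cos p - a)) := by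
      refine intervalIntegral.integral_congr fun p hp => ?_
      rw [uIcc_of_le hle] at hp
      rcases hp.1.eq_or_lt with h | h
      · rw [← h]; simp
      · have : Real.sin p ≠ 0 := (Real.sin_pos_of_pos_of_lt_pi h (by linarith [hp.2])).ne'
        unfold hS
        field_simp
    rw [e, h]
    have h0 : hS ν 0 = 0 := by simp [hS]
    rw [h0, zero_mul, sub_zero]
    refine (abs_sub _ _).trans ?_
    rw [add_div]
    refine add_le_add ?_ ?_
    · rw [abs_mul]
      have b1 : |hS ν (π/2)| ≤ K := by
        refine (hS_bd ν hle le_rfl).trans ?_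
        rw [hK]
        nlinarith [show 0 ≤ (ν^2+1) * π^2 by positivity]
      calc _ ≤ K * (1 / z) := mul_le_mul b1 (hvb _) (abs_nonneg _) hK0
        _ = K / z := by ring
    · have h4 := intervalIntegral.norm_integral_le_of_norm_le_const (a := 0) (b := π/2) (C := K/z)
        (f := fun p => hS' ν p * (-Real.sin (z * Real.cos p - a) / z)) ?_
      · rw [sub_zero, abs_of_nonneg hle] at h4
        refine h4.trans (le_of_eq ?_)
        ring
      · intro p hp
        rw [uIoc_of_le hle] at hp
        rw [norm_mul]
        calc _ ≤ K * (1 / z) := mul_le_mul (hS'_bd ν hp.1 hp.2) (hvb _) (abs_nonneg _) hK0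
          _ = K / z := by ring
  · intro p hp
    rw [min_eq_left hle, max_eq_right hle] at hp
    have : Real.sin p ≠ 0 := (Real.sin_pos_of_pos_of_lt_pi hp.1 (by linarith [hp.2])).ne'
    exact (hS_deriv ν this).hasDerivWithinAt

lemma CB_fold (ν z : ℝ) : CB ν 0 z =
    2 * ∫ p in (0:ℝ)..(π/2), Real.cos (z * Real.cos p - ν*π/2) * Real.cos (ν*p) := by
  have h1 : CB ν 0 z = ∫ p in (-(π/2))..(π/2), Real.cos (ν*p + (ν*π/2 - z * Real.cos p)) := by
    have := intervalIntegral.integral_comp_add_right (a := -(π/2)) (b := π/2)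
      (f := fun t => Real.cos (ν * t - z * Real.sin t)) (π/2)
    unfold CB
    simp only [pow_zero, one_mul]
    rw [show -(π/2) + π/2 = 0 by ring, show π/2 + π/2 = π by ring] at this
    rw [← this]
    refine intervalIntegral.integral_congr fun p _ => ?_
    simp only [Real.sin_add_pi_div_two]
    congr 1
    ring
  have hi : ∀ a b, IntervalIntegrable (fun p => Real.cos (ν*p + (ν*π/2 - z * Real.cos p)))
    volume a b := fun a b => Continuous.intervalIntegrable (by fun_prop) _ _
  have h2 : (∫ p in (-(π/2))..0, Real.cos (ν*p + (ν*π/2 - z * Real.cos p))) =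
      ∫ p in (0:ℝ)..(π/2), Real.cos (-(ν*p) + (ν*π/2 - z * Real.cos p)) := by
    have := intervalIntegral.integral_comp_neg (a := 0) (b := π/2)
      (f := fun p => Real.cos (ν*p + (ν*π/2 - z * Real.cos p)))
    rw [neg_zero] at this
    rw [← this]
    refine intervalIntegral.integral_congr fun p _ => ?_
    simp only [Real.cos_neg]
    congr 1
    ring
  rw [h1, ← intervalIntegral.integral_add_adjacent_intervals (hi (-(π/2)) 0) (hi 0 (π/2)), h2,
    ← intervalIntegral.integral_add (Continuous.intervalIntegrable (by fun_prop) _ _)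
      (Continuous.intervalIntegrable (by fun_prop) _ _), ← intervalIntegral.integral_const_mul]
  refine intervalIntegral.integral_congr fun p _ => ?_
  beta_reduce
  rw [show z * Real.cos p - ν*π/2 = -(ν*π/2 - z * Real.cos p) by ring, Real.cos_neg, Real.cos_add,
    Real.cos_add, Real.cos_neg, Real.sin_neg]
  ring

lemma main_term (z a : ℝ) (hz : 0 < z) :
    ∫ p in (0:ℝ)..(π/2), Real.cos (z * Real.cos p - a) * Real.cos (p/2) =
    2 / √(2*z) * (Real.cos (z-a) * fC (√z) + Real.sin (z-a) * fS (√z)) := by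
  have h := intervalIntegral.integral_comp_mul_deriv (a := 0) (b := π/2)
    (f := fun p => √(2*z) * Real.sin (p/2)) (f' := fun p => √(2*z) * (Real.cos (p/2) * (1/2)))
    (g := fun w => Real.cos ((z-a) - w^2)) ?_ (Continuous.continuousOn (by fun_prop)) (by fun_prop)
  · have hq : √(2*z) ^2 = 2*z := Real.sq_sqrt (by positivity)
    have hq0 : 0 < √(2*z) := Real.sqrt_pos.2 (by positivity)
    have e1 : √(2*z) * Real.sin (π/2/2) = √z := by
      rw [show π/2/2 = π/4 by ring, Real.sin_pi_div_four, Real.sqrt_mul (by norm_num)]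
      have : √2 * √2 = 2 := Real.mul_self_sqrt (by norm_num)
      linear_combination (√z/2) * this
    have e2 : √(2*z) * Real.sin (0/2) = 0 := by simp
    rw [e1, e2] at h
    have e3 : (∫ w in (0:ℝ)..(√z), Real.cos ((z-a) - w^2)) =
        Real.cos (z-a) * fC (√z) + Real.sin (z-a) * fS (√z) := by
      unfold fC fS
      rw [← intervalIntegral.integral_const_mul, ← intervalIntegral.integral_const_mul,
        ← intervalIntegral.integral_add (Continuous.intervalIntegrable (by fun_prop) _ _)
          (Continuous.intervalIntegrable (by fun_prop) _ _)]
      refine intervalIntegral.integral_congr fun w _ => ?_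
      beta_reduce
      rw [Real.cos_sub]
    rw [e3] at h
    rw [← h, ← intervalIntegral.integral_const_mul]
    refine intervalIntegral.integral_congr fun p _ => ?_
    simp only [Function.comp]
    have e4 : z - a - (√(2*z) * Real.sin (p/2))^2 = z * Real.cos p - a := by
      rw [mul_pow, hq, Real.sin_sq_eq_half_sub, show 2 * (p/2) = p by ring]
      ring
    rw [e4]
    field_simp
  · intro p _
    exact (((hasDerivAt_id p).div_const 2).sin).const_mul _

lemma IB_zero_bd (ν : ℝ) (hν : 0 < ν) {z : ℝ} (hz : 0 < z) : IB ν 0 z ≤ 1 / z := by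
  have h1 : ∫ t in Ioi (0:ℝ), Real.exp (-z * t) = 1 / z := by
    have := integral_exp_mul_Ioi (a := -z) (by linarith) 0
    rw [this]; simp
  rw [← h1]
  refine setIntegral_mono_on (EB_integrable ν hν 0 hz) (exp_neg_integrableOn_Ioi 0 hz)
    measurableSet_Ioi fun t ht => ?_
  have ht' : 0 < t := ht
  unfold EB
  rw [pow_zero, one_mul]
  refine Real.exp_le_exp.2 ?_
  have : t ≤ Real.sinh t := Real.self_le_sinh_iff.2 ht'.le
  nlinarith

lemma abs_mul_le_of1 {a b c : ℝ} (ha : |a| ≤ 1) (hb : |b| ≤ c) : |a * b| ≤ c := by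
  rw [abs_mul]
  nlinarith [abs_nonneg a, abs_nonneg b]

set_option maxHeartbeats 800000 in
lemma zeros_phase (ν : ℝ) (hν : 0 < ν) : ∃ M, ∀ z : ℝ, 1 ≤ z → besselJ ν z = 0 →
    |1 + Real.sin (2 * (z - ν*π/2))| ≤ M / √z := by
  obtain ⟨M, hM0, hM⟩ := repl_bound ν
  refine ⟨8 / π * ((M+1)^2 + 24), fun z hz h0 => ?_⟩
  have hz0 : 0 < z := by linarith
  have hp := Real.pi_pos
  set q := √z with hq
  have hq1 : 1 ≤ q := Real.one_le_sqrt.2 hz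
  have hq2 : q^2 = z := Real.sq_sqrt hz0.le
  have hq0 : 0 < q := by linarith
  set a := ν*π/2 with ha
  set T := Real.cos (z-a) * fC q + Real.sin (z-a) * fS q with hT
  have hF := FB_zero ν hν hz0 h0
  have hI := IB_zero_bd ν hν hz0
  have hI0 := IB_nonneg ν 0 z
  have hR := hM z a hz0
  set R := ∫ p in (0:ℝ)..(π/2), Real.cos (z * Real.cos p - a) * (Real.cos (ν*p) - Real.cos (p/2))
    with hRd
  have hm := main_term z a hz0
  have hsum : CB ν 0 z = 2 * (R + 2 / √(2*z) * T) := by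
    rw [CB_fold, ← hm, hRd, ← intervalIntegral.integral_add
      (Continuous.intervalIntegrable (by fun_prop) _ _)
      (Continuous.intervalIntegrable (by fun_prop) _ _)]
    congr 1
    refine intervalIntegral.integral_congr fun p _ => ?_
    beta_reduce
    ring
  have hTb : |T| ≤ (M+1) / q := by
    unfold FB at hF
    have h1 : 2 / √(2*z) * T = Real.sin (ν*π) * IB ν 0 z / 2 - R := by linarith
    have h2 : |2 / √(2*z) * T| ≤ (M+1) / z := by
      rw [h1]
      refine (abs_sub _ _).trans ?_
      have : |Real.sin (ν*π) * IB ν 0 z / 2| ≤ 1 / z := by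
        rw [mul_div_assoc]
        refine abs_mul_le_of1 (Real.abs_sin_le_one _) ?_
        rw [abs_of_nonneg (by positivity)]
        linarith
      rw [add_div]; linarith
    have h3 : √(2*z) ≤ 2 * q := by
      rw [Real.sqrt_le_left (by positivity), mul_pow, hq2]; linarith
    have h4 : 0 < √(2*z) := Real.sqrt_pos.2 (by positivity)
    rw [abs_mul, abs_of_pos (by positivity)] at h2
    have h5 : 1 / q ≤ 2 / √(2*z) := by
      rw [div_le_div_iff₀ hq0 h4]; linarith
    have h6 : 1 / q * |T| ≤ (M+1) / z := (mul_le_mul_of_nonneg_right h5 (abs_nonneg _)).trans h2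
    rw [← hq2] at h6
    have h7 := mul_le_mul_of_nonneg_left h6 hq0.le
    have e1 : q * (1/q * |T|) = |T| := by field_simp
    have e2 : q * ((M+1)/q^2) = (M+1)/q := by field_simp
    rwa [e1, e2] at h7
  have hAB := fA_small hq0
  have f1 := fresnel1 q
  have f2 := fresnel2 q
  have hcs := Real.sin_sq_add_cos_sq (z-a)
  have hT2 : T^2 = ((fC q)^2 + (fS q)^2)/2 + Real.cos (2*(z-a)) * fA q / 2
      + (π/4 - fB q) * Real.sin (2*(z-a)) / 2 := by
    rw [← f1, ← f2, Real.cos_two_mul, Real.sin_two_mul, hT]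
    linear_combination (fS q)^2 * hcs
  have hsum2 : |((fC q)^2 + (fS q)^2) - π/4| ≤ 24 / q := by
    set N := (fC q)^2 + (fS q)^2 with hN
    have hN0 : 0 ≤ N := by positivity
    have hN2 : N^2 = (fA q)^2 + (π/4 - fB q)^2 := by rw [← f1, ← f2, hN]; ring
    have u1 : N ≤ |fA q| + |π/4 - fB q| := by
      refine abs_le_of_sq_le_sq' ?_ (by positivity) |>.2
      rw [hN2, add_sq, sq_abs, sq_abs]
      nlinarith [mul_nonneg (abs_nonneg (fA q)) (abs_nonneg (π/4 - fB q))]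
    have u2 : |π/4 - fB q| ≤ N := by
      refine abs_le_of_sq_le_sq ?_ hN0
      rw [hN2]; nlinarith [sq_nonneg (fA q)]
    have u3 : |π/4 - fB q| ≤ π/4 + |fB q| := by
      refine (abs_sub _ _).trans ?_
      rw [abs_of_pos (by positivity : 0 < π/4)]
    have u4 : π/4 - fB q ≤ |π/4 - fB q| := le_abs_self _
    have u5 := le_abs_self (fB q)
    have e : 24 / q = 12 / q + 12 / q := by ring
    rw [e, abs_le]
    constructor <;> linarith [hAB.1, hAB.2, abs_nonneg (fA q)]
  have hT3 : T^2 ≤ (M+1)^2 / q := by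
    have h1 : T^2 ≤ ((M+1)/q)^2 := by rw [← sq_abs T]; gcongr
    refine h1.trans ?_
    rw [div_pow]
    gcongr
    exact le_self_pow₀ hq1 two_ne_zero
  have hkey : π/8 * (1 + Real.sin (2*(z-a))) = T^2 - (((fC q)^2 + (fS q)^2) - π/4)/2
      - Real.cos (2*(z-a)) * fA q / 2 + fB q * Real.sin (2*(z-a)) / 2 := by
    rw [hT2]; ring
  have hb : |π/8 * (1 + Real.sin (2*(z-a)))| ≤ ((M+1)^2 + 24) / q := by
    have g1 : |Real.cos (2*(z-a)) * fA q| ≤ 12 / q := by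
      exact abs_mul_le_of1 (Real.abs_cos_le_one _) hAB.1
    have g2 : |fB q * Real.sin (2*(z-a))| ≤ 12 / q := by
      rw [mul_comm]
      exact abs_mul_le_of1 (Real.abs_sin_le_one _) hAB.2
    have e : ((M+1)^2 + 24) / q = (M+1)^2/q + 24 / q := by ring
    have e' : 24 / q = 2 * (12 / q) := by ring
    have : 0 ≤ 12 / q := by positivity
    rw [hkey, e]
    rw [abs_le] at g1 g2 hsum2 ⊢
    have hTn := sq_nonneg T
    constructor <;> linarith [g1.1, g1.2, g2.1, g2.2, hsum2.1, hsum2.2,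
      show 0 ≤ (M+1)^2/q by positivity]
  rw [abs_mul, abs_of_pos (by positivity : 0 < π/8)] at hb
  have h9 : |1 + Real.sin (2*(z-a))| = 8/π * (π/8 * |1 + Real.sin (2*(z-a))|) := by field_simp
  rw [h9, mul_div_assoc]
  gcongr
end Part7

section Part8
open Real Set Filter MeasureTheory

/-! ### Normalised phase, counting -/

lemma phase_hits {ν : ℝ} (hν : 0 < ν) {θ : ℝ → ℝ} {L : ℝ} (h : IsPhase ν θ L) {a c : ℝ}
    (ha : 1 < a) (hc : θ a < c) : ∃ y, a < y ∧ θ y = c := by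
  obtain ⟨b, hb1, hb2⟩ := (((phase_atTop hν h).eventually_gt_atTop c).and
    (eventually_gt_atTop a)).exists
  have hcont : ContinuousOn θ (Icc a b) :=
    (phase_cont h).mono fun y hy => lt_of_lt_of_le ha hy.1
  obtain ⟨y, hy, hyc⟩ := intermediate_value_Ioo hb2.le hcont ⟨hc, hb1⟩
  exact ⟨y, hy.1, hyc⟩

lemma phase_normal (ν : ℝ) (hν : 0 < ν) : ∃ θ, IsPhase ν θ (-(π/4)) := by
  obtain ⟨θ, L, h⟩ := phase_exists ν hν
  have hp := Real.pi_pos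
  obtain ⟨M, hM⟩ := zeros_phase ν hν
  -- choose zeros
  have hnat : Tendsto (fun n : ℕ => (n:ℝ) * π + π/2) atTop atTop :=
    tendsto_atTop_add_const_right _ _ (tendsto_natCast_atTop_atTop.atTop_mul_const hp)
  have hex : ∀ n : ℕ, ∃ y, 1 < y ∧ (θ 2 < (n:ℝ)*π + π/2 → θ y = (n:ℝ)*π + π/2) := by
    intro n
    by_cases hn : θ 2 < (n:ℝ)*π + π/2
    · obtain ⟨y, hy, hy2⟩ := phase_hits hν h (by norm_num : (1:ℝ) < 2) hn
      exact ⟨y, by linarith, fun _ => hy2⟩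
    · exact ⟨2, by norm_num, fun h => absurd h hn⟩
  choose y hy1 hy2 using hex
  have hev : ∀ᶠ n : ℕ in atTop, θ (y n) = (n:ℝ)*π + π/2 := by
    filter_upwards [hnat.eventually_gt_atTop (θ 2)] with n hn
    exact hy2 n hn
  have hytop : Tendsto y atTop atTop := by
    rw [tendsto_atTop]
    intro b
    filter_upwards [hev, hnat.eventually_gt_atTop (θ (max b 2))] with n hn hn2
    by_contra hlt
    push Not at hlt
    have h1 : y n < max b 2 := lt_of_lt_of_le hlt (le_max_left _ _)
    have h2 := phase_strictMono hν h (hy1 n) (show (1:ℝ) < max b 2 from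
      lt_of_lt_of_le (by norm_num) (le_max_right _ _)) h1
    linarith
  have hlim := (phase_tendsto h).comp hytop
  have hztop : Tendsto (fun n => ν * y n) atTop atTop := hytop.const_mul_atTop hν
  have hs1 : Tendsto (fun n => 1 + Real.sin (2 * (ν * y n - ν*π/2))) atTop (nhds 0) := by
    have h1 : Tendsto (fun n => M / √(ν * y n)) atTop (nhds 0) :=
      Tendsto.div_atTop tendsto_const_nhds (Real.tendsto_sqrt_atTop.comp hztop)
    refine squeeze_zero_norm' ?_ h1
    filter_upwards [hev, hztop.eventually_ge_atTop 1] with n hn hn1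
    refine hM _ hn1 ?_
    rw [(h.1 (y n) (hy1 n)).2, hn, Real.cos_eq_zero_iff]
    exact ⟨n, by push_cast; ring⟩
  have hs2 : Tendsto (fun n => 1 + Real.sin (2 * (ν * y n - ν*π/2))) atTop
      (nhds (1 + Real.sin (π - 2 * (L - ν*(π/2)) - ν * π))) := by
    have hc : Tendsto (fun n => 1 + Real.sin (π - 2 * (θ (y n) - ν * y n) - ν * π)) atTop
      (nhds (1 + Real.sin (π - 2 * (L - ν*(π/2)) - ν * π))) :=
      ((Real.continuous_sin.tendsto _).comp
        (((hlim.const_mul 2).const_sub π).sub_const (ν*π))).const_add 1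
    refine hc.congr' ?_
    filter_upwards [hev] with n hn
    rw [hn, show π - 2 * ((n:ℝ)*π + π/2 - ν * y n) - ν * π =
      2 * (ν * y n - ν*π/2) - (n:ℝ) * (2*π) by ring, Real.sin_sub_nat_mul_two_pi]
  have hu := tendsto_nhds_unique hs1 hs2
  have hL : Real.sin (2*L) = -1 := by
    rw [show π - 2 * (L - ν*(π/2)) - ν * π = π - 2*L by ring, Real.sin_pi_sub] at hu
    linarith
  obtain ⟨n, hn⟩ := Real.sin_eq_neg_one_iff.1 hL
  refine ⟨fun y => θ y + (-n : ℤ) * π, ?_⟩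
  have := phase_shift h (-n)
  rw [show L + ((-n : ℤ):ℝ) * π = -(π/4) by push_cast; linarith] at this
  exact this

/-- The enumeration hypotheses. -/
structure IsEnum (J : ℝ → ℕ → ℝ) : Prop where
  pos : ∀ ν : ℝ, 0 ≤ ν → ∀ k : ℕ, 1 ≤ k → 0 < J ν k
  mono : ∀ ν : ℝ, 0 ≤ ν → ∀ k l : ℕ, 1 ≤ k → k < l → J ν k < J ν l
  zero : ∀ ν : ℝ, 0 ≤ ν → ∀ k : ℕ, 1 ≤ k → besselJ ν (J ν k) = 0
  all : ∀ ν : ℝ, 0 ≤ ν → ∀ z : ℝ, 0 < z → besselJ ν z = 0 → ∃ k : ℕ, 1 ≤ k ∧ J ν k = z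

lemma IsEnum.mono_le {J : ℝ → ℕ → ℝ} (hJ : IsEnum J) {ν : ℝ} (hν : 0 ≤ ν) {k l : ℕ} (hk : 1 ≤ k)
    (h : k ≤ l) : J ν k ≤ J ν l := by
  rcases h.eq_or_lt with h | h
  · rw [h]
  · exact (hJ.mono ν hν k l hk h).le

lemma IsEnum.lt_of {J : ℝ → ℕ → ℝ} (hJ : IsEnum J) {ν : ℝ} (hν : 0 ≤ ν) {k l : ℕ} (hl : 1 ≤ l)
    (h : J ν k < J ν l) : k < l := by
  by_contra hc
  push Not at hc
  exact absurd (hJ.mono_le hν hl hc) (not_le.2 h)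

lemma phase_at_zero {ν : ℝ} (hν : 0 < ν) {θ : ℝ → ℝ} {L : ℝ} (h : IsPhase ν θ L) {z : ℝ}
    (hz : ν < z) (h0 : besselJ ν z = 0) : ∃ m : ℤ, θ (z/ν) = (2*m+1)*π/2 := by
  have h1 : 1 < z/ν := by rwa [lt_div_iff₀ hν, one_mul]
  have h2 := (h.1 _ h1).2
  rw [mul_div_cancel₀ _ hν.ne', Real.cos_eq_zero_iff] at h2
  exact h2.1 h0

lemma enum_step {J : ℝ → ℕ → ℝ} (hJ : IsEnum J) {ν : ℝ} (hν : 0 < ν) {θ : ℝ → ℝ} {L : ℝ}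
    (h : IsPhase ν θ L) {l : ℕ} (hl : 1 ≤ l) (hz : ν < J ν l) :
    θ (J ν (l+1) / ν) = θ (J ν l / ν) + π := by
  have hp := Real.pi_pos
  obtain ⟨m, hm⟩ := phase_at_zero hν h hz (hJ.zero ν hν.le l hl)
  have h1 : 1 < J ν l / ν := by rwa [lt_div_iff₀ hν, one_mul]
  obtain ⟨y, hy, hyc⟩ := phase_hits hν h h1 (show θ (J ν l / ν) < θ (J ν l / ν) + π by linarith)
  have hy1 : 1 < y := by linarith
  have hyz : besselJ ν (ν*y) = 0 := by
    rw [(h.1 y hy1).2, hyc, hm, Real.cos_eq_zero_iff]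
    exact ⟨m+1, by push_cast; ring⟩
  obtain ⟨k, hk, hky⟩ := hJ.all ν hν.le (ν*y) (by positivity) hyz
  have hlk : l < k := by
    refine hJ.lt_of hν.le hk ?_
    rw [hky]; rw [div_lt_iff₀ hν] at hy; linarith
  have hlt := hJ.mono ν hν.le l (l+1) hl (Nat.lt_succ_self l)
  have hle : J ν (l+1) ≤ J ν k := hJ.mono_le hν.le (by omega) hlk
  rcases hle.eq_or_lt with he | hlt2
  · rw [he, hky, mul_div_cancel_left₀ _ hν.ne', hyc]
  exfalso
  obtain ⟨m', hm'⟩ := phase_at_zero hν h (hz.trans hlt) (hJ.zero ν hν.le (l+1) (by omega))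
  have h2 : 1 < J ν (l+1) / ν := by rw [lt_div_iff₀ hν, one_mul]; linarith
  have a1 := phase_strictMono hν h h1 h2 (by gcongr)
  have a2 := phase_strictMono hν h h2 hy1 (by rw [div_lt_iff₀ hν]; linarith)
  rw [hyc, hm', hm] at a2
  rw [hm', hm] at a1
  have b1 : ((m:ℝ)) < m' := by nlinarith
  have b2 : ((m':ℝ)) < m + 1 := by nlinarith
  have b1' : m < m' := by exact_mod_cast b1
  have b2' : m' < m + 1 := by exact_mod_cast b2
  omega

lemma enum_steps {J : ℝ → ℕ → ℝ} (hJ : IsEnum J) {ν : ℝ} (hν : 0 < ν) {θ : ℝ → ℝ} {L : ℝ}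
    (h : IsPhase ν θ L) {l : ℕ} (hl : 1 ≤ l) (hz : ν < J ν l) (n : ℕ) :
    θ (J ν (l+n) / ν) = θ (J ν l / ν) + n * π := by
  induction n with
  | zero => simp
  | succ n ih =>
    have h1 := enum_step hJ hν h (l := l + n) (by omega)
      (lt_of_lt_of_le hz (hJ.mono_le hν.le hl (by omega)))
    rw [← add_assoc, h1, ih]; push_cast; ring

lemma enum_unbounded {J : ℝ → ℕ → ℝ} (hJ : IsEnum J) {ν : ℝ} (hν : 0 < ν) {θ : ℝ → ℝ} {L : ℝ}
    (h : IsPhase ν θ L) : Tendsto (J ν) atTop atTop := by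
  have hp := Real.pi_pos
  rw [tendsto_atTop]
  intro b
  set a := max (b/ν) 2 with ha
  have ha1 : 1 < a := lt_of_lt_of_le (by norm_num) (le_max_right _ _)
  obtain ⟨n, hn⟩ := exists_nat_gt (θ a / π)
  rw [div_lt_iff₀ hp] at hn
  obtain ⟨y, hy, hyc⟩ := phase_hits hν h ha1 (show θ a < (2*(n:ℝ)+1)*π/2 by nlinarith)
  have hyz : besselJ ν (ν*y) = 0 := by
    rw [(h.1 y (by linarith)).2, hyc, Real.cos_eq_zero_iff]
    exact ⟨n, by push_cast; ring⟩
  obtain ⟨k, hk, hky⟩ := hJ.all ν hν.le (ν*y) (mul_pos hν (by linarith)) hyz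
  filter_upwards [eventually_ge_atTop k] with l hl
  refine le_trans ?_ (hJ.mono_le hν.le hk hl)
  rw [hky]
  have : b/ν < y := lt_of_le_of_lt (le_max_left _ _) hy
  rw [div_lt_iff₀ hν] at this
  linarith

/-- existence of the integer index shift -/
lemma enum_index {J : ℝ → ℕ → ℝ} (hJ : IsEnum J) {ν : ℝ} (hν : 0 < ν) {θ : ℝ → ℝ} {L : ℝ}
    (h : IsPhase ν θ L) : ∃ c : ℤ, ∀ l : ℕ, 1 ≤ l → ν < J ν l →
      θ (J ν l / ν) = ((l:ℝ) + c - 1/2) * π := by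
  obtain ⟨l0, hl0, hl1⟩ := (((enum_unbounded hJ hν h).eventually_gt_atTop ν).and
    (eventually_ge_atTop 1)).exists
  obtain ⟨m, hm⟩ := phase_at_zero hν h hl0 (hJ.zero ν hν.le l0 hl1)
  refine ⟨m + 1 - l0, fun l hl hz => ?_⟩
  rcases le_total l0 l with hle | hle
  · obtain ⟨n, rfl⟩ := Nat.exists_eq_add_of_le hle
    rw [enum_steps hJ hν h hl1 hl0, hm]
    push_cast; ring
  · obtain ⟨n, rfl⟩ := Nat.exists_eq_add_of_le hle
    have := enum_steps hJ hν h hl hz n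
    rw [hm] at this
    push_cast
    linarith

/-- asymptotic shift -/
def HasShift (J : ℝ → ℕ → ℝ) (ν : ℝ) (c : ℤ) : Prop :=
  Tendsto (fun l : ℕ => J ν l - ((l:ℝ) + c + ν/2 - 1/4) * π) atTop (nhds 0)

lemma index_shift {J : ℝ → ℕ → ℝ} (hJ : IsEnum J) {ν : ℝ} (hν : 0 < ν) {θ : ℝ → ℝ}
    (h : IsPhase ν θ (-(π/4))) {c : ℤ} (hc : ∀ l : ℕ, 1 ≤ l → ν < J ν l →
      θ (J ν l / ν) = ((l:ℝ) + c - 1/2) * π) : HasShift J ν c := by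
  have hu := enum_unbounded hJ hν h
  have h1 := (phase_tendsto h).comp (hu.atTop_div_const hν)
  have h2 := (h1.const_sub (-(π/4) - ν*(π/2)))
  rw [sub_self] at h2
  refine h2.congr' ?_
  filter_upwards [hu.eventually_gt_atTop ν, eventually_ge_atTop 1] with l hl hl1
  simp only [Function.comp]
  rw [hc l hl1 hl, mul_div_cancel₀ _ hν.ne']
  ring
end Part8

section Part9
open Real Set Filter MeasureTheory

/-! ### Sturm comparison, Rolle, determination of the index shift -/

lemma sign_exists {f : ℝ → ℝ} {p q : ℝ} (hpq : p < q) (hf : ContinuousOn f (Ioo p q))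
    (h0 : ∀ x ∈ Ioo p q, f x ≠ 0) : ∃ σ : ℝ, σ ≠ 0 ∧ ∀ x ∈ Ioo p q, 0 < σ * f x := by
  have hm : (p+q)/2 ∈ Ioo p q := ⟨by linarith, by linarith⟩
  refine ⟨f ((p+q)/2), h0 _ hm, fun x hx => ?_⟩
  by_contra hneg
  push Not at hneg
  have hpc : IsPreconnected (Ioo p q) := isPreconnected_Ioo
  have key : ∃ y ∈ Ioo p q, f y = 0 := by
    rcases lt_or_gt_of_ne (h0 _ hm) with h | h
    · have hx0 : 0 ≤ f x := by
        by_contra hc; push Not at hc; nlinarith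
      obtain ⟨y, hy, hy2⟩ := hpc.intermediate_value hm hx hf ⟨h.le, hx0⟩
      exact ⟨y, hy, hy2⟩
    · have hx0 : f x ≤ 0 := by
        by_contra hc; push Not at hc; nlinarith
      obtain ⟨y, hy, hy2⟩ := hpc.intermediate_value hx hm hf ⟨hx0, h.le⟩
      exact ⟨y, hy, hy2⟩
  obtain ⟨y, hy, hy2⟩ := key
  exact h0 y hy hy2

lemma deriv_nonpos_right {v : ℝ → ℝ} {d p q : ℝ} (hpq : p < q) (hv : ∀ x ∈ Ioo p q, 0 < v x)
    (hq : v q = 0) (hd : HasDerivAt v d q) : d ≤ 0 := by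
  have h1 := hd.hasDerivWithinAt (s := Iio q)
  rw [hasDerivWithinAt_iff_tendsto_slope' (by simp)] at h1
  refine le_of_tendsto h1 ?_
  filter_upwards [Ioo_mem_nhdsLT hpq] with x hx
  rw [slope_def_field, hq]
  exact div_nonpos_of_nonneg_of_nonpos (by linarith [hv x hx]) (by linarith [hx.2])

lemma deriv_nonneg_left {v : ℝ → ℝ} {d p q : ℝ} (hpq : p < q) (hv : ∀ x ∈ Ioo p q, 0 < v x)
    (hq : v p = 0) (hd : HasDerivAt v d p) : 0 ≤ d := by
  have h1 := hd.hasDerivWithinAt (s := Ioi p)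
  rw [hasDerivWithinAt_iff_tendsto_slope' (by simp)] at h1
  refine ge_of_tendsto h1 ?_
  filter_upwards [Ioo_mem_nhdsGT hpq] with x hx
  rw [slope_def_field, hq]
  exact div_nonneg (by linarith [hv x hx]) (by linarith [hx.1])

noncomputable def Wr (ν μ x : ℝ) : ℝ := x * (besselJ ν x * dJ μ x - dJ ν x * besselJ μ x)

lemma Wr_hasDerivAt {ν μ x : ℝ} (hν : 0 < ν) (hμ : 0 < μ) (hx : 0 < x) :
    HasDerivAt (Wr ν μ) ((μ^2 - ν^2) * (besselJ ν x * besselJ μ x) / x) x := by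
  have h := (hasDerivAt_id x).mul
    (((besselJ_hasDerivAt ν hν.le x hx).mul (dJ_hasDerivAt μ hμ.le x hx)).sub
      ((dJ_hasDerivAt ν hν.le x hx).mul (besselJ_hasDerivAt μ hμ.le x hx)))
  refine h.congr_deriv ?_
  simp only [id, Pi.sub_apply, Pi.mul_apply]
  field_simp
  ring

lemma Wr_tendsto {ν μ : ℝ} (hν : 0 < ν) (hμ : 0 < μ) :
    Tendsto (Wr ν μ) (nhdsWithin 0 (Ioi 0)) (nhds 0) := by
  have h := ((besselJ_tendsto_zero ν hν).mul (zdJ_tendsto_zero μ hμ)).sub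
    ((zdJ_tendsto_zero ν hν).mul (besselJ_tendsto_zero μ hμ))
  simp only [mul_zero, sub_zero] at h
  refine h.congr fun x => ?_
  unfold Wr; ring

lemma besselJ_contAt {ν x : ℝ} (hν : 0 < ν) (hx : 0 < x) : ContinuousAt (besselJ ν) x :=
  (besselJ_hasDerivAt ν hν.le x hx).continuousAt

/-- Sturm: between `p` and `q` (consecutive zeros of the higher order function, or `p = 0`). -/
lemma sturm {ν μ p q : ℝ} (hν : 0 < ν) (hνμ : ν < μ) (hp : 0 ≤ p) (hpq : p < q)
    (hp0 : p = 0 ∨ besselJ μ p = 0) (hq0 : besselJ μ q = 0)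
    (hne : ∀ x ∈ Ioo p q, besselJ μ x ≠ 0) : ∃ x ∈ Ioo p q, besselJ ν x = 0 := by
  by_contra hno
  push Not at hno
  have hμ : 0 < μ := by linarith
  have hxpos : ∀ x ∈ Ioo p q, 0 < x := fun x hx => lt_of_le_of_lt hp hx.1
  have hq : 0 < q := by linarith
  obtain ⟨σ, hσ, hσ2⟩ := sign_exists hpq
    (fun x hx => (besselJ_contAt hμ (hxpos x hx)).continuousWithinAt) hne
  obtain ⟨τ, hτ, hτ2⟩ := sign_exists hpq
    (fun x hx => (besselJ_contAt hν (hxpos x hx)).continuousWithinAt) hno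
  set W : ℝ → ℝ := fun x => (σ*τ) * Wr ν μ x with hW
  have hWd : ∀ x, 0 < x → HasDerivAt W ((σ*τ) * ((μ^2 - ν^2) * (besselJ ν x * besselJ μ x) / x)) x :=
    fun x hx => (Wr_hasDerivAt hν hμ hx).const_mul _
  have hmono : StrictMonoOn W (Ioc p q) := by
    apply strictMonoOn_of_deriv_pos (convex_Ioc p q)
    · intro x hx
      exact (hWd x (lt_of_le_of_lt hp hx.1)).continuousAt.continuousWithinAt
    · intro x hx
      rw [interior_Ioc] at hx
      have hx0 := hxpos x hx
      rw [(hWd x hx0).deriv]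
      have e : (σ*τ) * ((μ^2 - ν^2) * (besselJ ν x * besselJ μ x) / x) =
        ((μ - ν) * (μ + ν)) * ((τ * besselJ ν x) * (σ * besselJ μ x)) / x := by ring
      rw [e]
      have h1 := hσ2 x hx
      have h2 := hτ2 x hx
      have h3 : 0 < μ - ν := by linarith
      positivity
  have hWq : W q ≤ 0 := by
    have h1 : σ * dJ μ q ≤ 0 := by
      refine deriv_nonpos_right (v := fun x => σ * besselJ μ x) hpq hσ2 (by simp [hq0]) ?_
      exact (besselJ_hasDerivAt μ hμ.le q hq).const_mul σ
    have h2 : 0 ≤ τ * besselJ ν q := by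
      have ht : Tendsto (fun x => τ * besselJ ν x) (nhdsWithin q (Iio q)) (nhds (τ * besselJ ν q)) :=
        ((besselJ_contAt hν hq).tendsto.const_mul τ).mono_left nhdsWithin_le_nhds
      refine ge_of_tendsto ht ?_
      filter_upwards [Ioo_mem_nhdsLT hpq] with x hx
      exact (hτ2 x hx).le
    have e : W q = q * ((τ * besselJ ν q) * (σ * dJ μ q)) := by
      rw [hW]; simp only [Wr, hq0]; ring
    rw [e]
    exact mul_nonpos_of_nonneg_of_nonpos hq.le (mul_nonpos_of_nonneg_of_nonpos h2 h1)
  have hWp : ∃ w, 0 ≤ w ∧ Tendsto W (nhdsWithin p (Ioi p)) (nhds w) := by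
    rcases hp.eq_or_lt with h | h
    · refine ⟨0, le_rfl, ?_⟩
      rw [← h]
      simpa using (Wr_tendsto hν hμ).const_mul (σ*τ)
    · have hp0' : besselJ μ p = 0 := by
        rcases hp0 with h' | h'
        · exact absurd h' h.ne'
        · exact h'
      refine ⟨W p, ?_, (hWd p h).continuousAt.tendsto.mono_left nhdsWithin_le_nhds⟩
      have h1 : 0 ≤ σ * dJ μ p := by
        refine deriv_nonneg_left (v := fun x => σ * besselJ μ x) hpq hσ2 (by simp [hp0']) ?_
        exact (besselJ_hasDerivAt μ hμ.le p h).const_mul σ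
      have h2 : 0 ≤ τ * besselJ ν p := by
        have ht : Tendsto (fun x => τ * besselJ ν x) (nhdsWithin p (Ioi p))
            (nhds (τ * besselJ ν p)) :=
          ((besselJ_contAt hν h).tendsto.const_mul τ).mono_left nhdsWithin_le_nhds
        refine ge_of_tendsto ht ?_
        filter_upwards [Ioo_mem_nhdsGT hpq] with x hx
        exact (hτ2 x hx).le
      have e : W p = p * ((τ * besselJ ν p) * (σ * dJ μ p)) := by
        rw [hW]; simp only [Wr, hp0']; ring
      rw [e]
      positivity
  obtain ⟨w, hw0, hw⟩ := hWp
  have hm1 : (p+q)/2 ∈ Ioc p q := ⟨by linarith, by linarith⟩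
  have hm2 : W ((p+q)/2) < W q := hmono hm1 ⟨hpq, le_rfl⟩ (by linarith)
  have : w ≤ W ((p+q)/2) := by
    refine le_of_tendsto hw ?_
    filter_upwards [Ioo_mem_nhdsGT (show p < (p+q)/2 by linarith)] with x hx
    exact (hmono ⟨hx.1, by linarith [hx.2]⟩ hm1 hx.2).le
  linarith

lemma enum_consec {J : ℝ → ℕ → ℝ} (hJ : IsEnum J) {ν : ℝ} (hν : 0 ≤ ν) {k : ℕ} (hk : 1 ≤ k) :
    ∀ x ∈ Ioo (J ν k) (J ν (k+1)), besselJ ν x ≠ 0 := by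
  intro x hx h0
  obtain ⟨m, hm, hmx⟩ := hJ.all ν hν x (lt_trans (hJ.pos ν hν k hk) hx.1) h0
  rw [← hmx] at hx
  have h1 := hJ.lt_of hν hm hx.1
  have h2 := hJ.lt_of hν (by omega) hx.2
  omega

lemma enum_sturm {J : ℝ → ℕ → ℝ} (hJ : IsEnum J) {ν μ : ℝ} (hν : 0 < ν) (hνμ : ν < μ) (k : ℕ)
    (hk : 1 ≤ k) : J ν k ≤ J μ k := by
  have hμ : 0 < μ := by linarith
  induction k, hk using Nat.le_induction with
  | base =>
    have hne : ∀ x ∈ Ioo 0 (J μ 1), besselJ μ x ≠ 0 := by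
      intro x hx h0
      obtain ⟨m, hm, hmx⟩ := hJ.all μ hμ.le x hx.1 h0
      have := hJ.mono_le hμ.le le_rfl hm
      linarith [hx.2]
    obtain ⟨x, hx, hx0⟩ := sturm hν hνμ le_rfl (hJ.pos μ hμ.le 1 le_rfl) (Or.inl rfl)
      (hJ.zero μ hμ.le 1 le_rfl) hne
    obtain ⟨m, hm, hmx⟩ := hJ.all ν hν.le x hx.1 hx0
    have := hJ.mono_le hν.le le_rfl hm
    linarith [hx.2]
  | succ k hk ih =>
    obtain ⟨x, hx, hx0⟩ := sturm hν hνμ (hJ.pos μ hμ.le k hk).le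
      (hJ.mono μ hμ.le k (k+1) hk (Nat.lt_succ_self k)) (Or.inr (hJ.zero μ hμ.le k hk))
      (hJ.zero μ hμ.le (k+1) (by omega)) (enum_consec hJ hμ.le hk)
    obtain ⟨m, hm, hmx⟩ := hJ.all ν hν.le x (lt_trans (hJ.pos μ hμ.le k hk) hx.1) hx0
    have h1 : k < m := hJ.lt_of hν.le hm (by rw [hmx]; linarith [hx.1])
    have := hJ.mono_le hν.le (by omega) (show k+1 ≤ m from h1)
    linarith [hx.2]

lemma rolle_zero {ν p q : ℝ} (hν : 0 < ν) (hp : 0 < p) (hpq : p < q) (h1 : besselJ ν p = 0)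
    (h2 : besselJ ν q = 0) : ∃ x ∈ Ioo p q, besselJ (ν+1) x = 0 := by
  have hd : ∀ x, 0 < x → HasDerivAt (fun x => x^(-ν) * besselJ ν x)
      (-(x^(-ν) * besselJ (ν+1) x)) x := by
    intro x hx
    have h := (Real.hasDerivAt_rpow_const (p := -ν) (Or.inl hx.ne')).mul
      (besselJ_hasDerivAt ν hν.le x hx)
    refine h.congr_deriv ?_
    rw [Real.rpow_sub hx, Real.rpow_one]
    unfold dJ
    field_simp
    ring
  obtain ⟨x, hx, hx0⟩ := exists_hasDerivAt_eq_zero hpq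
    (fun x hx => (hd x (lt_of_lt_of_le hp hx.1)).continuousAt.continuousWithinAt)
    (by simp [h1, h2]) (fun x hx => hd x (hp.trans hx.1))
  refine ⟨x, hx, ?_⟩
  have : 0 < x^(-ν) := Real.rpow_pos_of_pos (hp.trans hx.1) _
  rw [neg_eq_zero, mul_eq_zero] at hx0
  exact hx0.resolve_left this.ne'

lemma enum_rolle {J : ℝ → ℕ → ℝ} (hJ : IsEnum J) {ν : ℝ} (hν : 0 < ν) (k : ℕ)
    (hk : 1 ≤ k) : J (ν+1) k ≤ J ν (k+1) := by
  have hν1 : 0 ≤ ν + 1 := by linarith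
  induction k, hk using Nat.le_induction with
  | base =>
    obtain ⟨x, hx, hx0⟩ := rolle_zero hν (hJ.pos ν hν.le 1 le_rfl)
      (hJ.mono ν hν.le 1 2 le_rfl (by omega)) (hJ.zero ν hν.le 1 le_rfl)
      (hJ.zero ν hν.le 2 (by omega))
    obtain ⟨m, hm, hmx⟩ := hJ.all (ν+1) hν1 x (lt_trans (hJ.pos ν hν.le 1 le_rfl) hx.1) hx0
    have := hJ.mono_le hν1 le_rfl hm
    linarith [hx.2]
  | succ k hk ih =>
    obtain ⟨x, hx, hx0⟩ := rolle_zero hν (hJ.pos ν hν.le (k+1) (by omega))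
      (hJ.mono ν hν.le (k+1) (k+1+1) (by omega) (by omega)) (hJ.zero ν hν.le (k+1) (by omega))
      (hJ.zero ν hν.le (k+1+1) (by omega))
    obtain ⟨m, hm, hmx⟩ := hJ.all (ν+1) hν1 x (lt_trans (hJ.pos ν hν.le _ (by omega)) hx.1) hx0
    have h1 : k < m := hJ.lt_of hν1 hm (by rw [hmx]; linarith [hx.1])
    have := hJ.mono_le hν1 (by omega) (show k+1 ≤ m from h1)
    linarith [hx.2]

lemma shift_le {J : ℝ → ℕ → ℝ} (hJ : IsEnum J) {ν μ : ℝ} (hν : 0 < ν) (hνμ : ν < μ) {c d : ℤ}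
    (hc : HasShift J ν c) (hd : HasShift J μ d) : (c:ℝ) + ν/2 ≤ d + μ/2 := by
  have hp := Real.pi_pos
  have h := hd.sub hc
  rw [sub_zero] at h
  have h2 : -(((d:ℝ) + μ/2) - (c + ν/2)) * π ≤ 0 := by
    refine ge_of_tendsto h ?_
    filter_upwards [eventually_ge_atTop 1] with l hl
    have := enum_sturm hJ hν hνμ l hl
    nlinarith
  nlinarith

lemma shift_rolle {J : ℝ → ℕ → ℝ} (hJ : IsEnum J) {ν : ℝ} (hν : 0 < ν) {c d : ℤ}
    (hc : HasShift J ν c) (hd : HasShift J (ν+1) d) : d ≤ c := by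
  have hp := Real.pi_pos
  have h := (hc.comp (tendsto_add_atTop_nat 1)).sub hd
  rw [sub_zero] at h
  have h2 : -(((c:ℝ) + 1 + ν/2) - (d + (ν+1)/2)) * π ≤ 0 := by
    refine ge_of_tendsto h ?_
    filter_upwards [eventually_ge_atTop 1] with l hl
    have := enum_rolle hJ hν l hl
    simp only [Function.comp]
    push_cast
    nlinarith
  have h3 : (d:ℝ) < c + 1 := by nlinarith
  have h4 : d < c + 1 := by exact_mod_cast h3
  omega

lemma shift_exists {J : ℝ → ℕ → ℝ} (hJ : IsEnum J) {ν : ℝ} (hν : 0 < ν) :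
    ∃ c, HasShift J ν c := by
  obtain ⟨θ, h⟩ := phase_normal ν hν
  obtain ⟨c, hc⟩ := enum_index hJ hν h
  exact ⟨c, index_shift hJ hν h hc⟩

lemma shift_unique {J : ℝ → ℕ → ℝ} {ν : ℝ} {c d : ℤ}
    (hc : HasShift J ν c) (hd : HasShift J ν d) : c = d := by
  have h := hc.sub hd
  rw [sub_zero] at h
  have h2 : Tendsto (fun _ : ℕ => ((d:ℝ) - c) * π) atTop (nhds 0) :=
    h.congr fun l => by ring
  have h3 := tendsto_nhds_unique h2 tendsto_const_nhds
  have h4 : ((d:ℝ) - c) = 0 := by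
    rcases mul_eq_zero.1 h3.symm with h | h
    · exact h
    · exact absurd h Real.pi_ne_zero
  have : (c:ℝ) = d := by linarith
  exact_mod_cast this

lemma enum_half {J : ℝ → ℕ → ℝ} (hJ : IsEnum J) (l : ℕ) (hl : 1 ≤ l) : J (1/2) l = l * π := by
  have hp := Real.pi_pos
  have hh : (0:ℝ) ≤ 1/2 := by norm_num
  have hz : ∀ z : ℝ, 0 < z → (besselJ (1/2) z = 0 ↔ Real.sin z = 0) := by
    intro z hz
    rw [besselJ_half z hz, mul_eq_zero]
    have : √(2/(π*z)) ≠ 0 := (Real.sqrt_pos.2 (by positivity)).ne'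
    exact ⟨fun h => h.resolve_left this, Or.inr⟩
  have hk : ∀ k : ℕ, 1 ≤ k → ∃ m, 1 ≤ m ∧ J (1/2) m = k * π := by
    intro k hk
    have h0 : (0:ℝ) < k * π := by positivity
    exact hJ.all _ hh _ h0 ((hz _ h0).2 (Real.sin_nat_mul_pi k))
  have hm : ∀ k : ℕ, 1 ≤ k → ∃ m : ℤ, J (1/2) k = m * π := by
    intro k hk
    have h1 := (hz _ (hJ.pos _ hh k hk)).1 (hJ.zero _ hh k hk)
    obtain ⟨m, hm⟩ := Real.sin_eq_zero_iff.1 h1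
    exact ⟨m, hm.symm⟩
  refine le_antisymm ?_ ?_
  · induction l, hl using Nat.le_induction with
    | base =>
      obtain ⟨m, hm1, hm2⟩ := hk 1 le_rfl
      rw [← hm2]; exact hJ.mono_le hh le_rfl hm1
    | succ l hl ih =>
      obtain ⟨m, hm1, hm2⟩ := hk (l+1) (by omega)
      have : l < m := hJ.lt_of hh hm1 (by rw [hm2]; push_cast; nlinarith)
      rw [← hm2]; exact hJ.mono_le hh (by omega) this
  · induction l, hl using Nat.le_induction with
    | base =>
      obtain ⟨m, hm⟩ := hm 1 le_rfl
      have h0 := hJ.pos _ hh 1 le_rfl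
      rw [hm] at h0 ⊢
      have h1 : (0:ℝ) < m := by by_contra hc; push Not at hc; nlinarith
      have h2 : (0:ℤ) < m := by exact_mod_cast h1
      have h3 : (1:ℝ) ≤ m := by exact_mod_cast h2
      push_cast
      nlinarith
    | succ l hl ih =>
      obtain ⟨m, hm⟩ := hm (l+1) (by omega)
      have h0 := hJ.mono _ hh l (l+1) hl (Nat.lt_succ_self l)
      rw [hm] at h0 ⊢
      have h1 : (l:ℝ) < m := by by_contra hc; push Not at hc; nlinarith
      have h2 : (l:ℤ) < m := by exact_mod_cast h1
      have h3 : ((l:ℝ)+1) ≤ m := by exact_mod_cast h2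
      push_cast
      nlinarith

lemma shift_half {J : ℝ → ℕ → ℝ} (hJ : IsEnum J) (n : ℕ) : HasShift J (n + 1/2) 0 := by
  induction n with
  | zero =>
    unfold HasShift
    refine tendsto_const_nhds.congr' ?_
    filter_upwards [eventually_ge_atTop 1] with l hl
    rw [show ((0:ℕ):ℝ) + 1/2 = 1/2 by norm_num, enum_half hJ l hl]
    push_cast; ring
  | succ n ih =>
    have hpos : (0:ℝ) < n + 1/2 := by positivity
    have e : (((n+1:ℕ):ℝ) + 1/2) = (n + 1/2) + 1 := by push_cast; ring
    rw [e]
    obtain ⟨d, hd⟩ := shift_exists hJ (ν := (n + 1/2) + 1) (by linarith)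
    have h1 := shift_rolle hJ hpos ih hd
    have h2 := shift_le hJ hpos (by linarith) ih hd
    have h3 : (-1:ℝ) < d := by push_cast at h2; linarith
    have h4 : (-1:ℤ) < d := by exact_mod_cast h3
    have : d = 0 := by omega
    rwa [this] at hd

lemma shift_zero {J : ℝ → ℕ → ℝ} (hJ : IsEnum J) {ν : ℝ} (hν : 1/2 ≤ ν) : HasShift J ν 0 := by
  have hν0 : 0 < ν := by linarith
  obtain ⟨c, hc⟩ := shift_exists hJ hν0
  set n := ⌊ν - 1/2⌋₊ with hn
  have h1 : (n:ℝ) ≤ ν - 1/2 := Nat.floor_le (by linarith)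
  have h2 : ν - 1/2 < n + 1 := Nat.lt_floor_add_one _
  rcases h1.eq_or_lt with he | hlt
  · have := shift_half hJ n
    rwa [show (n:ℝ) + 1/2 = ν by linarith] at this
  have a1 := shift_le hJ (show (0:ℝ) < n + 1/2 by positivity) (by linarith) (shift_half hJ n) hc
  have a2 := shift_le hJ hν0 (show ν < ((n+1:ℕ):ℝ) + 1/2 by push_cast; linarith) hc
    (shift_half hJ (n+1))
  push_cast at a1 a2
  have b1 : (-1:ℝ) < c := by linarith
  have b2 : (c:ℝ) < 1 := by linarith
  have b1' : (-1:ℤ) < c := by exact_mod_cast b1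
  have b2' : c < 1 := by exact_mod_cast b2
  have : c = 0 := by omega
  rwa [this] at hc

/-- Final output of the counting part. -/
lemma phase_index {J : ℝ → ℕ → ℝ} (hJ : IsEnum J) {ν : ℝ} (hν : 1/2 ≤ ν) : ∃ θ : ℝ → ℝ,
    IsPhase ν θ (-(π/4)) ∧ ∀ l : ℕ, 1 ≤ l → ∀ y, 1 < y → θ y = ((l:ℝ) - 1/2) * π → J ν l = ν * y := by
  have hν0 : 0 < ν := by linarith
  have hp := Real.pi_pos
  obtain ⟨θ, h⟩ := phase_normal ν hν0
  obtain ⟨c, hc⟩ := enum_index hJ hν0 h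
  have h0 := shift_unique (index_shift hJ hν0 h hc) (shift_zero hJ hν)
  subst h0
  refine ⟨θ, h, fun l hl y hy hyl => ?_⟩
  have hz : besselJ ν (ν*y) = 0 := by
    rw [(h.1 y hy).2, hyl, Real.cos_eq_zero_iff]
    exact ⟨l - 1, by push_cast; ring⟩
  obtain ⟨k, hk, hky⟩ := hJ.all ν hν0.le (ν*y) (by positivity) hz
  have h1 := hc k hk (by rw [hky]; nlinarith)
  rw [hky, mul_div_cancel_left₀ _ hν0.ne', hyl] at h1
  have h2 : (l:ℝ) = k := by
    have := mul_right_cancel₀ hp.ne' h1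
    push_cast at this; linarith
  have h3 : l = k := by exact_mod_cast h2
  rw [h3, hky]
end Part9

section Part10
open Real Set Filter MeasureTheory

/-! ### Part 10: the integral of `theta0` -/

/-- closed form of the moment integral -/
noncomputable def kap3 (a : ℝ) : ℝ := -(a / (3 * (1 - a^2)))
noncomputable def kap2 (a : ℝ) : ℝ := (3 + 2 * a^2) / (6 * (1 - a^2)^2)
noncomputable def kap1 (a : ℝ) : ℝ :=
  (-(2 * a / (3 * (1 - a^2))) - a * (3 + 2 * a^2) / (2 * (1 - a^2)^2)) / (1 - a^2)
noncomputable def kap0 (a : ℝ) : ℝ := kap2 a - a * kap1 a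

lemma arctan_half {a : ℝ} (h0 : 0 < a) (h1 : a < 1) :
    π/2 - arctan ((1 + a)/√(1 - a^2)) = arccos a / 2 := by
  have hb : arccos a = arccos a := rfl
  set b := arccos a with hbdef
  have hca : cos b = a := Real.cos_arccos (by linarith) h1.le
  have hsa : sin b = √(1 - a^2) := Real.sin_arccos a
  have hb0 : 0 < b := Real.arccos_pos.2 h1
  have hb1 : b < π/2 := Real.arccos_lt_pi_div_two.2 h0
  have hp := Real.pi_pos
  have h2 : (1 + a)/√(1 - a^2) = tan (π/2 - b/2) := by
    rw [Real.tan_eq_sin_div_cos, Real.sin_pi_div_two_sub, Real.cos_pi_div_two_sub, ← hsa, ← hca]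
    have e1 : cos b = 2 * cos (b/2)^2 - 1 := by
      rw [← Real.cos_two_mul]; congr 1; ring
    have e2 : sin b = 2 * sin (b/2) * cos (b/2) := by
      rw [← Real.sin_two_mul]; congr 1; ring
    have hs : 0 < sin (b/2) := Real.sin_pos_of_pos_of_lt_pi (by linarith) (by linarith)
    have hc : 0 < cos (b/2) := Real.cos_pos_of_mem_Ioo ⟨by linarith, by linarith⟩
    rw [e1, e2]
    field_simp
    ring
  rw [h2, Real.arctan_tan (by linarith) (by linarith)]
  ring

noncomputable def Lanti (a t : ℝ) : ℝ :=
  kap0 a * (2/√(1 - a^2)) * arctan ((exp t + a)/√(1 - a^2))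
    + kap1 a * (sinh t / (cosh t + a)) + kap2 a * (sinh t / (cosh t + a)^2)
    + kap3 a * (sinh t / (cosh t + a)^3)

lemma Lanti_hasDerivAt {a : ℝ} (h0 : 0 < a) (h1 : a < 1) (t : ℝ) :
    HasDerivAt (Lanti a) (cosh t / (cosh t + a)^4) t := by
  have hs2 : 0 < 1 - a^2 := by nlinarith
  have hs : 0 < √(1 - a^2) := Real.sqrt_pos.2 hs2
  have hsq : √(1 - a^2)^2 = 1 - a^2 := Real.sq_sqrt hs2.le
  have hC := Real.cosh_pos t
  have hD : 0 < cosh t + a := by linarith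
  have he := Real.exp_pos t
  have d1 : HasDerivAt (fun t => arctan ((exp t + a)/√(1 - a^2)))
      (√(1 - a^2) / 2 * (1/(cosh t + a))) t := by
    have := ((((Real.hasDerivAt_exp t).add_const a).div_const (√(1-a^2)))).arctan
    refine this.congr_deriv ?_
    rw [Real.cosh_eq, Real.exp_neg]
    have : 0 < √(1 - a^2)^2 + (exp t + a)^2 := by positivity
    have e1 : exp t ^ 2 + 1 + 2 * a * exp t = √(1 - a^2)^2 + (exp t + a)^2 := by rw [hsq]; ring
    have e2 : 0 < (exp t + (exp t)⁻¹)/2 + a := by positivity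
    have e3 : 1 + ((exp t + a)/√(1 - a^2))^2 = (√(1 - a^2)^2 + (exp t + a)^2)/√(1-a^2)^2 := by
      field_simp
    have e4 : (exp t + (exp t)⁻¹)/2 + a = (√(1 - a^2)^2 + (exp t + a)^2) / (2 * exp t) := by
      rw [← e1]; field_simp
    rw [e3, e4]
    field_simp
  have dD : HasDerivAt (fun t => cosh t + a) (sinh t) t := (Real.hasDerivAt_cosh t).add_const a
  have dS := Real.hasDerivAt_sinh t
  have d2 := dS.div dD hD.ne'
  have d3 := dS.div (dD.pow 2) (pow_pos hD 2).ne'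
  have d4 := dS.div (dD.pow 3) (pow_pos hD 3).ne'
  have hd := (((d1.const_mul (kap0 a * (2/√(1 - a^2)))).add (d2.const_mul (kap1 a))).add
    (d3.const_mul (kap2 a))).add (d4.const_mul (kap3 a))
  refine hd.congr_deriv ?_
  have hsh : sinh t * sinh t = cosh t^2 - 1 := by
    have := Real.cosh_sq t; nlinarith
  simp only [Pi.pow_apply]
  push_cast
  have f0 : kap0 a * (2/√(1 - a^2)) * (√(1 - a^2) / 2 * (1/(cosh t + a))) = kap0 a / (cosh t + a) := by
    field_simp
  rw [f0]
  have g2 : (cosh t * (cosh t + a) - sinh t * sinh t) / (cosh t + a)^2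
     = (a * cosh t + 1) / (cosh t + a)^2 := by rw [hsh]; ring
  have g3 : (cosh t * (cosh t + a)^2 - sinh t * (2 * (cosh t + a)^(2-1) * sinh t)) / ((cosh t + a)^2)^2
     = (cosh t * (cosh t + a) - 2 * (cosh t^2 - 1)) / (cosh t + a)^3 := by
    rw [← hsh]; norm_num; field_simp
  have g4 : (cosh t * (cosh t + a)^3 - sinh t * (3 * (cosh t + a)^(3-1) * sinh t)) / ((cosh t + a)^3)^2
     = (cosh t * (cosh t + a) - 3 * (cosh t^2 - 1)) / (cosh t + a)^4 := by
    rw [← hsh]; norm_num; field_simp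
  rw [g2, g3, g4]
  unfold kap0 kap1 kap2 kap3
  have hs2' : 1 - a^2 ≠ 0 := hs2.ne'
  generalize cosh t = C at *
  field_simp
  ring

lemma Lanti_tendsto {a : ℝ} (h0 : 0 < a) (h1 : a < 1) :
    Tendsto (Lanti a) atTop (nhds (kap0 a * (2/√(1 - a^2)) * (π/2) + kap1 a)) := by
  have hs2 : 0 < 1 - a^2 := by nlinarith
  have hs : 0 < √(1 - a^2) := Real.sqrt_pos.2 hs2
  have t1 : Tendsto (fun t => arctan ((exp t + a)/√(1 - a^2))) atTop (nhds (π/2)) := by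
    refine (Real.tendsto_arctan_atTop.mono_right nhdsWithin_le_nhds).comp ?_
    exact (Real.tendsto_exp_atTop.atTop_add tendsto_const_nhds).atTop_div_const hs
  have te : Tendsto (fun t : ℝ => exp (-t)) atTop (nhds 0) := Real.tendsto_exp_neg_atTop_nhds_zero
  have t2 : Tendsto (fun t => sinh t / (cosh t + a)) atTop (nhds 1) := by
    have : Tendsto (fun t : ℝ => (1 - exp (-t) * exp (-t)) / (1 + exp (-t) * exp (-t) + 2 * a * exp (-t)))
        atTop (nhds ((1 - 0 * 0)/(1 + 0 * 0 + 2 * a * 0))) :=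
      (tendsto_const_nhds.sub (te.mul te)).div ((tendsto_const_nhds.add (te.mul te)).add (te.const_mul _))
        (by norm_num)
    simp only [mul_zero, sub_zero, add_zero, div_one] at this
    refine this.congr fun t => ?_
    rw [Real.sinh_eq, Real.cosh_eq]
    have he : exp t * exp (-t) = 1 := by rw [← Real.exp_add]; simp
    have p1 := Real.exp_pos t
    have p2 := Real.exp_pos (-t)
    rw [div_eq_div_iff (by positivity) (by positivity)]
    generalize exp t = u at *
    generalize exp (-t) = v at *
    linear_combination (-(v + a)) * he
  have t3 : Tendsto (fun t => 1/(cosh t + a)) atTop (nhds 0) := by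
    have : Tendsto (fun t : ℝ => cosh t + a) atTop atTop := by
      refine tendsto_atTop_mono (f := fun t => exp t / 2) (fun t => ?_)
        (Real.tendsto_exp_atTop.atTop_div_const (by norm_num))
      rw [Real.cosh_eq]
      have := Real.exp_pos (-t)
      linarith
    simp only [one_div]
    exact this.inv_tendsto_atTop
  have t4 := ((t1.const_mul (kap0 a * (2/√(1 - a^2)))).add (t2.const_mul (kap1 a))).add
    (((t2.mul t3).const_mul (kap2 a)).add (((t2.mul t3).mul t3).const_mul (kap3 a)))
  convert t4 using 1
  · funext t
    have hC := Real.cosh_pos t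
    have hD : 0 < cosh t + a := by linarith
    unfold Lanti
    field_simp
    ring
  · simp

lemma L_integral {a : ℝ} (h0 : 0 < a) (h1 : a < 1) :
    IntegrableOn (fun t => cosh t / (cosh t + a)^4) (Ioi 0) ∧
    ∫ t in Ioi (0:ℝ), cosh t / (cosh t + a)^4 = kap0 a * (arccos a / √(1 - a^2)) + kap1 a := by
  have hd := fun t (_ : t ∈ Ici (0:ℝ)) => Lanti_hasDerivAt h0 h1 t
  have hpos : ∀ t ∈ Ioi (0:ℝ), 0 ≤ cosh t / (cosh t + a)^4 := by
    intro t _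
    have hC := Real.cosh_pos t
    positivity
  have hT := Lanti_tendsto h0 h1
  refine ⟨integrableOn_Ioi_deriv_of_nonneg' hd hpos hT, ?_⟩
  rw [integral_Ioi_of_hasDerivAt_of_nonneg' hd hpos hT]
  have := arctan_half h0 h1
  have e : arctan ((1 + a)/√(1 - a^2)) = π/2 - arccos a / 2 := by linarith
  unfold Lanti
  simp only [Real.exp_zero, Real.sinh_zero, e]
  ring
end Part10

section Part11
open Real Set Filter MeasureTheory

lemma moment_exp {b : ℝ} (hb : 0 < b) :
    IntegrableOn (fun s : ℝ => s^3 * exp (-(b * s))) (Ioi 0) ∧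
    ∫ s in Ioi (0:ℝ), s^3 * exp (-(b * s)) = 6 / b^4 := by
  have h1 := Real.integral_rpow_mul_exp_neg_mul_Ioi (a := 4) (r := b) (by norm_num) hb
  have hG : Real.Gamma 4 = 6 := by
    rw [show (4:ℝ) = ((3:ℕ):ℝ) + 1 by norm_num, Real.Gamma_nat_eq_factorial]
    norm_num [Nat.factorial]
  have e : ∀ s ∈ Ioi (0:ℝ), s ^ ((4:ℝ) - 1) * exp (-(b * s)) = s^3 * exp (-(b * s)) := by
    intro s _
    rw [show (4:ℝ) - 1 = ((3:ℕ):ℝ) by norm_num, Real.rpow_natCast]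
  rw [setIntegral_congr_fun measurableSet_Ioi e, hG] at h1
  have h2 : ∫ s in Ioi (0:ℝ), s^3 * exp (-(b * s)) = 6 / b^4 := by
    rw [h1, show (4:ℝ) = ((4:ℕ):ℝ) by norm_num, Real.rpow_natCast]
    field_simp
  refine ⟨?_, h2⟩
  by_contra hn
  have : ∫ s in Ioi (0:ℝ), s^3 * exp (-(b * s)) = 0 := integral_undef hn
  rw [this] at h2
  have : 0 < 6 / b^4 := by positivity
  linarith

lemma besselK_moment {y : ℝ} (hy : 1 < y) :
    ∫ s in Ioi (0:ℝ), s^3 * besselK 1 s * exp (-s / y)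
      = 6 * (kap0 (1/y) * (arccos (1/y) / √(1 - (1/y)^2)) + kap1 (1/y)) := by
  have hy0 : 0 < y := by linarith
  have ha0 : 0 < 1/y := by positivity
  have ha1 : 1/y < 1 := by rw [div_lt_one hy0]; exact hy
  obtain ⟨hI, hL⟩ := L_integral ha0 ha1
  set a := 1/y with ha
  let F : ℝ → ℝ → ℝ := fun s t => s^3 * (exp (-s * cosh t) * cosh (1 * t)) * exp (-s / y)
  have hF : ∀ s t, F s t = cosh t * (s^3 * exp (-((cosh t + a) * s))) := by
    intro s t
    simp only [F]
    rw [one_mul, show -((cosh t + a) * s) = -s * cosh t + -s / y by rw [ha]; ring, Real.exp_add]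
    ring
  have hFc : Continuous (Function.uncurry F) := by
    simp only [F, Function.uncurry_def]
    fun_prop
  have hIntg : ∀ t, ∫ s in Ioi (0:ℝ), F s t = 6 * (cosh t / (cosh t + a)^4) := by
    intro t
    have hD : 0 < cosh t + a := by have := Real.cosh_pos t; linarith
    simp_rw [hF]
    rw [integral_const_mul, (moment_exp hD).2]
    ring
  have hFn : ∀ t, ∀ s ∈ Ioi (0:ℝ), ‖F s t‖ = F s t := by
    intro t s hs
    rw [Real.norm_of_nonneg]
    rw [hF]
    have := Real.cosh_pos t
    have : (0:ℝ) < s := hs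
    positivity
  have hIntg2 : Integrable (Function.uncurry F)
      ((volume.restrict (Ioi (0:ℝ))).prod (volume.restrict (Ioi (0:ℝ)))) := by
    rw [integrable_prod_iff' hFc.aestronglyMeasurable]
    constructor
    · refine Eventually.of_forall fun t => ?_
      have hD : 0 < cosh t + a := by have := Real.cosh_pos t; linarith
      simp only [Function.uncurry, hF]
      exact (moment_exp hD).1.const_mul _
    · have : (fun t => ∫ s in Ioi (0:ℝ), ‖Function.uncurry F (s, t)‖)
          = fun t => 6 * (cosh t / (cosh t + a)^4) := by
        funext t
        rw [← hIntg t]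
        exact setIntegral_congr_fun measurableSet_Ioi (hFn t)
      rw [this]
      exact hI.const_mul 6
  have hsw := integral_integral_swap hIntg2
  have e1 : ∀ s, ∫ t in Ioi (0:ℝ), F s t = s^3 * besselK 1 s * exp (-s / y) := by
    intro s
    simp only [F]
    rw [integral_mul_const, integral_const_mul]
    rfl
  simp_rw [e1, hIntg] at hsw
  rw [hsw, integral_const_mul, hL]

lemma gFun_eq {y : ℝ} (hy : 1 < y) : gFun y = arccos (1/y) * (y * cF y) := by
  have hy0 : 0 < y := by linarith
  have h := sqm_pos hy
  have hs : 0 < √(y^2 - 1) := by positivity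
  unfold gFun cF
  rw [show 1 - 1/y^2 = (y^2 - 1)/y^2 by field_simp, Real.sqrt_div h.le, Real.sqrt_sq hy0.le]
  field_simp

lemma gFun_hasDerivAt {y : ℝ} (hy : 1 < y) :
    HasDerivAt gFun ((cF y)^2 - arccos (1/y) * (cF y)^3) y := by
  have hy0 : 0 < y := by linarith
  have hr := cF_rel hy
  have hd := (beta_hasDerivAt hy).mul ((hasDerivAt_id y).mul (cF_hasDerivAt hy))
  have hd2 : HasDerivAt (fun y => arccos (1/y) * (y * cF y)) ((cF y)^2 - arccos (1/y) * (cF y)^3) y := by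
    refine hd.congr_deriv ?_
    simp only [id, Pi.mul_apply]
    have : cF y / y * (y * cF y) = cF y^2 := by field_simp
    rw [this]
    linear_combination (-(arccos (1/y) * cF y)) * hr
  refine hd2.congr_of_eventuallyEq ?_
  filter_upwards [Ioi_mem_nhds hy] with z hz using gFun_eq hz

noncomputable def g2F (y : ℝ) : ℝ :=
  -(2 * y * (cF y)^4) - (cF y)^4 / y + 3 * arccos (1/y) * y * (cF y)^5

lemma gFun_deriv2 {y : ℝ} (hy : 1 < y) : deriv (deriv gFun) y = g2F y := by
  have hy0 : 0 < y := by linarith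
  have he : deriv gFun =ᶠ[nhds y] fun y => (cF y)^2 - arccos (1/y) * (cF y)^3 := by
    filter_upwards [Ioi_mem_nhds hy] with z hz using (gFun_hasDerivAt hz).deriv
  rw [he.deriv_eq]
  have hd := ((cF_hasDerivAt hy).pow 2).sub ((beta_hasDerivAt hy).mul ((cF_hasDerivAt hy).pow 3))
  refine (hd.congr_deriv ?_).deriv
  unfold g2F
  simp only [Pi.pow_apply]
  norm_num
  field_simp
  ring

noncomputable def PhiF (y : ℝ) : ℝ := 4/π^2 * TF y * (PF y - π^2 * (cF y)^3 / 32)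
noncomputable def dPhi (y : ℝ) : ℝ :=
  4/π^2 * (1 / (y * cF y) * (PF y - π^2 * (cF y)^3 / 32)
    + TF y * (-(rF y / 2) + 3 * π^2 * y * (cF y)^5 / 32))

lemma PhiF_hasDerivAt {y : ℝ} (hy : 1 < y) : HasDerivAt PhiF (dPhi y) y := by
  have hd := ((TF_hasDerivAt hy).const_mul (4/π^2)).mul ((PF_hasDerivAt hy).sub
    ((((cF_hasDerivAt hy).pow 3).const_mul (π^2)).div_const 32))
  refine hd.congr_deriv ?_
  unfold dPhi
  simp only [Pi.pow_apply, Pi.sub_apply]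
  norm_num
  ring

lemma sqrt_eq_cF {y : ℝ} : √(y^2 - 1) = 1 / cF y := by
  unfold cF; rw [one_div_one_div]

lemma TF_eq {y : ℝ} : TF y = 1 / cF y - arccos (1/y) := by
  unfold TF; rw [sqrt_eq_cF]

lemma kap1_eq {y : ℝ} (hy : 1 < y) :
    kap1 (1/y) = -(1/y * (1 + (cF y)^2)^2 * (13/6 + 5/2 * (cF y)^2)) := by
  have hy0 : 0 < y := by linarith
  have hc := cF_pos hy
  have hr := cF_rel hy
  have h1a : 1 - (1/y)^2 = 1 / (1 + (cF y)^2) := by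
    rw [← hr]; field_simp
    linarith
  have hq : (1/y)^2 * (1 + (cF y)^2) = (cF y)^2 := by
    rw [← hr]; field_simp
  unfold kap1
  rw [h1a]
  generalize 1/y = a at *
  generalize cF y = c at *
  have hc1 : 0 < 1 + c^2 := by positivity
  field_simp
  linear_combination (-36 * a) * hq

lemma kap2_eq {y : ℝ} (hy : 1 < y) :
    kap2 (1/y) = (1 + (cF y)^2) * (3 + 5 * (cF y)^2) / 6 := by
  have hy0 : 0 < y := by linarith
  have hc := cF_pos hy
  have hr := cF_rel hy
  have h1a : 1 - (1/y)^2 = 1 / (1 + (cF y)^2) := by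
    rw [← hr]; field_simp
    linarith
  have hq : (1/y)^2 * (1 + (cF y)^2) = (cF y)^2 := by
    rw [← hr]; field_simp
  unfold kap2
  rw [h1a]
  generalize 1/y = a at *
  generalize cF y = c at *
  have hc1 : 0 < 1 + c^2 := by positivity
  field_simp
  linear_combination 2 * hq

lemma kap0_eq {y : ℝ} (hy : 1 < y) :
    kap0 (1/y) = (1 + (cF y)^2)^2 * (1 + 5 * (cF y)^2) / 2 := by
  have hy0 : 0 < y := by linarith
  have hr := cF_rel hy
  have hq : (1/y)^2 * (1 + (cF y)^2) = (cF y)^2 := by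
    rw [← hr]; field_simp
  unfold kap0
  rw [kap1_eq hy, kap2_eq hy]
  linear_combination ((1 + (cF y)^2) * (13/6 + 5/2 * (cF y)^2)) * hq

lemma theta0_eq {f : ℝ → ℝ} {t : ℝ} (ht : 0 < t) (hy : 1 < f t) :
    theta0 f t = π * f t * cF (f t) / t^2 * dPhi (f t) := by
  unfold theta0
  rw [besselK_moment hy, gFun_deriv2 hy, sqrt_eq_cF, kap0_eq hy, kap1_eq hy]
  unfold dPhi
  rw [TF_eq]
  generalize f t = y at *
  have hy0 : 0 < y := by linarith
  have hc := cF_pos hy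
  have hr := cF_rel hy
  have h := sqm_pos hy
  have hp := Real.pi_pos
  have hsq : √(1 - (1/y)^2) = 1 / (y * cF y) := by
    rw [show 1 - (1/y)^2 = (y^2 - 1)/y^2 by field_simp, Real.sqrt_div h.le, Real.sqrt_sq hy0.le,
      sqrt_eq_cF]
    field_simp
  rw [hsq]
  unfold g2F PF rF
  generalize arccos (1/y) = b at *
  generalize cF y = c at *
  have eA : -(π/(8*t^2)) * (-(2 * y * c^4) - c^4 / y + 3 * b * y * c^5) * y / (1/c)
      = π * y * c / t^2 * (4/π^2 * (1/(y*c) * (-(π^2 * c^3/32)) + (1/c - b) * (3 * π^2 * y * c^5/32))) := by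
    field_simp
    linear_combination (-32) * hr
  have eB : 1/c / (6 * π * t^2 * y^3) * (6 * ((1 + c^2)^2 * (1 + 5 * c^2) / 2 * (b / (1/(y*c)))
        + -(1/y * (1+c^2)^2 * (13/6 + 5/2 * c^2))))
      = π * y * c / t^2 * (4/π^2 * (1/(y*c) * ((3*c+5*c^3)/24) + (1/c - b) * (-(y*(c^3 + 5 * c^5)/4/2)))) := by
    rw [← hr]
    field_simp
    linear_combination (144 + 720 * c^2) * hr
  rw [eA, eB]
  ring
end Part11

section Part12
open Real Set Filter MeasureTheory

lemma TF_strictMono : StrictMonoOn TF (Ici 1) := by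
  refine strictMonoOn_of_deriv_pos (convex_Ici 1) ?_ ?_
  · unfold TF
    have h1 : ContinuousOn (fun y : ℝ => 1/y) (Ici 1) :=
      continuousOn_const.div continuousOn_id (fun y hy => by
        have : (1:ℝ) ≤ y := hy
        show y ≠ 0
        linarith)
    exact (by fun_prop : Continuous fun y : ℝ => √(y^2-1)).continuousOn.sub
      (Real.continuous_arccos.comp_continuousOn h1)
  · intro y hy
    rw [interior_Ici] at hy
    have hy1 : 1 < y := hy
    rw [(TF_hasDerivAt hy1).deriv]
    have := cF_pos hy1
    have : 0 < y := by linarith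
    positivity

lemma TF_pos {y : ℝ} (hy : 1 < y) : 0 < TF y := by
  have h := TF_strictMono (Set.mem_Ici.2 (le_refl (1:ℝ))) (show y ∈ Ici 1 from hy.le) hy
  have : TF 1 = 0 := by simp [TF]
  linarith

lemma TF_le {y : ℝ} (hy : 1 < y) : TF y ≤ y := by
  unfold TF
  have h1 := Real.arccos_nonneg (1/y)
  have h2 : √(y^2 - 1) ≤ y := by
    rw [Real.sqrt_le_left (by linarith)]; linarith
  linarith

section inverse
variable {f : ℝ → ℝ} (hf : ∀ t : ℝ, 0 < t → 1 < f t ∧ sigmaF (f t) = t)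

lemma TF_f (hf : ∀ t : ℝ, 0 < t → 1 < f t ∧ sigmaF (f t) = t) {t : ℝ} (ht : 0 < t) :
    TF (f t) = π / t := by
  obtain ⟨h1, h2⟩ := hf t ht
  have := TF_pos h1
  have e : sigmaF (f t) = π / TF (f t) := rfl
  rw [e] at h2
  rw [div_eq_iff this.ne'] at h2
  rw [eq_div_iff ht.ne', h2]
  ring

lemma inv_hasDerivAt (hf : ∀ t : ℝ, 0 < t → 1 < f t ∧ sigmaF (f t) = t) {u : ℝ} (hu : 0 < u) :
    HasDerivAt (fun u => f (π/u)) (f (π/u) * cF (f (π/u))) u := by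
  have hp := Real.pi_pos
  have h1 : ∀ v, 0 < v → 1 < f (π/v) ∧ TF (f (π/v)) = v := by
    intro v hv
    have h := div_pos hp hv
    refine ⟨(hf _ h).1, ?_⟩
    rw [TF_f hf h]; field_simp
  have hm : StrictMonoOn (fun u => f (π/u)) (Ioi 0) := by
    intro v hv w hw hvw
    have hv := h1 v hv
    have hw := h1 w hw
    rw [← TF_strictMono.lt_iff_lt (show f (π/v) ∈ Ici 1 from hv.1.le) (show f (π/w) ∈ Ici 1 from hw.1.le),
      hv.2, hw.2]
    exact hvw
  have hc : ContinuousAt (fun u => f (π/u)) u := by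
    refine hm.continuousAt_of_image_mem_nhds (Ioi_mem_nhds hu) ?_
    refine mem_of_superset (Ioi_mem_nhds (h1 u hu).1) ?_
    intro y hy
    have hy : 1 < y := hy
    refine ⟨TF y, TF_pos hy, ?_⟩
    have h2 := h1 (TF y) (TF_pos hy)
    exact TF_strictMono.injOn (show f (π/TF y) ∈ Ici 1 from h2.1.le) (show y ∈ Ici 1 from hy.le) h2.2
  have hy := (h1 u hu).1
  have hcp := cF_pos hy
  have hy0 : 0 < f (π/u) := by linarith
  have := HasDerivAt.of_local_left_inverse hc (TF_hasDerivAt hy) (by positivity) (by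
    filter_upwards [Ioi_mem_nhds hu] with v hv using (h1 v hv).2)
  refine this.congr_deriv ?_
  simp

lemma f_hasDerivAt (hf : ∀ t : ℝ, 0 < t → 1 < f t ∧ sigmaF (f t) = t) {t : ℝ} (ht : 0 < t) :
    HasDerivAt f (-(π * f t * cF (f t) / t^2)) t := by
  have hp := Real.pi_pos
  have h1 : HasDerivAt (fun t : ℝ => π/t) (-(π/t^2)) t := by
    have := (hasDerivAt_inv ht.ne').const_mul π
    refine this.congr_deriv ?_
    field_simp
  have h2 := (inv_hasDerivAt hf (div_pos hp ht)).comp t h1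
  have e : π/(π/t) = t := by field_simp
  rw [e] at h2
  refine (h2.congr_deriv (by ring)).congr_of_eventuallyEq ?_
  filter_upwards [Ioi_mem_nhds ht] with s hs
  have hs : 0 < s := hs
  simp only [Function.comp]
  congr 1
  field_simp

lemma f_tendsto (hf : ∀ t : ℝ, 0 < t → 1 < f t ∧ sigmaF (f t) = t) :
    Tendsto f (nhdsWithin 0 (Ioi 0)) atTop := by
  have hp := Real.pi_pos
  have h : Tendsto (fun t : ℝ => π * t⁻¹) (nhdsWithin 0 (Ioi 0)) atTop :=
    tendsto_inv_nhdsGT_zero.const_mul_atTop hp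
  refine tendsto_atTop_mono' _ ?_ h
  filter_upwards [self_mem_nhdsWithin] with t ht
  have := TF_le (hf t ht).1
  rw [TF_f hf ht] at this
  rw [← div_eq_mul_inv]
  exact this

lemma f_anti (hf : ∀ t : ℝ, 0 < t → 1 < f t ∧ sigmaF (f t) = t) {s t : ℝ} (hs : 0 < s) (hst : s ≤ t) :
    f t ≤ f s := by
  have ht : 0 < t := by linarith
  rw [← TF_strictMono.le_iff_le (show f t ∈ Ici 1 from (hf t ht).1.le)
    (show f s ∈ Ici 1 from (hf s hs).1.le), TF_f hf ht, TF_f hf hs]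
  have := Real.pi_pos
  gcongr
end inverse

lemma dPhi_cont {y : ℝ} (hy : 1 < y) : ContinuousAt dPhi y := by
  have h1 := (cF_hasDerivAt hy).continuousAt
  have h2 := (PF_hasDerivAt hy).continuousAt
  have h3 := (TF_hasDerivAt hy).continuousAt
  have hc := cF_pos hy
  have : y * cF y ≠ 0 := by
    have : 0 < y := by linarith
    positivity
  unfold dPhi rF
  fun_prop (disch := assumption)

lemma PhiF_tendsto : Tendsto PhiF atTop (nhds (1/(2*π^2))) := by
  have hc := cF_tendsto
  have hb : Tendsto (fun y : ℝ => arccos (1/y)) atTop (nhds (arccos 0)) := by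
    refine (Real.continuous_arccos.tendsto 0).comp ?_
    refine (tendsto_inv_atTop_zero (𝕜 := ℝ)).congr fun y => ?_
    rw [one_div]
  have hT : Tendsto (fun y => 1 - arccos (1/y) * cF y) atTop (nhds (1 - arccos 0 * 0)) :=
    tendsto_const_nhds.sub (hb.mul hc)
  have h := (hT.mul (((hc.pow 2).const_mul (5/24 - π^2/32)).const_add (3/24))).const_mul (4/π^2)
  have e : 4/π^2 * ((1 - arccos 0 * 0) * (3/24 + (5/24 - π^2/32) * 0^2)) = 1/(2*π^2) := by
    have := Real.pi_pos
    field_simp; norm_num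
  rw [e] at h
  refine h.congr' ?_
  filter_upwards [eventually_gt_atTop 1] with y hy
  have hcp := cF_pos hy
  unfold PhiF PF
  rw [TF_eq]
  field_simp
  ring

lemma theta0_form {y : ℝ} (hy : 1 < y) (t : ℝ) (ht : TF y = π / t) (h0 : 0 < t) :
    π * y * cF y / t^2 * dPhi y = (y * cF y) / π * (TF y / y)^2 * (4/π^2) *
      ((-(13/24 * cF y * (y * cF y)) - 5/8 * (y * cF y) * (cF y)^3
        + arccos (1/y) * ((y * cF y)^3 + 5 * (y * cF y)^3 * (cF y)^2)/8)
      + π^2/32 * (-(cF y * (y * cF y)) + 3 * (y * cF y)^3 * cF y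
        - 3 * arccos (1/y) * (y * cF y)^3 * (cF y)^2)) := by
  have hy0 : 0 < y := by linarith
  have hc := cF_pos hy
  have hr := cF_rel hy
  have hp := Real.pi_pos
  have e1 : π * y * cF y / t^2 = (y * cF y) / π * (TF y)^2 := by
    rw [ht]; field_simp
  rw [e1]
  have e2 : y^2 * (1 / (y * cF y) * PF y + TF y * -(rF y/2))
      = -(13/24 * cF y * (y * cF y)) - 5/8 * (y * cF y) * (cF y)^3
        + arccos (1/y) * ((y * cF y)^3 + 5 * (y * cF y)^3 * (cF y)^2)/8 := by
    unfold PF rF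
    rw [TF_eq]
    generalize arccos (1/y) = b
    generalize cF y = c at *
    field_simp
    linear_combination (-192 - 960 * c^2) * hr
  have e3 : y^2 * (1 / (y * cF y) * (-(π^2 * (cF y)^3/32)) + TF y * (3 * π^2 * y * (cF y)^5/32))
      = π^2/32 * (-(cF y * (y * cF y)) + 3 * (y * cF y)^3 * cF y
        - 3 * arccos (1/y) * (y * cF y)^3 * (cF y)^2) := by
    rw [TF_eq]
    generalize arccos (1/y) = b
    generalize cF y = c at *
    field_simp
    ring
  rw [← e2, ← e3]
  unfold dPhi
  field_simp
  ring

lemma theta0_integral {f : ℝ → ℝ} (hf : ∀ t : ℝ, 0 < t → 1 < f t ∧ sigmaF (f t) = t)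
    {x : ℝ} (hx : 0 < x) : ∫ t in (0:ℝ)..x, theta0 f t = 1/(2*π^2) - PhiF (f x) := by
  have hp := Real.pi_pos
  have hth : ∀ t, 0 < t → theta0 f t = π * f t * cF (f t) / t^2 * dPhi (f t) :=
    fun t ht => theta0_eq ht (hf t ht).1
  have hd : ∀ t, 0 < t → HasDerivAt (fun t => -PhiF (f t)) (theta0 f t) t := by
    intro t ht
    have := ((PhiF_hasDerivAt (hf t ht).1).comp t (f_hasDerivAt hf ht)).neg
    refine this.congr_deriv ?_
    rw [hth t ht]; ring
  have hcont : ContinuousOn (theta0 f) (Ioc 0 x) := by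
    have : ContinuousOn (fun t => π * f t * cF (f t) / t^2 * dPhi (f t)) (Ioc 0 x) := by
      intro t ht
      have ht0 : 0 < t := ht.1
      have h1 := (f_hasDerivAt hf ht0).continuousAt
      have h2 : ContinuousAt (fun t => cF (f t)) t :=
        (cF_hasDerivAt (hf t ht0).1).continuousAt.comp h1
      have h3 : ContinuousAt (fun t => dPhi (f t)) t :=
        (dPhi_cont (hf t ht0).1).comp h1
      have h4 : t^2 ≠ 0 := by positivity
      exact (((continuousAt_const.mul h1).mul h2).div (continuousAt_id.pow 2) h4 |>.mul h3).continuousWithinAt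
    exact this.congr fun t ht => hth t ht.1
  have hIntg : IntervalIntegrable (theta0 f) volume 0 x := by
    rw [intervalIntegrable_iff_integrableOn_Ioc_of_le hx.le]
    set M := 1 + cF (f x) with hM
    let R : ℝ × ℝ × ℝ × ℝ → ℝ := fun p => p.1 / π * (p.2.2.2)^2 * (4/π^2) *
      ((-(13/24 * p.2.1 * p.1) - 5/8 * p.1 * p.2.1^3
        + p.2.2.1 * (p.1^3 + 5 * p.1^3 * p.2.1^2)/8)
      + π^2/32 * (-(p.2.1 * p.1) + 3 * p.1^3 * p.2.1
        - 3 * p.2.2.1 * p.1^3 * p.2.1^2))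
    have hR : Continuous R := by simp only [R]; fun_prop
    have hK : IsCompact ((Icc (0:ℝ) M) ×ˢ ((Icc (0:ℝ) M) ×ˢ ((Icc (0:ℝ) π) ×ˢ (Icc (0:ℝ) 1)))) :=
      isCompact_Icc.prod (isCompact_Icc.prod (isCompact_Icc.prod isCompact_Icc))
    obtain ⟨C, hC⟩ := hK.exists_bound_of_continuousOn hR.continuousOn
    refine Integrable.of_bound (C := C) (hcont.aestronglyMeasurable measurableSet_Ioc) ?_
    refine (ae_restrict_iff' measurableSet_Ioc).2 (Eventually.of_forall fun t ht => ?_)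
    have hy := (hf t ht.1).1
    have hT := TF_f hf ht.1
    have hy0 : 0 < f t := by linarith
    have hc := cF_pos hy
    have hb := cF_bound (hf x hx).1 (f_anti hf ht.1 ht.2)
    rw [hth t ht.1, theta0_form hy t hT ht.1]
    have hw : f t * cF (f t) ≤ M := by
      rw [le_div_iff₀ hy0] at hb; linarith
    refine hC (f t * cF (f t), cF (f t), arccos (1/f t), TF (f t)/f t)
      ⟨⟨by positivity, hw⟩, ⟨hc.le, ?_⟩, ⟨Real.arccos_nonneg _, Real.arccos_le_pi _⟩,
        ⟨(div_pos (TF_pos hy) hy0).le, ?_⟩⟩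
    · show cF (f t) ≤ M
      nlinarith
    · show TF (f t) / f t ≤ 1
      rw [div_le_one hy0]; exact TF_le hy
  rw [intervalIntegral.integral_eq_sub_of_hasDerivAt_of_tendsto hx (fun t ht => hd t ht.1) hIntg
    (PhiF_tendsto.comp (f_tendsto hf)).neg ((hd x hx).continuousAt.tendsto.mono_left nhdsWithin_le_nhds)]
  ring
end Part12

section Part13
open Real Set Filter MeasureTheory

lemma zero_eq {J : ℝ → ℕ → ℝ} (hJ : IsEnum J) {f : ℝ → ℝ}
    (hf : ∀ t : ℝ, 0 < t → 1 < f t ∧ sigmaF (f t) = t) {x : ℝ} (hx : 0 < x) :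
    ∃ C y0 : ℝ, 1 < y0 ∧ ∀ᶠ k : ℕ in atTop, y0 < J (x*k) k / (x*k) ∧
      |(k - 1/4) * π - x * k * TF (J (x*k) k / (x*k)) + PF (J (x*k) k / (x*k)) / (x*k)| ≤ C / (k:ℝ)^2 := by
  have hp := Real.pi_pos
  obtain ⟨hY, -⟩ := hf x hx
  have hTY := TF_f hf hx
  set y0 := (1 + f x)/2 with hy0
  have hy1 : 1 < y0 := by rw [hy0]; linarith
  have hy2 : y0 < f x := by rw [hy0]; linarith
  have hgap : 0 < TF (f x) - TF y0 :=
    sub_pos.2 (TF_strictMono (Set.mem_Ici.2 hy1.le) (Set.mem_Ici.2 hY.le) hy2)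
  have hCb : 0 ≤ Cb y0 := by
    have := cF_pos hy1
    unfold Cb; positivity
  have hlim : Tendsto (fun k : ℕ => x * (k:ℝ) * (TF (f x) - TF y0)) atTop atTop :=
    (tendsto_natCast_atTop_atTop.const_mul_atTop hx).atTop_mul_const hgap
  have hlim2 : Tendsto (fun k : ℕ => x * (k:ℝ)) atTop atTop :=
    tendsto_natCast_atTop_atTop.const_mul_atTop hx
  refine ⟨2 * Cb y0 / x^2, y0, hy1, ?_⟩
  filter_upwards [hlim.eventually_gt_atTop (π/4 + 2 * Cb y0 + |kF y0|),
    hlim2.eventually_ge_atTop 1, eventually_ge_atTop 1] with k hk1 hk2 hk3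
  have hk0 : (0:ℝ) < k := by exact_mod_cast hk3
  set ν := x * (k:ℝ) with hν
  have hν0 : 0 < ν := by linarith
  obtain ⟨θ, hθ, hidx⟩ := phase_index hJ (show 1/2 ≤ ν by linarith)
  have hb : ∀ y, y0 ≤ y → |DF ν θ y - (-(π/4))| ≤ 2 * Cb y0 / ν^2 := by
    intro y hy
    refine (hθ.2 y0 y hy1 hy).trans ?_
    have e1 : 1/ν^3 ≤ 1/ν^2 := by
      apply one_div_le_one_div_of_le (by positivity)
      exact pow_le_pow_right₀ hk2 (by norm_num)
    have e2 : 1/y ≤ 1 := by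
      rw [div_le_one (by linarith)]; linarith
    have e3 : 0 < 1/ν^2 := by positivity
    have e4 : 0 < 1/ν^3 := by positivity
    calc Cb y0 * (1/ν^2 + 1/ν^3) * (1/y) ≤ Cb y0 * (1/ν^2 + 1/ν^3) * 1 := by gcongr
      _ ≤ Cb y0 * (1/ν^2 + 1/ν^2) * 1 := by gcongr
      _ = 2 * Cb y0 / ν^2 := by ring
  have hkp : (k:ℝ) * π = ν * TF (f x) := by rw [hTY, hν]; field_simp
  have hstart : θ y0 < ((k:ℝ) - 1/2) * π := by
    have h1 := (abs_le.1 (hb y0 le_rfl)).2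
    have h2 : 2 * Cb y0 / ν^2 ≤ 2 * Cb y0 := by
      apply div_le_self (by positivity)
      exact one_le_pow₀ hk2
    have h3 : 0 ≤ PF y0 / ν := by
      have := cF_pos hy1
      unfold PF; positivity
    have h4 : kF y0/(4*ν^2) * sin (2 * θ y0) ≤ |kF y0| := by
      refine (le_abs_self _).trans ?_
      rw [abs_mul, abs_div]
      have : |sin (2 * θ y0)| ≤ 1 := Real.abs_sin_le_one _
      have h5 : |kF y0| / |4 * ν^2| ≤ |kF y0| := by
        apply div_le_self (abs_nonneg _)
        rw [abs_of_pos (by positivity)]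
        nlinarith
      calc |kF y0| / |4 * ν^2| * |sin (2 * θ y0)| ≤ |kF y0| * 1 := by gcongr
        _ = _ := mul_one _
    unfold DF at h1
    nlinarith
  obtain ⟨y, hy, hyθ⟩ := phase_hits hν0 hθ hy1 hstart
  have hJy := hidx k hk3 y (by linarith) hyθ
  have hyy : J ν k / ν = y := by rw [hJy]; field_simp
  rw [hyy]
  refine ⟨hy, ?_⟩
  have h1 := hb y hy.le
  unfold DF at h1
  have hs : sin (2 * θ y) = 0 := by
    rw [hyθ]
    have : 2 * (((k:ℝ) - 1/2) * π) = ((2 * (k:ℤ) - 1 : ℤ) : ℝ) * π := by push_cast; ring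
    rw [this]; exact Real.sin_int_mul_pi _
  rw [hs, hyθ] at h1
  have e : (2 * Cb y0 / x^2) / (k:ℝ)^2 = 2 * Cb y0 / ν^2 := by rw [hν]; field_simp
  rw [e]
  convert h1 using 2
  ring

lemma inv_taylor {f : ℝ → ℝ} (hf : ∀ t : ℝ, 0 < t → 1 < f t ∧ sigmaF (f t) = t) {u : ℝ} (hu : 0 < u) :
    Tendsto (fun d => (f (π/(u+d)) - f (π/u) - f (π/u) * cF (f (π/u)) * d) / d^2)
      (nhdsWithin 0 {0}ᶜ) (nhds (-(f (π/u) * (cF (f (π/u)))^4)/2)) := by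
  have hp := Real.pi_pos
  set G : ℝ → ℝ := fun u => f (π/u) with hG
  have hy : 1 < G u := (hf _ (div_pos hp hu)).1
  have hr := cF_rel hy
  have hGd : ∀ v, 0 < v → HasDerivAt G (G v * cF (G v)) v := fun v hv => inv_hasDerivAt hf hv
  have hH : HasDerivAt (fun v => G v * cF (G v)) (-(G u * (cF (G u))^4)) u := by
    have h2 := (hGd u hu).mul ((cF_hasDerivAt hy).comp u (hGd u hu))
    refine h2.congr_deriv ?_
    simp only [Function.comp]
    linear_combination (-(G u * cF (G u)^2)) * hr
  have hev : ∀ᶠ d : ℝ in nhdsWithin 0 {0}ᶜ, 0 < u + d := by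
    have : ∀ᶠ d : ℝ in nhds 0, 0 < u + d := by
      filter_upwards [Ioi_mem_nhds (show -u < 0 by linarith)] with d hd
      have : -u < d := hd
      linarith
    exact this.filter_mono nhdsWithin_le_nhds
  have hc0 : ContinuousAt (fun d : ℝ => G (u+d) - G u - G u * cF (G u) * d) 0 := by
    have h1 : ContinuousAt (fun d : ℝ => G (u + d)) 0 := by
      have := (hGd u hu).continuousAt
      refine ContinuousAt.comp (g := G) (f := fun d => u + d) (by simpa using this) (by fun_prop)
    exact (h1.sub continuousAt_const).sub (continuousAt_const.mul continuousAt_id)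
  refine HasDerivAt.lhopital_zero_nhdsNE
    (f := fun d => G (u+d) - G u - G u * cF (G u) * d) (g := fun d => d^2)
    (f' := fun d => G (u+d) * cF (G (u+d)) - G u * cF (G u)) (g' := fun d => 2 * d) ?_ ?_ ?_ ?_ ?_ ?_
  · filter_upwards [hev] with d hd
    have h1 := (hGd (u+d) hd).comp_const_add u d
    have h2 := (h1.sub_const (G u)).sub ((hasDerivAt_id d).const_mul (G u * cF (G u)))
    exact h2.congr_deriv (by ring)
  · refine Eventually.of_forall fun d => ?_
    simpa using hasDerivAt_pow 2 d
  · filter_upwards [self_mem_nhdsWithin] with d hd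
    have : d ≠ 0 := hd
    simpa using this
  · have := hc0.tendsto.mono_left (nhdsWithin_le_nhds (s := {0}ᶜ))
    simpa using this
  · have : ContinuousAt (fun d : ℝ => d^2) 0 := by fun_prop
    have := this.tendsto.mono_left (nhdsWithin_le_nhds (s := {0}ᶜ))
    simpa using this
  · have h1 := hasDerivAt_iff_tendsto_slope_zero.1 hH
    have h2 := h1.div_const 2
    refine h2.congr' ?_
    filter_upwards [self_mem_nhdsWithin] with d hd
    have : d ≠ 0 := hd
    simp only [smul_eq_mul]
    field_simp

theorem final {x : ℝ} (hx : 0 < x) {J : ℝ → ℕ → ℝ} (hJ : IsEnum J) {f : ℝ → ℝ}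
    (hf : ∀ t : ℝ, 0 < t → 1 < f t ∧ sigmaF (f t) = t) :
    Filter.Tendsto
      (fun k : ℕ => (k:ℝ)^2 *
        (J (x*k) k / k - x * f x
          - (-(Real.pi/(4*k)) * (f x / Real.sqrt ((f x)^2 - 1)) + zetaC f x / (k:ℝ)^2)))
      Filter.atTop (nhds 0) := by
  have hp := Real.pi_pos
  obtain ⟨C, y0, hy0, hev⟩ := zero_eq hJ hf hx
  set Y : ℕ → ℝ := fun k => J (x*k) k / (x*k) with hYdef
  set δ : ℕ → ℝ := fun k => TF (Y k) - π/x with hδ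
  have hev : ∀ᶠ k : ℕ in atTop, y0 < Y k ∧
      |(k - 1/4) * π - x * k * TF (Y k) + PF (Y k) / (x*k)| ≤ C / (k:ℝ)^2 := hev
  set e : ℕ → ℝ := fun k => (k - 1/4) * π - x * k * TF (Y k) + PF (Y k) / (x*k) with he
  have hkk : ∀ᶠ k : ℕ in atTop, (0:ℝ) < k := by
    filter_upwards [eventually_gt_atTop 0] with k hk
    exact_mod_cast hk
  have hinv : Tendsto (fun k : ℕ => ((k:ℝ))⁻¹) atTop (nhds 0) := tendsto_inv_atTop_nhds_zero_nat
  have hke : Tendsto (fun k : ℕ => (k:ℝ) * e k) atTop (nhds 0) := by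
    refine squeeze_zero_norm' (a := fun k : ℕ => C * (k:ℝ)⁻¹) ?_ (by simpa using hinv.const_mul C)
    filter_upwards [hev, hkk] with k hk hk0
    rw [Real.norm_eq_abs, abs_mul, abs_of_pos hk0]
    calc (k:ℝ) * |e k| ≤ k * (C / (k:ℝ)^2) := by gcongr; exact hk.2
      _ = C * (k:ℝ)⁻¹ := by field_simp
  have hform : ∀ᶠ k : ℕ in atTop, (k:ℝ)^2 * (δ k + π/(4*x*k)) = PF (Y k)/x^2 - k * e k / x := by
    filter_upwards [hkk] with k hk0
    simp only [hδ, he]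
    field_simp
    ring
  have hkδ : Tendsto (fun k : ℕ => (k:ℝ) * δ k) atTop (nhds (-(π/(4*x)))) := by
    have hb : Tendsto (fun k : ℕ => (PF (Y k)/x^2 - k * e k / x) * (k:ℝ)⁻¹) atTop (nhds 0) := by
      have h1 : Tendsto (fun k : ℕ => PF (Y k) * (k:ℝ)⁻¹) atTop (nhds 0) := by
        set M := 1 + cF y0 with hM
        refine squeeze_zero_norm' (a := fun k : ℕ => (3*M + 5*M^3)/24 * (k:ℝ)⁻¹) ?_
          (by simpa using hinv.const_mul ((3*M + 5*M^3)/24))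
        filter_upwards [hev, hkk] with k hk hk0
        have hc := cF_pos (show 1 < Y k by linarith)
        have hcM : cF (Y k) ≤ M := by
          refine (cF_bound hy0 hk.1.le).trans ?_
          have := cF_pos hy0
          apply div_le_self (by positivity)
          linarith
        have hP : 0 < PF (Y k) := by unfold PF; positivity
        rw [norm_mul, Real.norm_of_nonneg hP.le, Real.norm_of_nonneg (by positivity)]
        gcongr
        unfold PF
        gcongr
      have := (h1.div_const (x^2)).sub ((hke.mul hinv).div_const x)
      simp only [mul_zero, zero_div, sub_zero] at this
      refine this.congr fun k => ?_
      ring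
    have h2 := hb.sub_const (π/(4*x))
    rw [zero_sub] at h2
    refine h2.congr' ?_
    filter_upwards [hform, hkk] with k hk hk0
    rw [← hk]
    field_simp
    ring
  have hδ0 : Tendsto δ atTop (nhds 0) := by
    have := hkδ.mul hinv
    rw [mul_zero] at this
    refine this.congr' ?_
    filter_upwards [hkk] with k hk0
    field_simp
  have hu : 0 < π/x := div_pos hp hx
  have hpu : π/(π/x) = x := by field_simp
  have hYG : ∀ᶠ k : ℕ in atTop, Y k = f (π/(π/x + δ k)) := by
    filter_upwards [hev] with k hk
    have hyk : 1 < Y k := by linarith [hk.1]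
    have e1 : π/x + δ k = TF (Y k) := by simp only [hδ]; ring
    rw [e1]
    have ht := div_pos hp (TF_pos hyk)
    refine (TF_strictMono.injOn (Set.mem_Ici.2 (hf _ ht).1.le) (Set.mem_Ici.2 hyk.le) ?_).symm
    rw [TF_f hf ht]
    have := TF_pos hyk
    field_simp
  have hYlim : Tendsto Y atTop (nhds (f x)) := by
    have h1 := (inv_hasDerivAt hf hu).continuousAt.tendsto
    have h2 : Tendsto (fun k => π/x + δ k) atTop (nhds (π/x)) := by
      simpa using hδ0.const_add (π/x)
    have h3 := h1.comp h2
    rw [hpu] at h3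
    refine h3.congr' ?_
    filter_upwards [hYG] with k hk using hk.symm
  have hY1 := (hf x hx).1
  have hPlim : Tendsto (fun k => PF (Y k)) atTop (nhds (PF (f x))) :=
    (PF_hasDerivAt hY1).continuousAt.tendsto.comp hYlim
  have hδ2 : Tendsto (fun k : ℕ => (k:ℝ)^2 * (δ k + π/(4*x*k))) atTop (nhds (PF (f x)/x^2)) := by
    have := (hPlim.div_const (x^2)).sub (hke.div_const x)
    rw [zero_div, sub_zero] at this
    refine this.congr' ?_
    filter_upwards [hform] with k hk using hk.symm
  have hδne : ∀ᶠ k : ℕ in atTop, δ k ≠ 0 := by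
    have h0 : -(π/(4*x)) < 0 := by
      have : 0 < π/(4*x) := by positivity
      linarith
    filter_upwards [hkδ.eventually_lt_const h0] with k hk h
    rw [h, mul_zero] at hk
    exact lt_irrefl _ hk
  have htay := (inv_taylor hf hu).comp (tendsto_nhdsWithin_iff.2 ⟨hδ0, hδne⟩)
  rw [hpu] at htay
  have hmain := ((htay.mul (hkδ.pow 2)).add (hδ2.const_mul (f x * cF (f x)))).const_mul x
  have hz : zetaC f x = x * (-(f x * cF (f x)^4)/2 * (-(π/(4*x)))^2 + f x * cF (f x) * (PF (f x)/x^2)) := by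
    unfold zetaC
    rw [theta0_integral hf hx, sqrt_eq_cF]
    unfold PhiF
    rw [TF_f hf hx]
    have := cF_pos hY1
    field_simp
    ring
  rw [← hz] at hmain
  have hfin := hmain.sub_const (zetaC f x)
  rw [sub_self] at hfin
  refine hfin.congr' ?_
  filter_upwards [hYG, hδne, hkk] with k h1 h2 h3
  rw [sqrt_eq_cF]
  have hJk : J (x*k) k / k = x * Y k := by simp only [hYdef]; field_simp
  have hc := cF_pos hY1
  rw [hJk]
  simp only [Function.comp]
  rw [← h1]
  field_simp
  ring
end Part13

theorem stmt_8 (x : ℝ) (hx : 0 < x)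
    (J : ℝ → ℕ → ℝ)
    (hJpos : ∀ ν : ℝ, 0 ≤ ν → ∀ k : ℕ, 1 ≤ k → 0 < J ν k)
    (hJmono : ∀ ν : ℝ, 0 ≤ ν → ∀ k l : ℕ, 1 ≤ k → k < l → J ν k < J ν l)
    (hJzero : ∀ ν : ℝ, 0 ≤ ν → ∀ k : ℕ, 1 ≤ k → besselJ ν (J ν k) = 0)
    (hJall : ∀ ν : ℝ, 0 ≤ ν → ∀ z : ℝ, 0 < z → besselJ ν z = 0 →
      ∃ k : ℕ, 1 ≤ k ∧ J ν k = z)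
    (f : ℝ → ℝ) (hf : ∀ t : ℝ, 0 < t → 1 < f t ∧ sigmaF (f t) = t) :
    Filter.Tendsto
      (fun k : ℕ => (k:ℝ)^2 *
        (J (x*k) k / k - x * f x
          - (-(Real.pi/(4*k)) * (f x / Real.sqrt ((f x)^2 - 1)) + zetaC f x / (k:ℝ)^2)))
      Filter.atTop (nhds 0) := by
  exact final hx ⟨hJpos, hJmono, hJzero, hJall⟩ hf
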